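/- arXiv:1406.2230 — 2 statements merged into one kernel-verified Lean document; each statement's English description precedes it below -/
import Mathlib

section
/- Suppose a positive integer n can be factored as n = (N − a₁)(N + b₁) = (N − a₂)(N + b₂) with integers N, a₁, a₂, b₁, b₂ satisfying 0 ≤ a₁ < a₂ and 0 ≤ b₁ < b₂. Then a₂·b₂ ≥ N. -/
/-- If a positive integer `n` has two factorizations `(N - a₁)(N + b₁) = (N - a₂)(N + b₂)`
with `0 ≤ a₁ < a₂` and `0 ≤ b₁ < b₂`, then `a₂ * b₂ ≥ N`. -/
theorem almost_square_two_factorizations (n N a₁ a₂ b₁ b₂ : ℤ)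
    (hn : 0 < n)
    (h₁ : n = (N - a₁) * (N + b₁)) (h₂ : n = (N - a₂) * (N + b₂))
    (ha₁ : 0 ≤ a₁) (ha : a₁ < a₂) (hb₁ : 0 ≤ b₁) (hb : b₁ < b₂) :
    a₂ * b₂ ≥ N := by
  by_contra! hlt
  have hdiff : a₂ * b₂ - a₁ * b₁ = N * ((b₂ - a₂) - (b₁ - a₁)) := by linarith
  have hprod : a₁ * b₁ < a₂ * b₂ := mul_lt_mul'' ha hb ha₁ hb₁
  have hnonneg : 0 ≤ a₁ * b₁ := mul_nonneg ha₁ hb₁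
  have hN : 0 < N := by linarith
  have hk : 0 < (b₂ - a₂) - (b₁ - a₁) := pos_of_mul_pos_right (by linarith) hN.le
  have hNle : N ≤ N * ((b₂ - a₂) - (b₁ - a₁)) := le_mul_of_one_le_right hN.le hk
  linarith
end

section
/- There exists n₀ such that for every perfect square n = N² with n ≥ n₀, the number of divisors d of n satisfying √n − n^{1/4}·(log n)^{1/7} ≤ d ≤ √n + n^{1/4}·(log n)^{1/7} is at most five. -/
open Real
namespace MiddleDivisors


section ZeroEstimate
open Polynomial Matrix

/-- A zero estimate on `𝔾ₐ × 𝔾ₘ`: a polynomial with fewer than `P` powers of the additive variable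
and fewer than `L` powers of the multiplicative variable cannot vanish on a sumset `E + E` with
at least `P * L` distinct additive and multiplicative coordinates. -/
theorem eq_zero_of_vanishing_on_sumset {A : Type*} [Add A] {P L : ℕ}
    (p : Fin P → Fin L → ℝ) (E : Finset A) (t y : A → ℝ)
    (ht : ∀ a b, t (a + b) = t a + t b) (hy : ∀ a b, y (a + b) = y a * y b)
    (htE : Set.InjOn t E) (hyE : Set.InjOn y E) (hy0 : ∀ a, y a ≠ 0) (hE : P * L ≤ E.card)
    (hvan : ∀ a ∈ E, ∀ b ∈ E, ∑ k : Fin P, ∑ l : Fin L,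
      p k l * t (a + b) ^ (k : ℕ) * y (a + b) ^ (l : ℕ) = 0) : p = 0 := by
  classical
  by_contra hp
  obtain ⟨k₀, hk₀⟩ : ∃ k, p k ≠ 0 := Function.ne_iff.mp hp
  obtain ⟨l₀, hl₀⟩ : ∃ l, p k₀ l ≠ 0 := Function.ne_iff.mp hk₀
  have hP : 0 < P := lt_of_le_of_lt (Nat.zero_le _) k₀.2
  have hL : 0 < L := lt_of_le_of_lt (Nat.zero_le _) l₀.2
  let q : Fin L → ℝ[X] := fun l => ∑ k : Fin P, C (p k l) * X ^ (k : ℕ)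
  have hqdeg : ∀ l, (q l).natDegree ≤ P - 1 := by
    intro l
    refine natDegree_sum_le_of_forall_le _ _ ?_
    intro k _
    refine (natDegree_C_mul_X_pow_le _ _).trans ?_
    have := k.2
    omega
  have hqeval : ∀ l x, (q l).eval x = ∑ k : Fin P, p k l * x ^ (k : ℕ) := by
    intro l x
    simp [q, eval_finsetSum]
  have hql₀ : q l₀ ≠ 0 := by
    intro h
    have : (q l₀).coeff k₀ = p k₀ l₀ := by
      simp only [q, finsetSum_coeff, coeff_C_mul, coeff_X_pow]
      rw [Finset.sum_eq_single k₀]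
      · simp
      · intro b _ hb
        have : (k₀ : ℕ) ≠ b := fun h => hb (Fin.ext h.symm)
        simp [this]
      · simp
    rw [h] at this
    exact hl₀ (by simpa using this.symm)
  let q' : Fin L → ℝ[X] := fun l => if q l = 0 then 1 else q l
  have hq'0 : ∀ l, q' l ≠ 0 := by
    intro l
    simp only [q']
    split_ifs with h
    · exact one_ne_zero
    · exact h
  have hq'deg : ∀ l, (q' l).natDegree ≤ P - 1 := by
    intro l
    simp only [q']
    split_ifs with h
    · simp
    · exact hqdeg l
  obtain ⟨F, hFE, hFc⟩ : ∃ F ⊆ E, F.card = L :=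
    Finset.exists_subset_card_eq (le_trans (Nat.le_mul_of_pos_left L hP) hE)
  let e : Fin L ≃ F := (F.equivFinOfCardEq hFc).symm
  let M : Matrix (Fin L) (Fin L) ℝ[X] := Matrix.of fun i l =>
    (q' l).comp (X + C (t (e i))) * X ^ (P - 1 - (q' l).natDegree) * C (y (e i) ^ (l : ℕ))
  have hcompdeg : ∀ l c, ((q' l).comp (X + C c)).natDegree = (q' l).natDegree := by
    intro l c
    rw [natDegree_comp, natDegree_X_add_C, mul_one]
  have hMdeg : ∀ i l, (M i l).natDegree ≤ P - 1 := by
    intro i l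
    simp only [M, of_apply]
    refine (natDegree_mul_C_le _ _).trans (natDegree_mul_le.trans ?_)
    rw [hcompdeg, natDegree_X_pow]
    have := hq'deg l
    omega
  have hMcoeff : ∀ i l, (M i l).coeff (P - 1) = (q' l).leadingCoeff * y (e i) ^ (l : ℕ) := by
    intro i l
    have h1 := hq'deg l
    simp only [M, of_apply]
    rw [coeff_mul_C]
    congr 1
    have : P - 1 = (q' l).natDegree + (P - 1 - (q' l).natDegree) := by omega
    conv_lhs => rw [this]
    rw [Nat.add_sub_cancel_left, coeff_mul_X_pow]
    have h2 : ((q' l).comp (X + C (t (e i)))).leadingCoeff = (q' l).leadingCoeff := by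
      rw [leadingCoeff_comp (by simp), leadingCoeff_X_add_C, one_pow, mul_one]
    rw [leadingCoeff, hcompdeg] at h2
    exact h2
  have hdetdeg : M.det.natDegree ≤ L * (P - 1) := by
    rw [det_apply]
    refine natDegree_sum_le_of_forall_le _ _ ?_
    intro σ _
    refine (natDegree_smul_le _ _).trans ((natDegree_prod_le _ _).trans ?_)
    refine (Finset.sum_le_sum (fun i _ => hMdeg (σ i) i)).trans ?_
    simp
  have hdetcoeff : M.det.coeff (L * (P - 1)) ≠ 0 := by
    have : M.det.coeff (L * (P - 1)) =
        Matrix.det (Matrix.of fun i l : Fin L => (q' l).leadingCoeff * y (e i) ^ (l : ℕ)) := by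
      rw [det_apply, det_apply, finsetSum_coeff]
      refine Finset.sum_congr rfl fun σ _ => ?_
      rw [coeff_smul]
      congr 1
      have := coeff_prod_of_natDegree_le (s := Finset.univ) (fun i => M (σ i) i) (P - 1)
        (fun i _ => hMdeg (σ i) i)
      rw [Finset.card_univ, Fintype.card_fin] at this
      rw [this]
      exact Finset.prod_congr rfl fun i _ => hMcoeff _ _
    rw [this]
    have h2 : Matrix.det (Matrix.of fun i l : Fin L => (q' l).leadingCoeff * y (e i) ^ (l : ℕ)) =
        (∏ l, (q' l).leadingCoeff) * (vandermonde fun i => y (e i)).det := by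
      rw [← Matrix.det_mul_row]
      rfl
    rw [h2]
    refine mul_ne_zero (Finset.prod_ne_zero_iff.mpr fun l _ => leadingCoeff_ne_zero.mpr (hq'0 l)) ?_
    rw [det_vandermonde_ne_zero_iff]
    intro i j hij
    exact e.injective (Subtype.ext (hyE (hFE (e i).2) (hFE (e j).2) hij))
  have hroot : ∀ b ∈ E, M.det.eval (t b) = 0 := by
    intro b hb
    let N : Matrix (Fin L) (Fin L) ℝ := Matrix.of fun i l =>
      (q' l).eval (t b + t (e i)) * y (e i) ^ (l : ℕ)
    have hN : N.det = 0 := by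
      rw [← exists_mulVec_eq_zero_iff]
      refine ⟨fun l => if q l = 0 then 0 else y b ^ (l : ℕ), ?_, ?_⟩
      · intro h
        have := congrFun h l₀
        simp only [hql₀, if_false, Pi.zero_apply] at this
        exact pow_ne_zero _ (hy0 b) this
      · ext i
        have h := hvan (e i) (hFE (e i).2) b hb
        rw [Finset.sum_comm] at h
        simp only [mulVec, dotProduct, Pi.zero_apply]
        refine Eq.trans (Finset.sum_congr rfl fun l _ => ?_) h
        simp only [N, q', of_apply]
        split_ifs with hl
        · have := hqeval l (t (e i + b))
          rw [hl, eval_zero] at this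
          rw [← Finset.sum_mul, ← this]
          simp
        · rw [hqeval, ← Finset.sum_mul, hy, ht, add_comm (t b), mul_pow]
          ring
    have : M.det.eval (t b) = Matrix.det (Matrix.of fun i l => (t b) ^ (P - 1 - (q' l).natDegree) * N i l) := by
      rw [← coe_evalRingHom, RingHom.map_det]
      congr 1
      ext i l
      simp [M, N, RingHom.mapMatrix_apply, eval_comp]
      ring
    rw [this, Matrix.det_mul_row, hN, mul_zero]
  have hzero : M.det = 0 := by
    by_contra h0
    have h1 : (E.image t).card ≤ M.det.roots.toFinset.card := by
      refine Finset.card_le_card ?_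
      intro x hx
      obtain ⟨b, hb, rfl⟩ := Finset.mem_image.mp hx
      rw [Multiset.mem_toFinset, mem_roots h0]
      exact hroot b hb
    rw [Finset.card_image_of_injOn htE] at h1
    have h2 := (Multiset.toFinset_card_le _).trans (M.det.card_roots')
    have h3 : P * L ≤ L * (P - 1) := hE.trans (h1.trans (h2.trans hdetdeg))
    have h4 : L * (P - 1) < L * P := Nat.mul_lt_mul_of_pos_left (by omega) hL
    rw [mul_comm P L] at h3
    omega
  exact hdetcoeff (by rw [hzero]; simp)

end ZeroEstimate


section Lattice

/-- An integer vector orthogonal to `(1, m, n)` whose entries have square at most `3 M`. -/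
theorem exists_short_orthogonal (m n : ℤ) (M : ℕ) (hM : 1 ≤ M) (hm : |m| ≤ M) (hn : |n| ≤ M) :
    ∃ w₁ w₂ : ℤ, (w₁ ≠ 0 ∨ w₂ ≠ 0) ∧ (m * w₁ + n * w₂) ^ 2 ≤ 3 * M ∧ w₁ ^ 2 ≤ 3 * M ∧
      w₂ ^ 2 ≤ 3 * M := by
  let _ : SeminormedAddCommGroup (Matrix (Fin 1) (Fin 3) ℤ) := Matrix.seminormedAddCommGroup
  let A : Matrix (Fin 1) (Fin 3) ℤ := !![1, m, n]
  obtain ⟨t, ht0, hAt, hnorm⟩ := Int.Matrix.exists_ne_zero_int_vec_norm_le A (by simp) (by simp)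
  have hA : ‖A‖ ≤ M := by
    rw [Matrix.norm_le_iff (by positivity)]
    intro i j
    fin_cases i
    have hm' : |(m : ℝ)| ≤ M := by exact_mod_cast hm
    have hn' : |(n : ℝ)| ≤ M := by exact_mod_cast hn
    have h1' : (1 : ℝ) ≤ M := by exact_mod_cast hM
    fin_cases j <;> simp [A, Int.norm_eq_abs, hm', hn', h1']
  have hM' : (1 : ℝ) ≤ M := by exact_mod_cast hM
  have hb : ‖t‖ ≤ (3 * (M : ℝ)) ^ ((1 : ℝ) / 2) := by
    refine hnorm.trans ?_
    simp only [Fintype.card_fin, Nat.cast_one, Nat.cast_ofNat]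
    norm_num only
    refine Real.rpow_le_rpow (by positivity) ?_ (by norm_num)
    have : max 1 ‖A‖ ≤ M := max_le hM' hA
    gcongr
  have hbi : ∀ i, (t i) ^ 2 ≤ 3 * (M : ℤ) := by
    intro i
    have h1 : |(t i : ℝ)| ≤ (3 * (M : ℝ)) ^ ((1 : ℝ) / 2) := by
      rw [← Int.norm_eq_abs]
      exact (norm_le_pi_norm t i).trans hb
    rw [← Real.sqrt_eq_rpow] at h1
    have h2 : (t i : ℝ) ^ 2 ≤ 3 * M := by
      rw [← sq_abs]
      calc |(t i : ℝ)| ^ 2 ≤ (√(3 * (M : ℝ))) ^ 2 := by gcongr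
        _ = 3 * (M : ℝ) := Real.sq_sqrt (by positivity)
    exact_mod_cast h2
  have horth : t 0 = -(m * t 1 + n * t 2) := by
    have := congrFun hAt 0
    simp [A, Matrix.mulVec, dotProduct, Fin.sum_univ_three] at this
    linarith
  refine ⟨t 1, t 2, ?_, ?_, hbi 1, hbi 2⟩
  · by_contra h
    push Not at h
    apply ht0
    ext i
    fin_cases i
    · simpa [h.1, h.2] using horth
    · exact h.1
    · exact h.2
  · have := hbi 0
    rw [horth, neg_sq] at this
    exact this

theorem dotProduct_self_combination (u₁ u₂ : Fin 3 → ℤ) (b₁ b₂ : ℤ) :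
    (b₁ • u₁ + b₂ • u₂) ⬝ᵥ (b₁ • u₁ + b₂ • u₂) =
      b₁ ^ 2 * (u₁ ⬝ᵥ u₁) + 2 * b₁ * b₂ * (u₁ ⬝ᵥ u₂) + b₂ ^ 2 * (u₂ ⬝ᵥ u₂) := by
  simp only [dotProduct, Fin.sum_univ_three, Pi.add_apply, Pi.smul_apply, smul_eq_mul]
  ring

theorem reduced_form_bounds {x y z G s b₁ b₂ : ℤ} (hG : 0 < G) (hgram : x * y - z ^ 2 = G)
    (hx : 0 ≤ x) (hy : 0 ≤ y) (hzx : |2 * z| ≤ x) (hzy : |2 * z| ≤ y)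
    (hs : b₁ ^ 2 * x + 2 * b₁ * b₂ * z + b₂ ^ 2 * y ≤ s) :
    1 ≤ x ∧ 1 ≤ y ∧ 3 * (x * y) ≤ 4 * G ∧ b₁ ^ 2 ≤ 2 * s ∧ b₂ ^ 2 ≤ 2 * s := by
  have hzz : 4 * z ^ 2 ≤ x * y := by
    calc 4 * z ^ 2 = |2 * z| * |2 * z| := by rw [abs_mul_abs_self]; ring
      _ ≤ x * y := mul_le_mul hzx hzy (abs_nonneg _) hx
  have hxy : 0 < x * y := by linarith [sq_nonneg z]
  have hx1 : 1 ≤ x := by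
    rcases hx.lt_or_eq with h | h
    · exact h
    · rw [← h] at hxy; simp at hxy
  have hy1 : 1 ≤ y := by
    rcases hy.lt_or_eq with h | h
    · exact h
    · rw [← h] at hxy; simp at hxy
  have hcross : -(b₁ ^ 2 * x + b₂ ^ 2 * y) ≤ 2 * (2 * b₁ * b₂ * z) := by
    have q1 : |b₁ * b₂| * 2 ≤ b₁ ^ 2 + b₂ ^ 2 := by
      rw [abs_mul, ← sq_abs b₁, ← sq_abs b₂]
      linarith [sq_nonneg (|b₁| - |b₂|)]
    have q2 : |2 * z| * b₁ ^ 2 ≤ x * b₁ ^ 2 := by gcongr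
    have q3 : |2 * z| * b₂ ^ 2 ≤ y * b₂ ^ 2 := by gcongr
    have q4 : |2 * z| * (|b₁ * b₂| * 2) ≤ |2 * z| * (b₁ ^ 2 + b₂ ^ 2) := by gcongr
    have c2 : -(|b₁ * b₂| * |2 * z|) ≤ b₁ * b₂ * (2 * z) := by
      rw [← abs_mul]; exact neg_abs_le _
    linarith
  have h1 : b₁ ^ 2 * 1 ≤ b₁ ^ 2 * x := by gcongr
  have h2 : b₂ ^ 2 * 1 ≤ b₂ ^ 2 * y := by gcongr
  exact ⟨hx1, hy1, by linarith, by linarith [sq_nonneg b₂], by linarith [sq_nonneg b₁]⟩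

/-- The vector `(1, m, n)` is an integer combination of two integer vectors, nearly orthogonal,
spanning a parallelogram of area `O(√M)` if `|m|, |n| ≤ M`. -/
theorem exists_reduced_pair (v : Fin 3 → ℤ) (hv : v 0 = 1) (M : ℕ) (hM : 1 ≤ M)
    (hm : |v 1| ≤ M) (hn : |v 2| ≤ M) :
    ∃ (u₁ u₂ : Fin 3 → ℤ) (b₁ b₂ : ℤ), (∀ i, v i = b₁ * u₁ i + b₂ * u₂ i) ∧
      1 ≤ u₁ ⬝ᵥ u₁ ∧ 1 ≤ u₂ ⬝ᵥ u₂ ∧ (u₁ ⬝ᵥ u₁) * (u₂ ⬝ᵥ u₂) ≤ 12 * M ∧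
      b₁ ^ 2 ≤ 6 * M ^ 2 ∧ b₂ ^ 2 ≤ 6 * M ^ 2 := by
  obtain ⟨w₁, w₂, hw, h0, h1, h2⟩ := exists_short_orthogonal (v 1) (v 2) M hM hm hn
  set G : ℤ := (v 1 * w₁ + v 2 * w₂) ^ 2 + w₁ ^ 2 + w₂ ^ 2 with hG
  have hG9 : G ≤ 9 * M := by linarith
  have hGpos : 0 < G := by
    rcases hw with hw | hw <;> positivity
  let S : Set ℕ := {k | ∃ (u₁ u₂ : Fin 3 → ℤ) (b₁ b₂ : ℤ), (∀ i, v i = b₁ * u₁ i + b₂ * u₂ i) ∧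
    (u₁ ⬝ᵥ u₁) * (u₂ ⬝ᵥ u₂) - (u₁ ⬝ᵥ u₂) ^ 2 = G ∧ u₁ ⬝ᵥ u₁ + u₂ ⬝ᵥ u₂ = k}
  have hnn : ∀ u : Fin 3 → ℤ, 0 ≤ u ⬝ᵥ u := fun u => by
    simp only [dotProduct]
    exact Finset.sum_nonneg fun i _ => mul_self_nonneg _
  have hS : S.Nonempty := by
    refine ⟨(v ⬝ᵥ v + ![0, -w₂, w₁] ⬝ᵥ ![0, -w₂, w₁]).toNat, v, ![0, -w₂, w₁], 1, 0,
      by simp, ?_, ?_⟩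
    · simp only [dotProduct, Fin.sum_univ_three, hG, hv]
      simp
      ring
    · rw [Int.toNat_of_nonneg (add_nonneg (hnn _) (hnn _))]
  obtain ⟨u₁, u₂, b₁, b₂, hvb, hgram, hsum⟩ := Nat.sInf_mem hS
  have hmin : ∀ (u₁' u₂' : Fin 3 → ℤ) (b₁' b₂' : ℤ), (∀ i, v i = b₁' * u₁' i + b₂' * u₂' i) →
      (u₁' ⬝ᵥ u₁') * (u₂' ⬝ᵥ u₂') - (u₁' ⬝ᵥ u₂') ^ 2 = G →
      u₁ ⬝ᵥ u₁ + u₂ ⬝ᵥ u₂ ≤ u₁' ⬝ᵥ u₁' + u₂' ⬝ᵥ u₂' := by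
    intro u₁' u₂' b₁' b₂' h1 h2
    have h3 : (u₁' ⬝ᵥ u₁' + u₂' ⬝ᵥ u₂').toNat ∈ S :=
      ⟨u₁', u₂', b₁', b₂', h1, h2, by
        rw [Int.toNat_of_nonneg (add_nonneg (hnn _) (hnn _))]⟩
    have h4 := Nat.sInf_le h3
    rw [hsum, ← Int.toNat_of_nonneg (add_nonneg (hnn u₁') (hnn u₂'))]
    exact_mod_cast h4
  set x := u₁ ⬝ᵥ u₁ with hx
  set y := u₂ ⬝ᵥ u₂ with hy
  set z := u₁ ⬝ᵥ u₂ with hz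
  have hz' : u₂ ⬝ᵥ u₁ = z := dotProduct_comm _ _
  have e1 : (u₂ + u₁) ⬝ᵥ (u₂ + u₁) = y + 2 * z + x := by
    simp only [add_dotProduct, dotProduct_add, ← hx, ← hy, ← hz, hz']; ring
  have e2 : (u₂ - u₁) ⬝ᵥ (u₂ - u₁) = y - 2 * z + x := by
    simp only [sub_dotProduct, dotProduct_sub, ← hx, ← hy, ← hz, hz']; ring
  have e3 : u₁ ⬝ᵥ (u₂ + u₁) = z + x := by
    simp only [dotProduct_add, ← hx, ← hz]
  have e4 : u₁ ⬝ᵥ (u₂ - u₁) = z - x := by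
    simp only [dotProduct_sub, ← hx, ← hz]
  have e5 : (u₁ - u₂) ⬝ᵥ (u₁ - u₂) = y - 2 * z + x := by
    simp only [sub_dotProduct, dotProduct_sub, ← hx, ← hy, ← hz, hz']; ring
  have e6 : (u₂ + u₁) ⬝ᵥ u₂ = y + z := by
    simp only [add_dotProduct, ← hy, ← hz]
  have e7 : (u₁ - u₂) ⬝ᵥ u₂ = z - y := by
    simp only [sub_dotProduct, ← hy, ← hz]
  have k1 := hmin u₁ (u₂ + u₁) (b₁ - b₂) b₂ (fun i => by rw [hvb i]; simp only [Pi.add_apply]; ring)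
    (by rw [e1, e3, ← hgram]; ring)
  have k2 := hmin u₁ (u₂ - u₁) (b₁ + b₂) b₂ (fun i => by rw [hvb i]; simp only [Pi.sub_apply]; ring)
    (by rw [e2, e4, ← hgram]; ring)
  have k3 := hmin (u₂ + u₁) u₂ b₁ (b₂ - b₁) (fun i => by rw [hvb i]; simp only [Pi.add_apply]; ring)
    (by rw [e1, e6, ← hgram]; ring)
  have k4 := hmin (u₁ - u₂) u₂ b₁ (b₂ + b₁) (fun i => by rw [hvb i]; simp only [Pi.sub_apply]; ring)
    (by rw [e5, e7, ← hgram]; ring)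
  rw [e1] at k1 k3
  rw [e2] at k2
  rw [e5] at k4
  have hx0 : 0 ≤ x := hnn u₁
  have hy0 : 0 ≤ y := hnn u₂
  have hzx : |2 * z| ≤ x := abs_le.mpr ⟨by linarith, by linarith⟩
  have hzy : |2 * z| ≤ y := abs_le.mpr ⟨by linarith, by linarith⟩
  have hvv : v ⬝ᵥ v = b₁ ^ 2 * x + 2 * b₁ * b₂ * z + b₂ ^ 2 * y := by
    have hv' : v = b₁ • u₁ + b₂ • u₂ := by
      ext i
      simp [hvb i]
    rw [hv', dotProduct_self_combination]
  have hvM : v ⬝ᵥ v ≤ 3 * M ^ 2 := by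
    have a1 : (v 1) ^ 2 ≤ M ^ 2 := sq_le_sq' (by linarith [(abs_le.mp hm).1]) (abs_le.mp hm).2
    have a2 : (v 2) ^ 2 ≤ M ^ 2 := sq_le_sq' (by linarith [(abs_le.mp hn).1]) (abs_le.mp hn).2
    have a3 : (1 : ℤ) ≤ M ^ 2 := by
      have : (1 : ℤ) ≤ M := by exact_mod_cast hM
      nlinarith
    have a4 : v ⬝ᵥ v = 1 + v 1 ^ 2 + v 2 ^ 2 := by
      simp only [dotProduct, Fin.sum_univ_three, hv]
      ring
    rw [a4]
    linarith only [a1, a2, a3]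
  obtain ⟨hx1, hy1, hxy, hb₁, hb₂⟩ :=
    reduced_form_bounds hGpos hgram hx0 hy0 hzx hzy (hvv.symm.trans_le hvM)
  exact ⟨u₁, u₂, b₁, b₂, hvb, hx1, hy1, by linarith only [hxy, hG9], by linarith only [hb₁],
    by linarith only [hb₂]⟩

end Lattice


section Auxiliary

theorem hasSum_exp (x : ℝ) : HasSum (fun n : ℕ => x ^ n / (n.factorial : ℝ)) (exp x) := by
  have := NormedSpace.expSeries_div_hasSum_exp (𝔸 := ℝ) x
  rwa [← Real.exp_eq_exp_ℝ] at this

theorem pow_div_factorial_le_exp_abs (x : ℝ) (n : ℕ) :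
    |x ^ n / (n.factorial : ℝ)| ≤ exp |x| := by
  rw [abs_div, abs_pow, Nat.abs_cast]
  exact Real.pow_div_factorial_le_exp _ (abs_nonneg x) n

/-- Truncation error of the exponential series. -/
theorem abs_exp_sub_sum_le (x q : ℝ) (hq : 1 ≤ q) (n : ℕ) :
    |exp x - ∑ j ∈ Finset.range n, x ^ j / (j.factorial : ℝ)| ≤ exp (q * |x|) / q ^ n := by
  have h1 := (hasSum_nat_add_iff' n).mpr (hasSum_exp x)
  have h2 := (hasSum_nat_add_iff' n).mpr (hasSum_exp (q * |x|))
  have hq0 : 0 < q := by linarith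
  have h3 := h2.div_const (q ^ n)
  have h4 : |exp x - ∑ j ∈ Finset.range n, x ^ j / (j.factorial : ℝ)| ≤
      (exp (q * |x|) - ∑ j ∈ Finset.range n, (q * |x|) ^ j / (j.factorial : ℝ)) / q ^ n := by
    rw [← Real.norm_eq_abs, ← h1.tsum_eq, ← h3.tsum_eq]
    refine tsum_of_norm_bounded h3.summable.hasSum fun i => ?_
    rw [Real.norm_eq_abs, abs_div, abs_pow, Nat.abs_cast, mul_pow, div_right_comm]
    gcongr
    rw [le_div_iff₀ (by positivity), mul_comm]
    gcongr
    omega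
  refine h4.trans ?_
  gcongr
  have : 0 ≤ ∑ j ∈ Finset.range n, (q * |x|) ^ j / (j.factorial : ℝ) :=
    Finset.sum_nonneg fun _ _ => by positivity
  linarith

/-- Taylor coefficient of order `n` of `s ↦ (R s) ^ k exp (x s)`. -/
noncomputable def expMonomialCoeff (R x : ℝ) (k n : ℕ) : ℝ :=
  if k ≤ n then R ^ k * (x ^ (n - k) / ((n - k).factorial : ℝ)) else 0

theorem abs_expMonomialCoeff_le {R x : ℝ} (hR : 1 ≤ R) {k P n : ℕ} (hk : k ≤ P) :
    |expMonomialCoeff R x k n| ≤ R ^ P * exp |x| := by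
  unfold expMonomialCoeff
  split_ifs
  · rw [abs_mul, abs_of_nonneg (by positivity : 0 ≤ R ^ k)]
    gcongr
    exact pow_div_factorial_le_exp_abs _ _
  · simp; positivity

theorem abs_expMonomial_sub_le {R x s q : ℝ} (hR : 1 ≤ R) (hq : 1 ≤ q) (hs : |s| ≤ 1) {k P T : ℕ}
    (hk : k ≤ P) (hP : P ≤ T) :
    |(R * s) ^ k * exp (x * s) - ∑ n ∈ Finset.range T, expMonomialCoeff R x k n * s ^ n| ≤
      R ^ P * (exp (q * |x|) / q ^ (T - P)) := by
  have h1 : ∑ n ∈ Finset.range T, expMonomialCoeff R x k n * s ^ n =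
      (R * s) ^ k * ∑ j ∈ Finset.range (T - k), (x * s) ^ j / (j.factorial : ℝ) := by
    obtain ⟨m, rfl⟩ := Nat.exists_eq_add_of_le (hk.trans hP)
    rw [Finset.sum_range_add, Finset.sum_eq_zero, zero_add, Finset.mul_sum, Nat.add_sub_cancel_left]
    · refine Finset.sum_congr rfl fun j _ => ?_
      simp only [expMonomialCoeff, Nat.le_add_right, if_true, Nat.add_sub_cancel_left]
      ring
    · intro n hn
      rw [expMonomialCoeff, if_neg (by simpa using hn), zero_mul]
  have hsk : |(R * s) ^ k| ≤ R ^ P := by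
    rw [abs_pow, abs_mul, abs_of_nonneg (by positivity : 0 ≤ R)]
    calc (R * |s|) ^ k ≤ R ^ k := by
          gcongr; nlinarith
      _ ≤ R ^ P := by gcongr
  rw [h1, ← mul_sub, abs_mul]
  gcongr
  refine (abs_exp_sub_sum_le (x * s) q hq (T - k)).trans ?_
  have hxs : |x * s| ≤ |x| := by
    rw [abs_mul]; nlinarith [abs_nonneg x]
  gcongr

/-- Siegel's lemma for real coefficients: `T` real linear forms in `B T` unknowns are made small at
a small nonzero integer point. -/
theorem exists_small_values {ι : Type*} [Fintype ι] (T B : ℕ) (hT : 0 < T) (hB : 2 ≤ B)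
    (hι : Fintype.card ι = B * T) (C : Fin T → ι → ℝ) (X S H : ℝ) (hX : 1 ≤ X) (hS : 1 ≤ S)
    (hC : ∀ n i, |C n i| ≤ X)
    (hH : ((B * T : ℕ) * (S * X + 1)) ≤ H ^ (B - 1)) (hH0 : 1 ≤ H) :
    ∃ p : ι → ℤ, p ≠ 0 ∧ (∀ i, |(p i : ℝ)| ≤ H) ∧
      ∀ n, |∑ i, (p i : ℝ) * C n i| ≤ (B * T : ℕ) * H / S := by
  let _ : SeminormedAddCommGroup (Matrix (Fin T) ι ℤ) := Matrix.seminormedAddCommGroup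
  let A : Matrix (Fin T) ι ℤ := Matrix.of fun n i => ⌊S * C n i⌋
  have hcard : Fintype.card (Fin T) < Fintype.card ι := by
    rw [Fintype.card_fin, hι]; nlinarith
  obtain ⟨p, hp0, hAp, hnorm⟩ := Int.Matrix.exists_ne_zero_int_vec_norm_le A hcard (by simpa)
  have hS0 : 0 < S := by linarith
  have hA : ‖A‖ ≤ S * X + 1 := by
    rw [Matrix.norm_le_iff (by positivity)]
    intro n i
    rw [Int.norm_eq_abs]
    have h1 := Int.floor_le (S * C n i)
    have h2 := Int.sub_one_lt_floor (S * C n i)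
    have h3 : |S * C n i| ≤ S * X := by
      rw [abs_mul, abs_of_pos hS0]; gcongr; exact hC n i
    have h4 := abs_le.mp h3
    simp only [A, Matrix.of_apply]
    rw [abs_le]
    constructor <;> linarith
  have hpH : ‖p‖ ≤ H := by
    refine hnorm.trans ?_
    rw [hι, Fintype.card_fin]
    have e1 : ((T : ℝ) / ((B * T : ℕ) - T)) = 1 / ((B - 1 : ℕ) : ℝ) := by
      have : (T : ℝ) ≠ 0 := by positivity
      push_cast [Nat.cast_sub (by omega : 1 ≤ B)]
      have hB' : (2 : ℝ) ≤ B := by exact_mod_cast hB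
      have h2 : (B : ℝ) - 1 ≠ 0 := by linarith
      have h3 : (B : ℝ) * T - T ≠ 0 := by
        rw [show (B : ℝ) * T - T = (B - 1) * T by ring]; positivity
      field_simp
    have e2 : ((B * T : ℕ) * max 1 ‖A‖ : ℝ) ≤ H ^ (B - 1) := by
      refine le_trans ?_ hH
      gcongr
      exact max_le (by nlinarith) hA
    calc ((B * T : ℕ) * max 1 ‖A‖ : ℝ) ^ ((T : ℝ) / ((B * T : ℕ) - T))
        ≤ (H ^ (B - 1)) ^ (1 / ((B - 1 : ℕ) : ℝ)) := by
          rw [e1]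
          exact Real.rpow_le_rpow (by positivity) e2 (by positivity)
      _ = H := by
          rw [one_div]
          exact Real.pow_rpow_inv_natCast (by linarith) (by omega)
  have hpi : ∀ i, |(p i : ℝ)| ≤ H := fun i => by
    rw [← Int.norm_eq_abs]; exact (norm_le_pi_norm p i).trans hpH
  refine ⟨p, hp0, hpi, fun n => ?_⟩
  have h0 : ∑ i, (p i : ℝ) * (⌊S * C n i⌋ : ℝ) = 0 := by
    have := congrFun hAp n
    simp only [A, Matrix.mulVec, dotProduct, Matrix.of_apply, Pi.zero_apply] at this
    have h2 : ((∑ i, ⌊S * C n i⌋ * p i : ℤ) : ℝ) = 0 := by rw [this]; simp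
    push_cast at h2
    rw [← h2]
    exact Finset.sum_congr rfl fun i _ => mul_comm _ _
  have h1 : S * ∑ i, (p i : ℝ) * C n i = ∑ i, (p i : ℝ) * (S * C n i - ⌊S * C n i⌋) := by
    simp only [mul_sub, Finset.sum_sub_distrib, h0, sub_zero, Finset.mul_sum]
    exact Finset.sum_congr rfl fun i _ => by ring
  rw [le_div_iff₀ hS0, mul_comm]
  nth_rewrite 1 [← abs_of_pos hS0]
  rw [← abs_mul, h1]
  calc |∑ i, (p i : ℝ) * (S * C n i - ⌊S * C n i⌋)|
      ≤ ∑ i, |(p i : ℝ) * (S * C n i - ⌊S * C n i⌋)| := Finset.abs_sum_le_sum_abs _ _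
    _ ≤ ∑ _i : ι, H * 1 := by
        refine Finset.sum_le_sum fun i _ => ?_
        rw [abs_mul]
        gcongr
        · exact hpi i
        · rw [abs_of_nonneg (by linarith [Int.floor_le (S * C n i)])]
          linarith [Int.sub_one_lt_floor (S * C n i)]
    _ = (B * T : ℕ) * H := by
        rw [Finset.sum_const, Finset.card_univ, hι, nsmul_eq_mul, mul_one]

set_option maxHeartbeats 1000000 in
/-- An exponential polynomial with small integer coefficients that is tiny on `[-R, R]`. -/
theorem exists_auxiliary_function (B E : ℕ) (hB : 10000 ≤ B) (hE : B ≤ E) (R c : ℝ) (hR : 1 ≤ R)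
    (hRB : log R ≤ B / 100) (hc : B ^ 2 * |c| * R ≤ E) :
    ∃ p : Fin E → Fin (B ^ 2) → ℤ, p ≠ 0 ∧ (∀ k l, |(p k l : ℝ)| ≤ exp (B * E / 100)) ∧
      ∀ t : ℝ, |t| ≤ R → |∑ k, ∑ l, (p k l : ℝ) * t ^ (k : ℕ) * exp (l * c * t)| ≤
        exp (-(B * E / 2)) := by
  have hBr : (10000 : ℝ) ≤ B := by exact_mod_cast hB
  have hEr : (B : ℝ) ≤ E := by exact_mod_cast hE
  have hB0 : (0 : ℝ) < B := by linarith
  have hE0 : (0 : ℝ) < E := by linarith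
  have hR0 : 0 < R := by linarith
  set T : ℕ := B * E with hT
  have hTr : (T : ℝ) = B * E := by rw [hT]; push_cast; ring
  have hTbig : (100000000 : ℝ) ≤ T := by rw [hTr]; nlinarith
  have hET : (E : ℝ) ≤ T / 10000 := by rw [hTr]; nlinarith
  have hN : ((B * T : ℕ) : ℝ) ≤ exp (T / 1000) := by
    have h1 : (T : ℝ) / 4000 + 1 ≤ exp (T / 4000) := add_one_le_exp _
    have h2 : ((T : ℝ) / 4000) ^ 4 ≤ exp (T / 4000) ^ 4 := by
      gcongr; linarith
    rw [← exp_nat_mul] at h2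
    have h3 : ((B * T : ℕ) : ℝ) ≤ T ^ 2 := by
      push_cast
      have : (B : ℝ) ≤ T := by rw [hTr]; nlinarith
      nlinarith
    have h4 : (T : ℝ) ^ 2 ≤ (T / 4000) ^ 4 := by
      have : (T : ℝ) ≤ (T / 4000) ^ 2 := by nlinarith
      calc (T : ℝ) ^ 2 ≤ ((T / 4000) ^ 2) ^ 2 := by gcongr
        _ = _ := by ring
    refine h3.trans (h4.trans (h2.trans (le_of_eq ?_)))
    congr 1; push_cast; ring
  have hRE : R ^ E ≤ exp (T / 100) := by
    rw [← Real.exp_log hR0, ← exp_nat_mul]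
    gcongr
    rw [hTr]; nlinarith
  have hx : ∀ l : Fin (B ^ 2), |(l : ℝ) * c * R| ≤ E := by
    intro l
    rw [abs_mul, abs_mul, abs_of_pos hR0, Nat.abs_cast]
    have : ((l : ℕ) : ℝ) ≤ (B : ℝ) ^ 2 := by exact_mod_cast l.2.le
    calc ((l : ℕ) : ℝ) * |c| * R ≤ (B : ℝ) ^ 2 * |c| * R := by gcongr
      _ ≤ E := hc
  set X : ℝ := exp (T / 100 + E) with hX
  have hX1 : 1 ≤ X := one_le_exp (by positivity)
  set S : ℝ := exp T with hS
  have hS1 : 1 ≤ S := one_le_exp (by positivity)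
  set H : ℝ := exp (T / 1000) with hH
  have hH1 : 1 ≤ H := one_le_exp (by positivity)
  let C : Fin T → Fin E × Fin (B ^ 2) → ℝ := fun n i =>
    expMonomialCoeff R (i.2 * c * R) i.1 n
  have hC : ∀ n i, |C n i| ≤ X := by
    intro n i
    refine (abs_expMonomialCoeff_le hR i.1.2.le).trans ?_
    rw [hX, exp_add]
    gcongr
    exact hx i.2
  have hHB : ((B * T : ℕ) * (S * X + 1) : ℝ) ≤ H ^ (B - 1) := by
    have h1 : S * X + 1 ≤ exp (2 * T) := by
      have h2 : S * X + 1 ≤ S * X * exp 1 := by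
        have := add_one_le_exp (1 : ℝ)
        nlinarith [mul_le_mul hS1 hX1 zero_le_one (by linarith)]
      refine h2.trans ?_
      rw [hS, hX, ← exp_add, ← exp_add]
      gcongr
      linarith
    calc ((B * T : ℕ) * (S * X + 1) : ℝ) ≤ exp (T / 1000) * exp (2 * T) := by gcongr
      _ ≤ H ^ (B - 1) := by
        rw [hH, ← exp_nat_mul, ← exp_add]
        gcongr
        push_cast [Nat.cast_sub (by omega : 1 ≤ B)]
        nlinarith
  obtain ⟨p, hp0, hpH, hpS⟩ := exists_small_values T B (by rw [hT]; exact Nat.mul_pos (by omega) (by omega)) (by omega)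
    (by simp [hT]; ring) C X S H hX1 hS1 hC hHB hH1
  refine ⟨fun k l => p (k, l), ?_, ?_, ?_⟩
  · intro h
    apply hp0
    ext ⟨k, l⟩
    exact congrFun (congrFun h k) l
  · intro k l
    refine (hpH _).trans ?_
    rw [hH, hTr]
    gcongr
    norm_num
  intro t ht
  set s : ℝ := t / R with hs
  have hts : t = R * s := by rw [hs]; field_simp
  have hs1 : |s| ≤ 1 := by
    rw [hs, abs_div, abs_of_pos hR0, div_le_one hR0]; exact ht
  have e1 : ∑ k : Fin E, ∑ l : Fin (B ^ 2), (p (k, l) : ℝ) * t ^ (k : ℕ) * exp (l * c * t) =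
      ∑ i : Fin E × Fin (B ^ 2), (p i : ℝ) * ((R * s) ^ (i.1 : ℕ) * exp (i.2 * c * R * s)) := by
    rw [Fintype.sum_prod_type]
    refine Finset.sum_congr rfl fun k _ => Finset.sum_congr rfl fun l _ => ?_
    rw [hts, mul_assoc, mul_assoc ((l : ℝ) * c)]
  have e2 : ∑ i : Fin E × Fin (B ^ 2), (p i : ℝ) * ((R * s) ^ (i.1 : ℕ) * exp (i.2 * c * R * s)) =
      ∑ i, (p i : ℝ) * ((R * s) ^ (i.1 : ℕ) * exp (i.2 * c * R * s) -
        ∑ n ∈ Finset.range T, expMonomialCoeff R (i.2 * c * R) i.1 n * s ^ n) +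
      ∑ n : Fin T, (∑ i, (p i : ℝ) * C n i) * s ^ (n : ℕ) := by
    have : ∑ n : Fin T, (∑ i, (p i : ℝ) * C n i) * s ^ (n : ℕ) = ∑ i, (p i : ℝ) *
        ∑ n ∈ Finset.range T, expMonomialCoeff R (i.2 * c * R) i.1 n * s ^ n := by
      simp only [Finset.sum_mul, Finset.mul_sum]
      rw [Finset.sum_comm]
      refine Finset.sum_congr rfl fun i _ => ?_
      rw [Finset.sum_range]
      exact Finset.sum_congr rfl fun n _ => by simp only [C]; ring
    rw [this, ← Finset.sum_add_distrib]
    exact Finset.sum_congr rfl fun i _ => by ring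
  have hcard : (Finset.univ : Finset (Fin E × Fin (B ^ 2))).card = B * T := by
    simp [hT]; ring
  have b1 : |∑ i, (p i : ℝ) * ((R * s) ^ (i.1 : ℕ) * exp (i.2 * c * R * s) -
        ∑ n ∈ Finset.range T, expMonomialCoeff R (i.2 * c * R) i.1 n * s ^ n)| ≤
      exp (-(51 / 100 * T)) := by
    have h1 : ∀ i : Fin E × Fin (B ^ 2), |(p i : ℝ) * ((R * s) ^ (i.1 : ℕ) *
        exp (i.2 * c * R * s) -
        ∑ n ∈ Finset.range T, expMonomialCoeff R (i.2 * c * R) i.1 n * s ^ n)| ≤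
        H * (exp (T / 100) * (exp (exp 1 * E) / exp 1 ^ (T - E))) := by
      intro i
      rw [abs_mul]
      gcongr
      · exact hpH i
      · refine (abs_expMonomial_sub_le hR (one_le_exp zero_le_one) hs1 i.1.2.le
          (by rw [hT]; nlinarith)).trans ?_
        gcongr
        exact hx i.2
    refine (Finset.abs_sum_le_sum_abs _ _).trans ((Finset.sum_le_sum fun i _ => h1 i).trans ?_)
    rw [Finset.sum_const, hcard, nsmul_eq_mul]
    have h2 : exp 1 ^ (T - E) = exp ((T : ℝ) - E) := by
      rw [← exp_nat_mul, Nat.cast_sub (by rw [hT]; nlinarith), mul_one]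
    rw [h2, ← exp_sub, ← exp_add, hH, ← exp_add]
    calc ((B * T : ℕ) : ℝ) * exp (T / 1000 + (T / 100 + (exp 1 * E - (T - E))))
        ≤ exp (T / 1000) * exp (T / 1000 + (T / 100 + (exp 1 * E - (T - E)))) := by gcongr
      _ ≤ exp (-(51 / 100 * T)) := by
        rw [← exp_add]
        gcongr
        have := Real.exp_one_lt_d9
        nlinarith
  have b2 : |∑ n : Fin T, (∑ i, (p i : ℝ) * C n i) * s ^ (n : ℕ)| ≤ exp (-(51 / 100 * T)) := by
    have h1 : ∀ n : Fin T, |(∑ i, (p i : ℝ) * C n i) * s ^ (n : ℕ)| ≤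
        (exp (T / 1000) * H / S) := by
      intro n
      rw [abs_mul, abs_pow]
      have h2 : |s| ^ (n : ℕ) ≤ 1 := pow_le_one₀ (abs_nonneg _) hs1
      calc |∑ i, (p i : ℝ) * C n i| * |s| ^ (n : ℕ) ≤ |∑ i, (p i : ℝ) * C n i| * 1 := by gcongr
        _ ≤ (B * T : ℕ) * H / S := by rw [mul_one]; exact hpS n
        _ ≤ exp (T / 1000) * H / S := by gcongr
    refine (Finset.abs_sum_le_sum_abs _ _).trans ((Finset.sum_le_sum fun i _ => h1 i).trans ?_)
    rw [Finset.sum_const, Finset.card_univ, Fintype.card_fin, nsmul_eq_mul, hH, hS, ← exp_add,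
      ← exp_sub]
    have h3 : (T : ℝ) ≤ exp (T / 1000) := by
      refine le_trans ?_ hN
      exact_mod_cast Nat.le_mul_of_pos_left T (by omega)
    calc (T : ℝ) * exp (T / 1000 + T / 1000 - T)
        ≤ exp (T / 1000) * exp (T / 1000 + T / 1000 - T) := by gcongr
      _ ≤ exp (-(51 / 100 * T)) := by
        rw [← exp_add]
        gcongr
        linarith
  rw [e1, e2, ← hTr]
  refine (abs_add_le _ _).trans ((add_le_add b1 b2).trans ?_)
  have h5 : exp (-(T / 2) : ℝ) = exp (-(51 / 100 * T)) * exp (T / 100) := by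
    rw [← exp_add]; congr 1; ring
  rw [h5]
  have h6 := add_one_le_exp ((T : ℝ) / 100)
  nlinarith [exp_pos (-(51 / 100 * T) : ℝ)]

end Auxiliary


section Heights

variable {ι : Type*}

/-- `z` has a denominator at most `exp g` with respect to `O`, and coordinates at most `exp g`. -/
def HeightLE (O : Subring (ι → ℝ)) (g : ℝ) (z : ι → ℝ) : Prop :=
  ∃ δ : ℕ, 1 ≤ δ ∧ (δ : ℝ) ≤ exp g ∧ (δ : ι → ℝ) * z ∈ O ∧ ∀ i, |z i| ≤ exp g

variable {O : Subring (ι → ℝ)} {g g' : ℝ} {z z' : ι → ℝ}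

theorem HeightLE.mono (hz : HeightLE O g z) (h : g ≤ g') : HeightLE O g' z := by
  obtain ⟨δ, h1, h2, h3, h4⟩ := hz
  exact ⟨δ, h1, h2.trans (exp_le_exp.mpr h), h3, fun i => (h4 i).trans (exp_le_exp.mpr h)⟩

theorem heightLE_one : HeightLE O 0 1 :=
  ⟨1, le_rfl, by simp, by simp, fun i => by simp⟩

theorem HeightLE.mul (hz : HeightLE O g z) (hz' : HeightLE O g' z') :
    HeightLE O (g + g') (z * z') := by
  obtain ⟨δ, h1, h2, h3, h4⟩ := hz
  obtain ⟨δ', h1', h2', h3', h4'⟩ := hz'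
  refine ⟨δ * δ', Nat.mul_pos h1 h1', ?_, ?_, fun i => ?_⟩
  · rw [exp_add, Nat.cast_mul]; gcongr
  · have := O.mul_mem h3 h3'
    rw [Nat.cast_mul]
    convert this using 1
    ring
  · rw [Pi.mul_apply, abs_mul, exp_add]
    gcongr
    · exact h4 i
    · exact h4' i

theorem HeightLE.pow (hz : HeightLE O g z) (n : ℕ) : HeightLE O (n * g) (z ^ n) := by
  induction n with
  | zero => simp [heightLE_one]
  | succ n ih =>
    rw [pow_succ]
    exact (ih.mul hz).mono (by push_cast; linarith)

theorem HeightLE.zpow (hz : HeightLE O g z) (hz' : HeightLE O g z⁻¹) (n : ℤ) :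
    HeightLE O (|(n : ℝ)| * g) (z ^ n) := by
  obtain ⟨m, rfl | rfl⟩ := n.eq_nat_or_neg
  · simpa using hz.pow m
  · simpa [zpow_neg, ← inv_pow] using hz'.pow m

theorem HeightLE.sub_one (hz : HeightLE O g z) (hg : 0 ≤ g) : HeightLE O (g + 1) (z - 1) := by
  obtain ⟨δ, h1, h2, h3, h4⟩ := hz
  refine ⟨δ, h1, h2.trans (exp_le_exp.mpr (by linarith)), ?_, fun i => ?_⟩
  · rw [mul_sub, mul_one]
    exact O.sub_mem h3 (natCast_mem O δ)
  · have h5 := abs_sub (z i) 1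
    rw [abs_one] at h5
    have h6 := add_one_le_exp (1 : ℝ)
    have h7 := one_le_exp hg
    rw [exp_add]
    simp only [Pi.sub_apply, Pi.one_apply]
    nlinarith [h4 i]

theorem HeightLE.le_abs [Fintype ι] [DecidableEq ι] (hι : Fintype.card ι = 4) {i₀ : ι}
    (hO : ∀ y ∈ O, y i₀ ≠ 0 → 1 ≤ ∏ i, |y i|) (hz : HeightLE O g z) (h0 : z i₀ ≠ 0) :
    exp (-(7 * g)) ≤ |z i₀| := by
  obtain ⟨δ, h1, h2, h3, h4⟩ := hz
  have hδ : (δ : ℝ) ≠ 0 := by positivity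
  have h5 := hO _ h3 (by simpa using ⟨by omega, h0⟩)
  rw [← Finset.mul_prod_erase _ _ (Finset.mem_univ i₀)] at h5
  have h6 : ∏ i ∈ Finset.univ.erase i₀, |((δ : ι → ℝ) * z) i| ≤ exp (2 * g) ^ 3 := by
    have : (Finset.univ.erase i₀).card = 3 := by
      rw [Finset.card_erase_of_mem (Finset.mem_univ _), Finset.card_univ, hι]
    rw [← this, ← Finset.prod_const]
    refine Finset.prod_le_prod (fun _ _ => abs_nonneg _) fun i _ => ?_
    rw [Pi.mul_apply, Pi.natCast_apply, abs_mul, Nat.abs_cast, two_mul, exp_add]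
    gcongr
    exact h4 i
  have h7 : |((δ : ι → ℝ) * z) i₀| ≤ exp g * |z i₀| := by
    rw [Pi.mul_apply, Pi.natCast_apply, abs_mul, Nat.abs_cast]
    gcongr
  have h8 : 1 ≤ exp g * |z i₀| * exp (2 * g) ^ 3 := by
    refine h5.trans ?_
    gcongr
  have h9 : exp g * |z i₀| * exp (2 * g) ^ 3 = exp (7 * g) * |z i₀| := by
    rw [← exp_nat_mul, mul_right_comm, ← exp_add]
    congr 2; push_cast; ring
  rw [h9] at h8
  rw [exp_neg, inv_le_iff_one_le_mul₀ (exp_pos _), mul_comm]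
  exact h8

theorem HeightLE.polynomial (hz : HeightLE O g z) (hg : 0 ≤ g) {P L : ℕ} (p : Fin P → Fin L → ℤ)
    {H R : ℝ} (hp : ∀ k l, |(p k l : ℝ)| ≤ H) (hH : 0 ≤ H) (hR : 1 ≤ R) (t : ℤ)
    (ht : |(t : ℝ)| ≤ R) (hg' : L * g ≤ g') (hb : P * L * H * R ^ P * exp (L * g) ≤ exp g') :
    HeightLE O g' (∑ k, ∑ l, (p k l : ι → ℝ) * (t : ι → ℝ) ^ (k : ℕ) * z ^ (l : ℕ)) := by
  obtain ⟨δ, h1, h2, h3, h4⟩ := hz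
  refine ⟨δ ^ L, Nat.pow_pos h1, ?_, ?_, fun i => ?_⟩
  · push_cast
    calc (δ : ℝ) ^ L ≤ exp g ^ L := by gcongr
      _ ≤ exp g' := by rw [← exp_nat_mul]; gcongr
  · simp only [Finset.mul_sum]
    refine O.sum_mem fun k _ => O.sum_mem fun l _ => ?_
    have e : ((δ ^ L : ℕ) : ι → ℝ) * ((p k l : ι → ℝ) * (t : ι → ℝ) ^ (k : ℕ) * z ^ (l : ℕ)) =
        (p k l : ι → ℝ) * (t : ι → ℝ) ^ (k : ℕ) * ((δ : ι → ℝ) ^ (L - l) * (δ * z) ^ (l : ℕ)) := by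
      rw [mul_pow, ← mul_assoc ((δ : ι → ℝ) ^ (L - (l : ℕ))), ← pow_add,
        Nat.sub_add_cancel l.2.le, Nat.cast_pow]
      ring
    rw [e]
    exact O.mul_mem (O.mul_mem (intCast_mem O _) (O.pow_mem (intCast_mem O _) _))
      (O.mul_mem (O.pow_mem (natCast_mem O _) _) (O.pow_mem h3 _))
  · refine le_trans ?_ hb
    simp only [Finset.sum_apply, Pi.mul_apply, Pi.pow_apply, Pi.intCast_apply]
    have h5 : ∀ (k : Fin P) (l : Fin L), |(p k l : ℝ) * (t : ℝ) ^ (k : ℕ) * z i ^ (l : ℕ)| ≤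
        H * R ^ P * exp (L * g) := by
      intro k l
      rw [abs_mul, abs_mul, abs_pow, abs_pow]
      have h6 : |(t : ℝ)| ^ (k : ℕ) ≤ R ^ P :=
        (pow_le_pow_left₀ (abs_nonneg _) ht _).trans (pow_le_pow_right₀ hR k.2.le)
      have h7 : |z i| ^ (l : ℕ) ≤ exp (L * g) := by
        rw [exp_nat_mul]
        exact (pow_le_pow_left₀ (abs_nonneg _) (h4 i) _).trans
          (pow_le_pow_right₀ (one_le_exp hg) l.2.le)
      gcongr
      exact hp k l
    refine (Finset.abs_sum_le_sum_abs _ _).trans ((Finset.sum_le_sum fun k _ =>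
      (Finset.abs_sum_le_sum_abs _ _).trans (Finset.sum_le_sum fun l _ => h5 k l)).trans ?_)
    simp only [Finset.sum_const, Finset.card_univ, Fintype.card_fin, nsmul_eq_mul]
    apply le_of_eq; ring

end Heights
section LinearForm

theorem cast_mul_sq_le_exp {B E : ℕ} (hB : 10000 ≤ B) (hE : B ≤ E) :
    ((E * B ^ 2 : ℕ) : ℝ) ≤ exp (B * E / 1000) := by
  have hBr : (10000 : ℝ) ≤ B := by exact_mod_cast hB
  have hEr : (B : ℝ) ≤ E := by exact_mod_cast hE
  set T : ℝ := B * E with hT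
  have hTbig : 100000000 ≤ T := by rw [hT]; nlinarith
  have h1 : T / 4000 + 1 ≤ exp (T / 4000) := add_one_le_exp _
  have h2 : (T / 4000) ^ 4 ≤ exp (T / 4000) ^ 4 := by
    gcongr; linarith
  rw [← exp_nat_mul] at h2
  have h3 : ((E * B ^ 2 : ℕ) : ℝ) ≤ T ^ 2 := by
    push_cast
    rw [hT, mul_pow, mul_comm]
    gcongr
    nlinarith
  have h4 : T ^ 2 ≤ (T / 4000) ^ 4 := by
    have : T ≤ (T / 4000) ^ 2 := by nlinarith
    calc T ^ 2 ≤ ((T / 4000) ^ 2) ^ 2 := by gcongr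
      _ = _ := by ring
  refine h3.trans (h4.trans (h2.trans (le_of_eq ?_)))
  congr 1; push_cast; ring

theorem exists_decomposition (l₁ l₂ b₁ b₂ : ℝ) (h1 : |b₁| ≤ b₁ ^ 2) (h2 : |b₂| ≤ b₂ ^ 2)
    (h : 1 ≤ b₁ ^ 2 + b₂ ^ 2) :
    ∃ c μ : ℝ, l₁ = c * b₂ + b₁ * μ ∧ l₂ = -(c * b₁) + b₂ * μ ∧
      |b₁ * μ| ≤ |b₁ * l₁ + b₂ * l₂| ∧ |b₂ * μ| ≤ |b₁ * l₁ + b₂ * l₂| := by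
  have hQ : 0 < b₁ ^ 2 + b₂ ^ 2 := by linarith
  refine ⟨(b₂ * l₁ - b₁ * l₂) / (b₁ ^ 2 + b₂ ^ 2), (b₁ * l₁ + b₂ * l₂) / (b₁ ^ 2 + b₂ ^ 2),
    by field_simp; ring, by field_simp; ring, ?_, ?_⟩
  · rw [← mul_div_assoc, abs_div, abs_mul, abs_of_pos hQ, div_le_iff₀ hQ, mul_comm]
    gcongr
    nlinarith [sq_nonneg b₂]
  · rw [← mul_div_assoc, abs_div, abs_mul, abs_of_pos hQ, div_le_iff₀ hQ, mul_comm]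
    gcongr
    nlinarith [sq_nonneg b₁]

/-- A polynomial in an integer `t` and an algebraic number `A = exp (c t + ε)` vanishes if the
exponential polynomial obtained by dropping `ε` is very small. -/
theorem HeightLE.polynomial_eq_zero {ι : Type*} [Fintype ι] [DecidableEq ι]
    (hι : Fintype.card ι = 4) {i₀ : ι} {O : Subring (ι → ℝ)}
    (hO : ∀ y ∈ O, y i₀ ≠ 0 → 1 ≤ ∏ i, |y i|) {B E : ℕ} (hB : 10000 ≤ B) (hE : B ≤ E) {g : ℝ}
    {A : ι → ℝ} (hA : HeightLE O g A) (hg : 0 ≤ g) (hgE : B ^ 2 * g ≤ E)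
    (p : Fin E → Fin (B ^ 2) → ℤ) (hp : ∀ k l, |(p k l : ℝ)| ≤ exp (B * E / 100))
    {R : ℝ} (hR : 1 ≤ R) (hRB : log R ≤ B / 100) {t : ℤ} (ht : |(t : ℝ)| ≤ R) {c ε : ℝ}
    (hAt : A i₀ = exp (c * t + ε)) (hc : B ^ 2 * |c| * R ≤ E) (hε : B ^ 2 * |ε| ≤ exp (-(B * E)))
    (hf : |∑ k, ∑ l, (p k l : ℝ) * t ^ (k : ℕ) * exp (l * c * t)| ≤ exp (-(B * E / 2))) :
    ∑ k, ∑ l, (p k l : ℝ) * (t : ℝ) ^ (k : ℕ) * A i₀ ^ (l : ℕ) = 0 := by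
  have hN := cast_mul_sq_le_exp hB hE
  have hBr : (10000 : ℝ) ≤ B := by exact_mod_cast hB
  have hEr : (B : ℝ) ≤ E := by exact_mod_cast hE
  have hR0 : 0 < R := by linarith
  have hRE : R ^ E ≤ exp (B * E / 100) := by
    rw [← Real.exp_log hR0, ← exp_nat_mul]
    gcongr
    have : (0 : ℝ) ≤ E := by positivity
    nlinarith
  set T : ℝ := B * E with hT
  have hTbig : 100000000 ≤ T := by rw [hT]; nlinarith
  have hET : (E : ℝ) ≤ T / 10000 := by rw [hT]; nlinarith
  have hF : HeightLE O (T / 20) (∑ k, ∑ l, (p k l : ι → ℝ) * (t : ι → ℝ) ^ (k : ℕ) *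
      A ^ (l : ℕ)) := by
    refine hA.polynomial hg p hp (exp_pos _).le hR t ht (by push_cast; linarith) ?_
    have h1 : ((E : ℝ) * (B ^ 2 : ℕ)) ≤ exp (T / 1000) := by exact_mod_cast hN
    have h2 : ((B ^ 2 : ℕ) * g : ℝ) ≤ T / 10000 := by push_cast; linarith
    calc (E : ℝ) * (B ^ 2 : ℕ) * exp (T / 100) * R ^ E * exp ((B ^ 2 : ℕ) * g)
        ≤ exp (T / 1000) * exp (T / 100) * exp (T / 100) * exp (T / 10000) := by gcongr
      _ ≤ exp (T / 20) := by
        rw [← exp_add, ← exp_add, ← exp_add]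
        gcongr
        linarith
  by_contra hne
  have hFi : (∑ k, ∑ l, (p k l : ι → ℝ) * (t : ι → ℝ) ^ (k : ℕ) * A ^ (l : ℕ)) i₀ =
      ∑ k, ∑ l, (p k l : ℝ) * (t : ℝ) ^ (k : ℕ) * A i₀ ^ (l : ℕ) := by
    simp only [Finset.sum_apply, Pi.mul_apply, Pi.pow_apply, Pi.intCast_apply]
  have hlow := hF.le_abs hι hO (by rw [hFi]; exact hne)
  rw [hFi] at hlow
  have hterm : ∀ (k : Fin E) (l : Fin (B ^ 2)), |(p k l : ℝ) * (t : ℝ) ^ (k : ℕ) * A i₀ ^ (l : ℕ) -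
      (p k l : ℝ) * t ^ (k : ℕ) * exp (l * c * t)| ≤
      exp (T / 100) * exp (T / 100) * (exp (T / 10000) * (2 * exp (-T))) := by
    intro k l
    have hl : ((l : ℕ) : ℝ) ≤ (B : ℝ) ^ 2 := by exact_mod_cast l.2.le
    have e1 : A i₀ ^ (l : ℕ) = exp (l * c * t) * exp (l * ε) := by
      rw [hAt, ← exp_nat_mul, ← exp_add]; congr 1; ring
    have hlε : |(l : ℝ) * ε| ≤ exp (-T) := by
      rw [abs_mul, Nat.abs_cast]
      refine le_trans ?_ hε
      gcongr
    have hlε' : |exp (l * ε) - 1| ≤ 2 * exp (-T) := by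
      refine (Real.abs_exp_sub_one_le (hlε.trans ?_)).trans (by linarith)
      rw [exp_le_one_iff]; linarith
    have hlc : exp (l * c * t) ≤ exp (T / 10000) := by
      gcongr
      refine le_trans ?_ hET
      refine le_trans (le_abs_self _) (le_trans ?_ hc)
      rw [abs_mul, abs_mul, Nat.abs_cast]
      gcongr
    have htk : |(t : ℝ)| ^ (k : ℕ) ≤ exp (T / 100) :=
      ((pow_le_pow_left₀ (abs_nonneg _) ht _).trans (pow_le_pow_right₀ hR k.2.le)).trans hRE
    rw [e1, ← mul_sub, ← mul_sub_one, abs_mul, abs_mul, abs_mul, abs_pow, abs_of_pos (exp_pos _)]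
    gcongr
    exact hp k l
  have hdiff : |∑ k, ∑ l, (p k l : ℝ) * (t : ℝ) ^ (k : ℕ) * A i₀ ^ (l : ℕ) -
      ∑ k, ∑ l, (p k l : ℝ) * t ^ (k : ℕ) * exp (l * c * t)| ≤ exp (-(T / 2)) := by
    rw [← Finset.sum_sub_distrib]
    simp only [← Finset.sum_sub_distrib]
    refine (Finset.abs_sum_le_sum_abs _ _).trans ((Finset.sum_le_sum fun k _ =>
      (Finset.abs_sum_le_sum_abs _ _).trans (Finset.sum_le_sum fun l _ => hterm k l)).trans ?_)
    simp only [Finset.sum_const, Finset.card_univ, Fintype.card_fin, nsmul_eq_mul]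
    have h1 : ((E : ℝ) * (B ^ 2 : ℕ)) ≤ exp (T / 1000) := by exact_mod_cast hN
    have h2 : (2 : ℝ) ≤ exp (T / 1000) := by
      have := add_one_le_exp (T / 1000)
      linarith
    calc (E : ℝ) * ((B ^ 2 : ℕ) * (exp (T / 100) * exp (T / 100) *
          (exp (T / 10000) * (2 * exp (-T)))))
        = (E : ℝ) * (B ^ 2 : ℕ) * (exp (T / 100) * exp (T / 100) *
          (exp (T / 10000) * (2 * exp (-T)))) := by ring
      _ ≤ exp (T / 1000) * (exp (T / 100) * exp (T / 100) *
          (exp (T / 10000) * (exp (T / 1000) * exp (-T)))) := by gcongr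
      _ ≤ exp (-(T / 2)) := by
        simp only [← exp_add]
        gcongr
        linarith
  have h3 : exp (-(7 * (T / 20))) ≤ 2 * exp (-(T / 2)) := by
    refine hlow.trans ?_
    have := abs_sub_abs_le_abs_sub (∑ k, ∑ l, (p k l : ℝ) * (t : ℝ) ^ (k : ℕ) * A i₀ ^ (l : ℕ))
      (∑ k, ∑ l, (p k l : ℝ) * t ^ (k : ℕ) * exp (l * c * t))
    linarith
  have h4 : exp (-(7 * (T / 20))) = exp (-(T / 2)) * exp (3 * T / 20) := by
    rw [← exp_add]; congr 1; ring
  rw [h4] at h3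
  have h5 := add_one_le_exp (3 * T / 20)
  nlinarith [exp_pos (-(T / 2))]

theorem HeightLE.log_eq_zero {ι : Type*} [Fintype ι] [DecidableEq ι]
    (hι : Fintype.card ι = 4) {i₀ : ι} {O : Subring (ι → ℝ)}
    (hO : ∀ y ∈ O, y i₀ ≠ 0 → 1 ≤ ∏ i, |y i|) {g : ℝ} {a : ι → ℝ} (ha : HeightLE O g a)
    (hg : 0 ≤ g) (hpos : 0 < a i₀) (hlog : |log (a i₀)| < exp (-(7 * g + 8))) :
    log (a i₀) = 0 := by
  by_cases h : a i₀ = 1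
  · rw [h, log_one]
  exfalso
  have h1 := (ha.sub_one hg).le_abs hι hO (by simpa [sub_eq_zero] using h)
  simp only [Pi.sub_apply, Pi.one_apply] at h1
  have h2 : |exp (log (a i₀)) - 1| ≤ 2 * |log (a i₀)| := by
    refine Real.abs_exp_sub_one_le (hlog.le.trans ?_)
    rw [exp_le_one_iff]; linarith
  rw [exp_log hpos] at h2
  have h3 : exp (-(7 * (g + 1))) = exp 1 * exp (-(7 * g + 8)) := by
    rw [← exp_add]; congr 1; ring
  have h4 := add_one_le_exp (1 : ℝ)
  nlinarith [exp_pos (-(7 * g + 8))]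

end LinearForm
section LinearFormTwo

theorem exists_pow_le_exp : ∃ B₀ : ℕ, ∀ B : ℕ, B₀ ≤ B → (B : ℝ) ^ 6000 ≤ exp (B / 100) := by
  have h1 := (isLittleO_pow_exp_pos_mul_atTop (k := 6000) (b := 1 / 100) (by norm_num)).bound
    (c := 1) one_pos
  have h2 := tendsto_natCast_atTop_atTop.eventually h1
  obtain ⟨B₀, hB₀⟩ := Filter.eventually_atTop.mp h2
  refine ⟨B₀, fun B hB => ?_⟩
  have := hB₀ B hB
  rw [one_mul, Real.norm_of_nonneg (by positivity), Real.norm_of_nonneg (exp_pos _).le] at this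
  convert this using 2
  ring

theorem parameter_bounds {B h M q : ℕ} (hB : 10000 ≤ B) (hBexp : (B : ℝ) ^ 6000 ≤ exp (B / 100))
    (hh : 1 ≤ h) (hq : 1 ≤ q) (hqM : q ^ 2 ≤ 200 * M) (hM1 : h ^ 2 * B ^ 20 ≤ M)
    (hM2 : M ≤ B ^ 2000) :
    (10 * (B * (16 * h ^ 2 * B ^ 7 * q : ℕ)) : ℝ) ≤ h * M / 100 ∧
      (100 * q * h * B ^ 5 * M : ℝ) ≤ exp (B / 100) ∧ 20 * q * h * B ^ 5 < M := by
  have key : q * h * B ^ 10 ≤ 15 * M := by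
    refine (Nat.pow_le_pow_iff_left two_ne_zero).mp ?_
    calc (q * h * B ^ 10) ^ 2 = q ^ 2 * (h ^ 2 * B ^ 20) := by ring
      _ ≤ (200 * M) * M := by gcongr
      _ ≤ (15 * M) ^ 2 := by nlinarith
  have hB5 : 10000 ≤ B ^ 5 := hB.trans (Nat.le_self_pow (by norm_num) B)
  have hpos : 1 ≤ q * h * B ^ 5 := by
    have : 0 < q * h * B ^ 5 := by positivity
    exact this
  have key5 : 10000 * (q * h * B ^ 5) ≤ 15 * M := by
    calc 10000 * (q * h * B ^ 5) ≤ B ^ 5 * (q * h * B ^ 5) := by gcongr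
      _ = q * h * B ^ 10 := by ring
      _ ≤ _ := key
  refine ⟨?_, ?_, ?_⟩
  · have h1 : 1000 * (B * (16 * h ^ 2 * B ^ 7 * q)) ≤ h * M := by
      have h2 : 16000 * (q * h * B ^ 8) ≤ M := by
        have h3 : 240000 * (q * h * B ^ 8) ≤ B ^ 2 * (q * h * B ^ 8) := by
          gcongr; nlinarith
        have h4 : B ^ 2 * (q * h * B ^ 8) = q * h * B ^ 10 := by ring
        omega
      calc 1000 * (B * (16 * h ^ 2 * B ^ 7 * q)) = h * (16000 * (q * h * B ^ 8)) := by ring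
        _ ≤ h * M := by gcongr
    have h2 : (1000 * (B * (16 * h ^ 2 * B ^ 7 * q : ℕ)) : ℝ) ≤ h * M := by exact_mod_cast h1
    linarith
  · refine le_trans ?_ hBexp
    have h1 : 100 * q * h * B ^ 5 * M ≤ M ^ 3 := by
      have h2 : 100 * (q * h * B ^ 5) ≤ M * M := by nlinarith
      calc 100 * q * h * B ^ 5 * M = 100 * (q * h * B ^ 5) * M := by ring
        _ ≤ M * M * M := by gcongr
        _ = M ^ 3 := by ring
    have h3 : M ^ 3 ≤ B ^ 6000 := by
      calc M ^ 3 ≤ (B ^ 2000) ^ 3 := by gcongr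
        _ = B ^ 6000 := by rw [← pow_mul]
    exact_mod_cast h1.trans h3
  · nlinarith

/-- If `r / s = b₁ / b₂` for coprime `b₁, b₂`, then `(r, s)` is a multiple of `(b₁, b₂)`. -/
theorem abs_le_of_isCoprime {b₁ b₂ r s : ℤ} (hb : IsCoprime b₁ b₂) (h : r * b₂ = s * b₁)
    (hne : r ≠ 0 ∨ s ≠ 0) : |b₁| ≤ |r| ∧ |b₂| ≤ |s| := by
  obtain ⟨p, q, hpq⟩ := hb
  have hr : (p * r + q * s) * b₁ = r := by
    linear_combination r * hpq - q * h
  have hs : (p * r + q * s) * b₂ = s := by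
    linear_combination s * hpq + p * h
  have hk : p * r + q * s ≠ 0 := by
    intro h0
    rw [h0, zero_mul] at hr hs
    rcases hne with hne | hne
    · exact hne hr.symm
    · exact hne hs.symm
  have hk1 : 1 ≤ |p * r + q * s| := Int.one_le_abs hk
  constructor
  · rw [← hr, abs_mul]; nlinarith [abs_nonneg b₁]
  · rw [← hs, abs_mul]; nlinarith [abs_nonneg b₂]

theorem abs_natCast_sub_natCast_lt {a b n : ℕ} (ha : a < n) (hb : b < n) :
    |(a : ℤ) - b| < n := by
  rw [abs_lt]; constructor <;> omega


theorem abs_le_abs_sq (b : ℤ) : |(b : ℝ)| ≤ (b : ℝ) ^ 2 := by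
  have : |b| ≤ b ^ 2 := by
    rw [← sq_abs]
    rcases eq_or_ne b 0 with rfl | hb0
    · simp
    · nlinarith [Int.one_le_abs hb0]
  exact_mod_cast this

theorem abs_le_of_multiplicative_relation {l₁ l₂ c μ ν V W η : ℝ} {b₁ b₂ r s : ℤ}
    (hc₁ : l₁ = c * b₂ + b₁ * μ) (hc₂ : l₂ = -(c * b₁) + b₂ * μ) (hμ₁ : |b₁ * μ| ≤ ν)
    (hμ₂ : |b₂ * μ| ≤ ν) (hrs : r * l₁ + s * l₂ = 0) (hne : r * b₂ - s * b₁ ≠ 0)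
    (hr : |(r : ℝ)| ≤ V) (hs : |(s : ℝ)| ≤ V) (hb₁ : |(b₁ : ℝ)| ≤ W) (hb₂ : |(b₂ : ℝ)| ≤ W)
    (hη : (2 * V * W + 1) * ν ≤ η) : |l₁| ≤ η ∧ |l₂| ≤ η := by
  have hν : 0 ≤ ν := (abs_nonneg _).trans hμ₁
  have hV : 0 ≤ V := (abs_nonneg _).trans hr
  have hct : c * ((r * b₂ - s * b₁ : ℤ) : ℝ) = -(r * (b₁ * μ) + s * (b₂ * μ)) := by
    rw [hc₁, hc₂] at hrs
    push_cast
    linear_combination hrs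
  have ht1 : (1 : ℝ) ≤ |((r * b₂ - s * b₁ : ℤ) : ℝ)| := by exact_mod_cast Int.one_le_abs hne
  have hcle : |c| ≤ 2 * V * ν := by
    calc |c| ≤ |c| * |((r * b₂ - s * b₁ : ℤ) : ℝ)| := le_mul_of_one_le_right (abs_nonneg _) ht1
      _ = |r * (b₁ * μ) + s * (b₂ * μ)| := by rw [← abs_mul, hct, abs_neg]
      _ ≤ |(r : ℝ)| * |b₁ * μ| + |(s : ℝ)| * |b₂ * μ| := by
        rw [← abs_mul, ← abs_mul]; exact abs_add_le _ _
      _ ≤ V * ν + V * ν := by gcongr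
      _ = 2 * V * ν := by ring
  have key : ∀ b : ℝ, |b| ≤ W → |c| * |b| + ν ≤ η := by
    intro b hb
    have : |c| * |b| ≤ 2 * V * ν * W := by gcongr
    linarith
  constructor
  · rw [hc₁]
    refine (abs_add_le _ _).trans (le_trans ?_ (key _ hb₂))
    rw [abs_mul]
    linarith
  · rw [hc₂]
    refine (abs_add_le _ _).trans (le_trans ?_ (key _ hb₁))
    rw [abs_neg, abs_mul]
    linarith

theorem HeightLE.polynomial_eq_zero_of_box {ι : Type} [Fintype ι] [DecidableEq ι]
    (hι : Fintype.card ι = 4) {i₀ : ι} {O : Subring (ι → ℝ)}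
    (hO : ∀ y ∈ O, y i₀ ≠ 0 → 1 ≤ ∏ i, |y i|) {B E : ℕ} (hB : 10000 ≤ B) (hE : B ≤ E)
    {a₁ a₂ : ι → ℝ} {γ₁ γ₂ G ν V : ℝ} (ha₁ : HeightLE O γ₁ a₁) (ha₂ : HeightLE O γ₂ a₂)
    (hγ₁ : 0 ≤ γ₁) (hγ₂ : 0 ≤ γ₂) (hp₁ : 0 < a₁ i₀) (hp₂ : 0 < a₂ i₀) {R₁ R₂ : ℕ}
    (hG₁ : R₁ * γ₁ ≤ G) (hG₂ : R₂ * γ₂ ≤ G) (hG : B ^ 2 * (4 * G) ≤ E) (hV₁ : R₁ ≤ V)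
    (hV₂ : R₂ ≤ V) {b₁ b₂ : ℤ} {c μ : ℝ} (hc₁ : log (a₁ i₀) = c * b₂ + b₁ * μ)
    (hc₂ : log (a₂ i₀) = -(c * b₁) + b₂ * μ) (hμ₁ : |b₁ * μ| ≤ ν) (hμ₂ : |b₂ * μ| ≤ ν)
    (hν : B ^ 2 * (4 * V * ν) ≤ exp (-(B * E))) {R : ℝ}
    (hR : R = 2 * R₁ * |(b₂ : ℝ)| + 2 * R₂ * |(b₁ : ℝ)|) (hR1 : 1 ≤ R)
    (hRlog : log R ≤ B / 100) (hcR : B ^ 2 * |c| * R ≤ E) (p : Fin E → Fin (B ^ 2) → ℤ)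
    (hp : ∀ k l, |(p k l : ℝ)| ≤ exp (B * E / 100))
    (hf : ∀ t : ℝ, |t| ≤ R → |∑ k, ∑ l, (p k l : ℝ) * t ^ (k : ℕ) * exp (l * c * t)| ≤
        exp (-(B * E / 2))) (r s : ℕ) (hr : r < 2 * R₁) (hs : s < 2 * R₂) :
    ∑ k, ∑ l, (p k l : ℝ) * ((r : ℝ) * b₂ - s * b₁) ^ (k : ℕ) *
        (a₁ i₀ ^ r * a₂ i₀ ^ s) ^ (l : ℕ) = 0 := by
  have hν0 : 0 ≤ ν := (abs_nonneg _).trans hμ₁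
  have hr' : (r : ℝ) ≤ 2 * R₁ := by exact_mod_cast hr.le
  have hs' : (s : ℝ) ≤ 2 * R₂ := by exact_mod_cast hs.le
  have hg : (r : ℝ) * γ₁ + s * γ₂ ≤ 4 * G := by
    have e1 : (r : ℝ) * γ₁ ≤ 2 * R₁ * γ₁ := by gcongr
    have e2 : (s : ℝ) * γ₂ ≤ 2 * R₂ * γ₂ := by gcongr
    linarith
  have htR : |(((r : ℤ) * b₂ - s * b₁ : ℤ) : ℝ)| ≤ R := by
    push_cast
    refine (abs_sub _ _).trans ?_
    rw [abs_mul, abs_mul, Nat.abs_cast, Nat.abs_cast, hR]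
    gcongr
  have hexp : (a₁ ^ r * a₂ ^ s) i₀ = exp (c * (((r : ℤ) * b₂ - s * b₁ : ℤ) : ℝ) +
      (r * (b₁ * μ) + s * (b₂ * μ))) := by
    rw [Pi.mul_apply, Pi.pow_apply, Pi.pow_apply, ← exp_log hp₁, ← exp_log hp₂, ← exp_nat_mul,
      ← exp_nat_mul, ← exp_add, hc₁, hc₂]
    congr 1
    push_cast
    ring
  have hε : B ^ 2 * |r * (b₁ * μ) + s * (b₂ * μ)| ≤ exp (-(B * E)) := by
    refine le_trans ?_ hν
    gcongr
    refine (abs_add_le _ _).trans ?_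
    rw [abs_mul (r : ℝ), abs_mul (s : ℝ), Nat.abs_cast, Nat.abs_cast]
    have e2 : (r : ℝ) * |b₁ * μ| ≤ 2 * V * ν :=
      mul_le_mul (by linarith) hμ₁ (abs_nonneg _) (by linarith [Nat.cast_nonneg (α := ℝ) R₁])
    have e3 : (s : ℝ) * |b₂ * μ| ≤ 2 * V * ν :=
      mul_le_mul (by linarith) hμ₂ (abs_nonneg _) (by linarith [Nat.cast_nonneg (α := ℝ) R₁])
    linarith
  have := HeightLE.polynomial_eq_zero hι hO hB hE ((ha₁.pow r).mul (ha₂.pow s)) (by positivity)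
    (le_trans (by gcongr) hG) p hp hR1 hRlog htR hexp hcR hε (hf _ htR)
  simpa using this

set_option maxHeartbeats 1000000 in
theorem linear_form_two_lower_bound {ι : Type} [Fintype ι] [DecidableEq ι]
    (hι : Fintype.card ι = 4) {i₀ : ι} {O : Subring (ι → ℝ)}
    (hO : ∀ y ∈ O, y i₀ ≠ 0 → 1 ≤ ∏ i, |y i|) {B : ℕ} (hB : 10000 ≤ B)
    (hBexp : (B : ℝ) ^ 6000 ≤ exp (B / 100)) {h M n₁ n₂ : ℕ} (hh : 1 ≤ h) (hn₁ : 1 ≤ n₁)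
    (hn₂ : 1 ≤ n₂) (hq : (n₁ * n₂) ^ 2 ≤ 200 * M) (hM1 : h ^ 2 * B ^ 20 ≤ M) (hM2 : M ≤ B ^ 2000)
    {a₁ a₂ : ι → ℝ} (ha₁ : HeightLE O (3 * h * n₁) a₁) (ha₂ : HeightLE O (3 * h * n₂) a₂)
    (hp₁ : 0 < a₁ i₀) (hp₂ : 0 < a₂ i₀) (hl₁ : |log (a₁ i₀)| ≤ 3 * h * n₁)
    (hl₂ : |log (a₂ i₀)| ≤ 3 * h * n₂) {b₁ b₂ : ℤ} (hb : IsCoprime b₁ b₂) (hb₁ : |b₁| ≤ 3 * M)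
    (hb₂ : |b₂| ≤ 3 * M) (hbM : M ≤ 10 * (|b₁| * n₁ + |b₂| * n₂))
    (hΛ : b₁ * log (a₁ i₀) + b₂ * log (a₂ i₀) ≠ 0) :
    exp (-(h * M / 100)) ≤ |b₁ * log (a₁ i₀) + b₂ * log (a₂ i₀)| := by
  by_contra! hlt
  set l₁ := log (a₁ i₀) with hl₁def
  set l₂ := log (a₂ i₀) with hl₂def
  set Λ := b₁ * l₁ + b₂ * l₂ with hΛdef
  set q := n₁ * n₂ with hqdef
  have hq1 : 1 ≤ q := Nat.mul_pos hn₁ hn₂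
  obtain ⟨hpa, hpb, hpc⟩ := parameter_bounds hB hBexp hh hq1 hq hM1 hM2
  set E := 16 * h ^ 2 * B ^ 7 * q with hE
  set w := h * B ^ 5 with hw
  set R₁ := n₂ * w with hR₁
  set R₂ := n₁ * w with hR₂
  have hw1 : 1 ≤ w := Nat.mul_pos hh (by positivity)
  have hBE : B ≤ E := by
    calc B ≤ B ^ 7 := Nat.le_self_pow (by norm_num) B
      _ = 1 * B ^ 7 * 1 := by ring
      _ ≤ E := by rw [hE]; gcongr; nlinarith
  have hBr : (10000 : ℝ) ≤ B := by exact_mod_cast hB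
  have hEr : (B : ℝ) ≤ E := by exact_mod_cast hBE
  have hTbig : (100000000 : ℝ) ≤ B * E := by nlinarith
  set T : ℝ := B * E with hT
  have hΛT : |Λ| ≤ exp (-(10 * T)) := by
    refine hlt.le.trans ?_
    gcongr
  have hRn₁ : R₁ * n₁ = q * w := by rw [hR₁, hqdef]; ring
  have hRn₂ : R₂ * n₂ = q * w := by rw [hR₂, hqdef]; ring
  have hRn₁r : (R₁ : ℝ) * n₁ = q * w := by exact_mod_cast hRn₁
  have hRn₂r : (R₂ : ℝ) * n₂ = q * w := by exact_mod_cast hRn₂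
  have hRq₁ : R₁ ≤ q * w := by rw [← hRn₁]; exact Nat.le_mul_of_pos_right _ hn₁
  have hRq₂ : R₂ ≤ q * w := by rw [← hRn₂]; exact Nat.le_mul_of_pos_right _ hn₂
  have hRq₁r : (R₁ : ℝ) ≤ q * w := by exact_mod_cast hRq₁
  have hRq₂r : (R₂ : ℝ) ≤ q * w := by exact_mod_cast hRq₂
  have hqw1 : (1 : ℝ) ≤ q * w := by exact_mod_cast Nat.mul_pos hq1 hw1
  have hhr : (1 : ℝ) ≤ h := by exact_mod_cast hh
  have hEqw : (E : ℝ) = B ^ 2 * (16 * h * (q * w)) := by rw [hE, hw]; push_cast; ring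
  -- the decomposition of the two logarithms
  have hb0 : b₁ ≠ 0 ∨ b₂ ≠ 0 := hb.ne_zero_or_ne_zero
  have hb1 : (1 : ℝ) ≤ |(b₁ : ℝ)| ∨ (1 : ℝ) ≤ |(b₂ : ℝ)| := by
    rcases hb0 with h0 | h0
    · left; exact_mod_cast Int.one_le_abs h0
    · right; exact_mod_cast Int.one_le_abs h0
  obtain ⟨c, μ, hc₁, hc₂, hμ₁, hμ₂⟩ := exists_decomposition l₁ l₂ b₁ b₂ (abs_le_abs_sq b₁)
    (abs_le_abs_sq b₂) (by
    rcases hb1 with h0 | h0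
    · nlinarith [abs_le_abs_sq b₁, sq_nonneg (b₂ : ℝ)]
    · nlinarith [abs_le_abs_sq b₂, sq_nonneg (b₁ : ℝ)])
  rw [← hΛdef] at hμ₁ hμ₂
  have hb₁r : |(b₁ : ℝ)| ≤ 3 * M := by exact_mod_cast hb₁
  have hb₂r : |(b₂ : ℝ)| ≤ 3 * M := by exact_mod_cast hb₂
  have hcb₂ : |c| * |(b₂ : ℝ)| ≤ 3 * h * n₁ + |Λ| := by
    rw [← abs_mul]
    have : c * b₂ = l₁ - b₁ * μ := by rw [hc₁]; ring
    rw [this]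
    exact (abs_sub _ _).trans (by linarith)
  have hcb₁ : |c| * |(b₁ : ℝ)| ≤ 3 * h * n₂ + |Λ| := by
    rw [← abs_mul]
    have : c * b₁ = b₂ * μ - l₂ := by rw [hc₂]; ring
    rw [this]
    exact (abs_sub _ _).trans (by linarith)
  set R : ℝ := 2 * R₁ * |(b₂ : ℝ)| + 2 * R₂ * |(b₁ : ℝ)| with hR
  have hR₁1 : (1 : ℝ) ≤ R₁ := by exact_mod_cast Nat.mul_pos hn₂ hw1
  have hR₂1 : (1 : ℝ) ≤ R₂ := by exact_mod_cast Nat.mul_pos hn₁ hw1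
  have hR1 : 1 ≤ R := by
    rw [hR]
    rcases hb1 with h0 | h0
    · have := mul_le_mul hR₂1 h0 zero_le_one (by linarith)
      have h2 : 0 ≤ 2 * R₁ * |(b₂ : ℝ)| := by positivity
      linarith
    · have := mul_le_mul hR₁1 h0 zero_le_one (by linarith)
      have h2 : 0 ≤ 2 * R₂ * |(b₁ : ℝ)| := by positivity
      linarith
  have hqwM : 100 * (q * w * M) ≤ exp (B / 100) := by
    refine le_trans (le_of_eq ?_) hpb
    rw [hw]; push_cast; ring
  have hRle : R ≤ exp (B / 100) := by
    refine le_trans ?_ hqwM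
    have h1 : 2 * R₁ * |(b₂ : ℝ)| ≤ 2 * (q * w) * (3 * M) := by gcongr
    have h2 : 2 * R₂ * |(b₁ : ℝ)| ≤ 2 * (q * w) * (3 * M) := by gcongr
    have h3 : (0 : ℝ) ≤ q * w * M := by positivity
    rw [hR]
    linarith
  have hRlog : log R ≤ B / 100 := (log_le_iff_le_exp (by linarith)).mpr hRle
  have hΛ1 : |Λ| ≤ 1 := hΛT.trans (exp_le_one_iff.mpr (by linarith))
  have hcR : B ^ 2 * |c| * R ≤ E := by
    have h1 : |c| * R ≤ 16 * h * (q * w) := by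
      have e1 : |c| * R = 2 * R₁ * (|c| * |(b₂ : ℝ)|) + 2 * R₂ * (|c| * |(b₁ : ℝ)|) := by
        rw [hR]; ring
      have e2 : 2 * R₁ * (|c| * |(b₂ : ℝ)|) ≤ 2 * R₁ * (3 * h * n₁ + 1) := by
        gcongr; linarith
      have e3 : 2 * R₂ * (|c| * |(b₁ : ℝ)|) ≤ 2 * R₂ * (3 * h * n₂ + 1) := by
        gcongr; linarith
      have e4 : 2 * (R₁ : ℝ) * (3 * h * n₁ + 1) = 6 * h * (R₁ * n₁) + 2 * R₁ := by ring
      have e5 : 2 * (R₂ : ℝ) * (3 * h * n₂ + 1) = 6 * h * (R₂ * n₂) + 2 * R₂ := by ring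
      rw [hRn₁r] at e4
      rw [hRn₂r] at e5
      have e6 : 1 * (q * w : ℝ) ≤ h * (q * w) := by gcongr
      linarith
    rw [hEqw, mul_assoc]
    gcongr
  obtain ⟨p, hp0, hpH, hpf⟩ := exists_auxiliary_function B E hB hBE R c hR1 hRlog hcR
  -- vanishing on the large box
  have hν : (B : ℝ) ^ 2 * (4 * (q * w) * |Λ|) ≤ exp (-(B * E)) := by
    have e2 : (B : ℝ) ^ 2 * (4 * (q * w)) ≤ exp T := by
      have e3 : (E : ℝ) ≤ T := by
        rw [hT]; exact le_mul_of_one_le_left (by linarith only [hBr, hEr]) (by linarith only [hBr])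
      have e4 : (B : ℝ) ^ 2 * (4 * (q * w)) ≤ E := by
        rw [hEqw]; gcongr; linarith only [hhr]
      linarith only [add_one_le_exp T, e3, e4]
    calc (B : ℝ) ^ 2 * (4 * (q * w) * |Λ|) = B ^ 2 * (4 * (q * w)) * |Λ| := by ring
      _ ≤ exp T * exp (-(10 * T)) := by gcongr
      _ ≤ exp (-T) := by rw [← exp_add]; gcongr; linarith only [hTbig]
  have hvan := HeightLE.polynomial_eq_zero_of_box hι hO hB hBE ha₁ ha₂ (by positivity)
    (by positivity) hp₁ hp₂ (R₁ := R₁) (R₂ := R₂) (G := 3 * h * (q * w))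
    (by rw [← hRn₁r]; apply le_of_eq; ring) (by rw [← hRn₂r]; apply le_of_eq; ring)
    (by
      rw [hEqw]
      refine mul_le_mul_of_nonneg_left ?_ (by positivity)
      have : (0 : ℝ) ≤ h * (q * w) := by positivity
      linarith only [this])
    hRq₁r hRq₂r hc₁ hc₂ hμ₁ hμ₂ hν hR hR1 hRlog hcR p hpH hpf
  -- injectivity
  have hinj : ∀ r s r' s' : ℕ, r < R₁ → r' < R₁ → s < R₂ → s' < R₂ →
      (r : ℝ) * b₂ - s * b₁ = r' * b₂ - s' * b₁ → r = r' ∧ s = s' := by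
    intro r s r' s' hr hr' hs hs' heq
    by_contra hne
    have heq' : ((r : ℤ) - r') * b₂ = ((s : ℤ) - s') * b₁ := by
      have : (r : ℤ) * b₂ - s * b₁ = r' * b₂ - s' * b₁ := by exact_mod_cast heq
      linarith
    obtain ⟨h1, h2⟩ := abs_le_of_isCoprime hb heq' (by omega)
    have h3 : |b₁| < (R₁ : ℤ) := h1.trans_lt (abs_natCast_sub_natCast_lt hr hr')
    have h4 : |b₂| < (R₂ : ℤ) := h2.trans_lt (abs_natCast_sub_natCast_lt hs hs')
    have h5 : |b₁| * n₁ ≤ (q * w : ℕ) := by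
      rw [← hRn₁]; push_cast; gcongr
    have h6 : |b₂| * n₂ ≤ (q * w : ℕ) := by
      rw [← hRn₂]; push_cast; gcongr
    have h7 : 20 * (q * w) < M := by
      refine lt_of_eq_of_lt ?_ hpc
      rw [hw]; ring
    have h8 : (20 * (q * w : ℕ) : ℤ) < M := by exact_mod_cast h7
    linarith
  have hinj' : ∀ r s r' s' : ℕ, r < R₁ → r' < R₁ → s < R₂ → s' < R₂ →
      a₁ i₀ ^ r * a₂ i₀ ^ s = a₁ i₀ ^ r' * a₂ i₀ ^ s' → r = r' ∧ s = s' := by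
    intro r s r' s' hr hr' hs hs' heq
    by_contra hne
    have hlog : (r : ℝ) * l₁ + s * l₂ = r' * l₁ + s' * l₂ := by
      have := congrArg log heq
      rwa [log_mul (by positivity) (by positivity), log_mul (by positivity) (by positivity),
        log_pow, log_pow, log_pow, log_pow] at this
    have hlog' : (((r : ℤ) - r' : ℤ) : ℝ) * l₁ + (((s : ℤ) - s' : ℤ) : ℝ) * l₂ = 0 := by
      push_cast
      linear_combination hlog
    have ht0 : ((r : ℤ) - r') * b₂ - ((s : ℤ) - s') * b₁ ≠ 0 := by
      intro h0
      apply hne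
      refine hinj r s r' s' hr hr' hs hs' ?_
      have : ((((r : ℤ) - r') * b₂ - ((s : ℤ) - s') * b₁ : ℤ) : ℝ) = 0 := by rw [h0]; simp
      push_cast at this
      linear_combination this
    have hdr : |(((r : ℤ) - r' : ℤ) : ℝ)| ≤ q * w :=
      le_trans (by exact_mod_cast (abs_natCast_sub_natCast_lt hr hr').le) hRq₁r
    have hds : |(((s : ℤ) - s' : ℤ) : ℝ)| ≤ q * w :=
      le_trans (by exact_mod_cast (abs_natCast_sub_natCast_lt hs hs').le) hRq₂r
    have hsmall : (2 * (q * w) * (3 * M) + 1) * |Λ| ≤ exp (-(9 * T)) := by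
      have hM1r : (1 : ℝ) ≤ M := by
        have : 1 ≤ M := by omega
        exact_mod_cast this
      have e2 : 1 ≤ q * w * (M : ℝ) := one_le_mul_of_one_le_of_one_le hqw1 hM1r
      have e3 : (B : ℝ) / 100 ≤ T := by
        rw [hT]; nlinarith only [hBr, hEr]
      calc (2 * (q * w) * (3 * M) + 1) * |Λ| ≤ exp (B / 100) * exp (-(10 * T)) := by
            gcongr; linarith only [hqwM, e2]
        _ ≤ exp (-(9 * T)) := by rw [← exp_add]; gcongr; linarith only [e3]
    have hbig : ∀ n : ℕ, n ≤ q → 7 * (3 * h * n) + 8 < 9 * T := by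
      intro n hn
      have e1 : (n : ℝ) ≤ q := by exact_mod_cast hn
      have e2 : (16 * h * q : ℝ) ≤ E := by
        have : 16 * h * q ≤ E := by
          calc 16 * h * q = 16 * h * 1 * q := by ring
            _ ≤ 16 * h ^ 2 * B ^ 7 * q := by
              gcongr
              · exact Nat.le_self_pow (by norm_num) h
              · exact Nat.one_le_pow _ _ (by omega)
        exact_mod_cast this
      have e3 : (h : ℝ) * n ≤ h * q := by gcongr
      have e4 : (1000 * E : ℝ) ≤ T := by rw [hT]; nlinarith only [hBr, hEr]
      linarith only [e2, e3, e4, hTbig]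
    obtain ⟨hs₁, hs₂⟩ := abs_le_of_multiplicative_relation hc₁ hc₂ hμ₁ hμ₂ hlog' ht0 hdr hds hb₁r
      hb₂r hsmall
    have hz₁ : l₁ = 0 := by
      refine ha₁.log_eq_zero hι hO (by positivity) hp₁ ?_
      refine hs₁.trans_lt (exp_lt_exp.mpr (neg_lt_neg ?_))
      exact hbig n₁ (Nat.le_mul_of_pos_right _ hn₂)
    have hz₂ : l₂ = 0 := by
      refine ha₂.log_eq_zero hι hO (by positivity) hp₂ ?_
      refine hs₂.trans_lt (exp_lt_exp.mpr (neg_lt_neg ?_))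
      exact hbig n₂ (Nat.le_mul_of_pos_left _ hn₁)
    apply hΛ
    rw [hΛdef, hz₁, hz₂]
    simp
  -- the zero estimate
  have hzero := eq_zero_of_vanishing_on_sumset (A := ℕ × ℕ) (fun k l => (p k l : ℝ))
    (Finset.range R₁ ×ˢ Finset.range R₂) (fun a => (a.1 : ℝ) * b₂ - a.2 * b₁)
    (fun a => a₁ i₀ ^ a.1 * a₂ i₀ ^ a.2)
    (fun a b => by simp only [Prod.fst_add, Prod.snd_add]; push_cast; ring)
    (fun a b => by simp only [Prod.fst_add, Prod.snd_add, pow_add]; ring)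
    (by
      intro a ha b hb' hab
      simp only [Finset.coe_product, Finset.coe_range, Set.mem_prod, Set.mem_Iio] at ha hb'
      have := hinj _ _ _ _ ha.1 hb'.1 ha.2 hb'.2 hab
      exact Prod.ext this.1 this.2)
    (by
      intro a ha b hb' hab
      simp only [Finset.coe_product, Finset.coe_range, Set.mem_prod, Set.mem_Iio] at ha hb'
      have := hinj' _ _ _ _ ha.1 hb'.1 ha.2 hb'.2 hab
      exact Prod.ext this.1 this.2)
    (fun a => by positivity)
    (by
      rw [Finset.card_product, Finset.card_range, Finset.card_range]
      calc E * B ^ 2 = h ^ 2 * q * B ^ 9 * 16 := by rw [hE]; ring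
        _ ≤ h ^ 2 * q * B ^ 9 * B := by gcongr; omega
        _ = R₁ * R₂ := by rw [hR₁, hR₂, hw, hqdef]; ring)
    (by
      intro a ha b hb'
      simp only [Finset.mem_product, Finset.mem_range] at ha hb'
      have := hvan (a.1 + b.1) (a.2 + b.2) (by omega) (by omega)
      simpa using this)
  apply hp0
  ext k l
  have := congrFun (congrFun hzero k) l
  simpa using this

end LinearFormTwo
section LinearFormThree

theorem exists_sup_bound (u : Fin 3 → ℤ) (hu : 1 ≤ u ⬝ᵥ u) :
    ∃ n : ℕ, 1 ≤ n ∧ (∀ j, |u j| ≤ n) ∧ ((n : ℤ) ^ 2 ≤ 4 * (u ⬝ᵥ u)) := by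
  obtain ⟨x, hx⟩ := Int.eq_ofNat_of_zero_le (zero_le_one.trans hu)
  have hx1 : 1 ≤ x := by rw [hx] at hu; exact_mod_cast hu
  refine ⟨Nat.sqrt x + 1, by omega, fun j => ?_, ?_⟩
  · have h1 : u j ^ 2 ≤ u ⬝ᵥ u := by
      simp only [dotProduct]
      rw [sq]
      exact Finset.single_le_sum (f := fun i => u i * u i) (fun i _ => mul_self_nonneg _)
        (Finset.mem_univ j)
    have h2 : (x : ℤ) < ((Nat.sqrt x + 1 : ℕ) : ℤ) ^ 2 := by
      have := Nat.lt_succ_sqrt' x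
      exact_mod_cast this
    refine abs_le_of_sq_le_sq ?_ (by positivity)
    rw [hx] at h1
    exact h1.trans h2.le
  · rw [hx]
    have h1 : 1 ≤ Nat.sqrt x := Nat.le_sqrt.mpr (by omega)
    have h2 : Nat.sqrt x ^ 2 ≤ x := Nat.sqrt_le' x
    have h3 : (Nat.sqrt x + 1) ^ 2 ≤ 4 * x := by nlinarith
    exact_mod_cast h3

theorem HeightLE.monomial {ι : Type*} {O : Subring (ι → ℝ)} {h : ℝ} (hh : 0 ≤ h)
    {α : Fin 3 → ι → ℝ} (hα : ∀ j, HeightLE O h (α j)) (hα' : ∀ j, HeightLE O h (α j)⁻¹)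
    {u : Fin 3 → ℤ} {n : ℕ} (hu : ∀ j, |u j| ≤ n) :
    HeightLE O (3 * h * n) (α 0 ^ u 0 * α 1 ^ u 1 * α 2 ^ u 2) := by
  have hu' : ∀ j, |(u j : ℝ)| ≤ n := fun j => by exact_mod_cast hu j
  have key : ∀ j, HeightLE O (h * n) (α j ^ u j) := fun j =>
    ((hα j).zpow (hα' j) (u j)).mono (by rw [mul_comm h]; gcongr; exact hu' j)
  exact (((key 0).mul (key 1)).mul (key 2)).mono (by linarith)

theorem linear_form_three_lower_bound {ι : Type} [Fintype ι] [DecidableEq ι]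
    (hι : Fintype.card ι = 4) {i₀ : ι} {O : Subring (ι → ℝ)}
    (hO : ∀ y ∈ O, y i₀ ≠ 0 → 1 ≤ ∏ i, |y i|) {B : ℕ} (hB : 10000 ≤ B)
    (hBexp : (B : ℝ) ^ 6000 ≤ exp (B / 100)) {h M : ℕ} (hh : 1 ≤ h)
    (hM1 : h ^ 2 * B ^ 20 ≤ M) (hM2 : M ≤ B ^ 2000)
    {α : Fin 3 → ι → ℝ} (hα : ∀ j, HeightLE O h (α j)) (hα' : ∀ j, HeightLE O h (α j)⁻¹)
    (hpos : ∀ j, 0 < α j i₀) {v : Fin 3 → ℤ} (hv0 : v 0 = 1) (hv : ∀ j, |v j| ≤ M)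
    (hvM : ∃ j, M ≤ 10 * |v j|) (hΛ : ∑ j, v j * log (α j i₀) ≠ 0) :
    exp (-(h * M / 100)) ≤ |∑ j, v j * log (α j i₀)| := by
  have hM : 1 ≤ M := le_trans (Nat.mul_pos (by positivity) (by positivity)) hM1
  obtain ⟨u₁, u₂, b₁, b₂, hvb, hx₁, hx₂, hxx, hb₁, hb₂⟩ :=
    exists_reduced_pair v hv0 M hM (hv 1) (hv 2)
  obtain ⟨n₁, hn₁, hu₁, hnx₁⟩ := exists_sup_bound u₁ hx₁
  obtain ⟨n₂, hn₂, hu₂, hnx₂⟩ := exists_sup_bound u₂ hx₂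
  have hq : (n₁ * n₂) ^ 2 ≤ 200 * M := by
    have h1 : ((n₁ : ℤ) ^ 2) * (n₂ : ℤ) ^ 2 ≤ (4 * (u₁ ⬝ᵥ u₁)) * (4 * (u₂ ⬝ᵥ u₂)) := by
      gcongr
    have h2 : ((n₁ * n₂ : ℕ) : ℤ) ^ 2 ≤ 200 * (M : ℤ) := by
      push_cast
      rw [mul_pow]
      have h3 : (0 : ℤ) ≤ M := by positivity
      linarith only [h1, hxx, h3]
    exact_mod_cast h2
  have hb3 : ∀ b : ℤ, b ^ 2 ≤ 6 * (M : ℤ) ^ 2 → |b| ≤ 3 * M := fun b hb =>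
    abs_le_of_sq_le_sq (by linarith only [hb, sq_nonneg (M : ℤ), mul_pow (3 : ℤ) M 2])
      (by positivity)
  have hlogα : ∀ j, |log (α j i₀)| ≤ h := by
    intro j
    obtain ⟨_, _, _, _, h1⟩ := hα j
    obtain ⟨_, _, _, _, h2⟩ := hα' j
    have h3 := h1 i₀
    have h4 := h2 i₀
    rw [abs_of_pos (hpos j)] at h3
    rw [Pi.inv_apply, abs_of_pos (inv_pos.mpr (hpos j))] at h4
    have h5 := (log_le_iff_le_exp (hpos j)).mpr h3
    have h6 := (log_le_iff_le_exp (inv_pos.mpr (hpos j))).mpr h4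
    rw [log_inv] at h6
    exact abs_le.mpr ⟨by linarith, h5⟩
  have hlog : ∀ u : Fin 3 → ℤ, log ((α 0 ^ u 0 * α 1 ^ u 1 * α 2 ^ u 2) i₀) =
      ∑ j, u j * log (α j i₀) := by
    intro u
    have hz : ∀ j, α j i₀ ^ u j ≠ 0 := fun j => (zpow_pos (hpos j) _).ne'
    simp only [Pi.mul_apply, Pi.pow_apply, Fin.sum_univ_three]
    rw [log_mul (mul_ne_zero (hz 0) (hz 1)) (hz 2), log_mul (hz 0) (hz 1), log_zpow, log_zpow,
      log_zpow]
  have hlog' : ∀ (u : Fin 3 → ℤ) (n : ℕ), (∀ j, |u j| ≤ n) →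
      |log ((α 0 ^ u 0 * α 1 ^ u 1 * α 2 ^ u 2) i₀)| ≤ 3 * h * n := by
    intro u n hu
    rw [hlog]
    have : ∀ j, |u j * log (α j i₀)| ≤ n * h := fun j => by
      rw [abs_mul]
      have : |(u j : ℝ)| ≤ n := by exact_mod_cast hu j
      gcongr
      exact hlogα j
    refine (Finset.abs_sum_le_sum_abs _ _).trans ((Finset.sum_le_sum fun j _ => this j).trans ?_)
    simp only [Finset.sum_const, Finset.card_univ, Fintype.card_fin, nsmul_eq_mul]
    apply le_of_eq; push_cast; ring
  have hp : ∀ u : Fin 3 → ℤ, 0 < (α 0 ^ u 0 * α 1 ^ u 1 * α 2 ^ u 2) i₀ := fun u =>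
    mul_pos (mul_pos (zpow_pos (hpos 0) _) (zpow_pos (hpos 1) _)) (zpow_pos (hpos 2) _)
  have hΛeq : b₁ * log ((α 0 ^ u₁ 0 * α 1 ^ u₁ 1 * α 2 ^ u₁ 2) i₀) +
      b₂ * log ((α 0 ^ u₂ 0 * α 1 ^ u₂ 1 * α 2 ^ u₂ 2) i₀) = ∑ j, v j * log (α j i₀) := by
    rw [hlog, hlog, Finset.mul_sum, Finset.mul_sum, ← Finset.sum_add_distrib]
    refine Finset.sum_congr rfl fun j _ => ?_
    rw [hvb j]
    push_cast
    ring
  rw [← hΛeq] at hΛ ⊢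
  refine linear_form_two_lower_bound hι hO hB hBexp hh hn₁ hn₂ hq hM1 hM2
    (HeightLE.monomial (by positivity) hα hα' hu₁) (HeightLE.monomial (by positivity) hα hα' hu₂)
    (hp u₁) (hp u₂) (hlog' u₁ n₁ hu₁) (hlog' u₂ n₂ hu₂) ?_ (hb3 b₁ hb₁) (hb3 b₂ hb₂) ?_ hΛ
  · refine ⟨u₁ 0, u₂ 0, ?_⟩
    rw [mul_comm, mul_comm (u₂ 0), ← hvb 0, hv0]
  · obtain ⟨j, hj⟩ := hvM
    refine hj.trans ?_
    rw [hvb j]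
    have h1 : |b₁ * u₁ j + b₂ * u₂ j| ≤ |b₁| * n₁ + |b₂| * n₂ := by
      refine (abs_add_le _ _).trans ?_
      rw [abs_mul, abs_mul]
      have := hu₁ j
      have := hu₂ j
      gcongr
    linarith only [h1]

end LinearFormThree
section Biquadratic

theorem eq_zero_of_sq_eq_mul_sq {D x y : ℤ} (hD : ¬ IsSquare D) (h : x ^ 2 = D * y ^ 2) :
    y = 0 := by
  by_contra hy
  have h1 : y ∣ x := (Int.pow_dvd_pow_iff two_ne_zero).mp ⟨D, by rw [h]; ring⟩
  obtain ⟨k, rfl⟩ := h1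
  apply hD
  refine ⟨k, ?_⟩
  have : y ^ 2 * (k * k) = y ^ 2 * D := by linear_combination h
  exact (mul_left_cancel₀ (pow_ne_zero 2 hy) this).symm

theorem eq_zero_of_biquadratic_norm {D₁ D₂ a b c d : ℤ} (h₁ : 0 < D₁) (hD₁ : ¬ IsSquare D₁)
    (hD₂ : ¬ IsSquare D₂) (hD₁₂ : ¬ IsSquare (D₁ * D₂))
    (hA : a ^ 2 + b ^ 2 * D₁ - D₂ * (c ^ 2 + d ^ 2 * D₁) = 0) (hB : a * b - D₂ * (c * d) = 0) :
    a = 0 ∧ b = 0 ∧ c = 0 ∧ d = 0 := by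
  have hn : c ^ 2 - D₁ * d ^ 2 = 0 := by
    by_contra hn
    set n := c ^ 2 - D₁ * d ^ 2 with hndef
    have h1 : (a * c - b * d * D₁) ^ 2 + D₁ * (b * c - a * d) ^ 2 = D₂ * n ^ 2 := by
      rw [hndef]
      linear_combination (c ^ 2 + D₁ * d ^ 2) * hA - 4 * c * d * D₁ * hB
    have h2 : (a * c - b * d * D₁) * (b * c - a * d) = 0 := by
      linear_combination (c ^ 2 + D₁ * d ^ 2) * hB - c * d * hA
    rcases mul_eq_zero.mp h2 with h3 | h3
    · rw [h3] at h1
      exact hn (eq_zero_of_sq_eq_mul_sq (x := D₁ * (b * c - a * d)) hD₁₂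
        (by linear_combination D₁ * h1))
    · rw [h3] at h1
      exact hn (eq_zero_of_sq_eq_mul_sq (x := a * c - b * d * D₁) hD₂ (by linear_combination h1))
  have hd : d = 0 := eq_zero_of_sq_eq_mul_sq (x := c) hD₁ (by linear_combination hn)
  have hc : c = 0 := by
    rw [hd] at hn
    simpa using hn
  rw [hc, hd] at hA
  have hb : b = 0 := by
    have : b ^ 2 * D₁ ≤ 0 := by nlinarith [sq_nonneg a]
    have : b ^ 2 ≤ 0 := by nlinarith
    exact pow_eq_zero_iff two_ne_zero |>.mp (le_antisymm this (sq_nonneg b))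
  rw [hb] at hA
  exact ⟨by simpa using hA, hb, hc, hd⟩

/-- The real number `1` or `-1` attached to a Boolean. -/
noncomputable def boolSign (b : Bool) : ℝ := if b then 1 else -1

theorem boolSign_mul_self (b : Bool) : boolSign b * boolSign b = 1 := by
  cases b <;> simp [boolSign]

/-- The four real conjugates of `a + b √D₁ + c √D₂ + d √D₁ √D₂`. -/
noncomputable def biquadratic (D₁ D₂ : ℕ) (a b c d : ℝ) (i : Bool × Bool) : ℝ :=
  a + b * (boolSign i.1 * √D₁) + c * (boolSign i.2 * √D₂) +
    d * (boolSign i.1 * √D₁ * (boolSign i.2 * √D₂))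

/-- The order `ℤ[√D₁, √D₂]`, embedded by its four real conjugates. -/
noncomputable def biquadraticOrder (D₁ D₂ : ℕ) : Subring (Bool × Bool → ℝ) where
  carrier := {y | ∃ a b c d : ℤ, y = biquadratic D₁ D₂ a b c d}
  mul_mem' := by
    rintro _ _ ⟨a, b, c, d, rfl⟩ ⟨a', b', c', d', rfl⟩
    refine ⟨a * a' + D₁ * (b * b') + D₂ * (c * c') + D₁ * D₂ * (d * d'),
      a * b' + b * a' + D₂ * (c * d' + d * c'), a * c' + c * a' + D₁ * (b * d' + d * b'),
      a * d' + d * a' + b * c' + c * b', ?_⟩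
    ext i
    have h1 : (boolSign i.1 * √D₁) * (boolSign i.1 * √D₁) = D₁ := by
      rw [mul_mul_mul_comm, boolSign_mul_self, Real.mul_self_sqrt (by positivity), one_mul]
    have h2 : (boolSign i.2 * √D₂) * (boolSign i.2 * √D₂) = D₂ := by
      rw [mul_mul_mul_comm, boolSign_mul_self, Real.mul_self_sqrt (by positivity), one_mul]
    simp only [Pi.mul_apply, biquadratic]
    generalize boolSign i.1 * √D₁ = s at *
    generalize boolSign i.2 * √D₂ = t at *
    push_cast
    linear_combination (b * b' + b * d' * t + d * b' * t + d * d' * t * t) * h1 +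
      (c * c' + c * d' * s + d * c' * s + d * d' * D₁) * h2
  one_mem' := ⟨1, 0, 0, 0, by ext; simp [biquadratic]⟩
  add_mem' := by
    rintro _ _ ⟨a, b, c, d, rfl⟩ ⟨a', b', c', d', rfl⟩
    refine ⟨a + a', b + b', c + c', d + d', ?_⟩
    ext i
    simp only [Pi.add_apply, biquadratic]
    push_cast
    ring
  zero_mem' := ⟨0, 0, 0, 0, by ext; simp [biquadratic]⟩
  neg_mem' := by
    rintro _ ⟨a, b, c, d, rfl⟩
    refine ⟨-a, -b, -c, -d, ?_⟩
    ext i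
    simp only [Pi.neg_apply, biquadratic]
    push_cast
    ring

theorem one_le_prod_abs_of_mem_biquadraticOrder {D₁ D₂ : ℕ} (h₁ : 0 < D₁)
    (hD₁ : ¬ IsSquare (D₁ : ℤ)) (hD₂ : ¬ IsSquare (D₂ : ℤ)) (hD₁₂ : ¬ IsSquare ((D₁ : ℤ) * D₂)) :
    ∀ y ∈ biquadraticOrder D₁ D₂, y (true, true) ≠ 0 → 1 ≤ ∏ i, |y i| := by
  rintro _ ⟨a, b, c, d, rfl⟩ hne
  set A : ℤ := a ^ 2 + b ^ 2 * D₁ - D₂ * (c ^ 2 + d ^ 2 * D₁) with hA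
  set C : ℤ := a * b - D₂ * (c * d) with hC
  have hnorm : ∏ i, biquadratic D₁ D₂ a b c d i = ((A ^ 2 - D₁ * (2 * C) ^ 2 : ℤ) : ℝ) := by
    rw [Fintype.prod_prod_type]
    simp only [Fintype.prod_bool, biquadratic, boolSign]
    have h1 : √(D₁ : ℝ) * √D₁ = D₁ := Real.mul_self_sqrt (by positivity)
    have h2 : √(D₂ : ℝ) * √D₂ = D₂ := Real.mul_self_sqrt (by positivity)
    simp only [if_true, Bool.false_eq_true, if_false]
    rw [hA, hC]
    push_cast
    generalize √(D₁ : ℝ) = s at *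
    generalize √(D₂ : ℝ) = t at *
    rw [← h1, ← h2]
    ring
  rw [← Finset.abs_prod, hnorm]
  have hne' : A ^ 2 - D₁ * (2 * C) ^ 2 ≠ 0 := by
    intro h0
    have h2 : A ^ 2 = D₁ * (2 * C) ^ 2 := by linear_combination h0
    have hC0 : C = 0 := by
      have := eq_zero_of_sq_eq_mul_sq hD₁ h2
      omega
    have hA0 : A = 0 := by
      rw [hC0] at h2
      simpa using h2
    obtain ⟨rfl, rfl, rfl, rfl⟩ := eq_zero_of_biquadratic_norm (by exact_mod_cast h₁) hD₁ hD₂ hD₁₂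
      hA0 hC0
    apply hne
    simp [biquadratic]
  exact_mod_cast Int.one_le_abs hne'

end Biquadratic
section DivisorBound

theorem exists_succ_pow_le_two_pow (j : ℕ) : ∃ C : ℕ, 1 ≤ C ∧ ∀ a : ℕ, (a + 1) ^ j ≤ C * 2 ^ a := by
  have h := tendsto_pow_const_div_const_pow_of_one_lt j (one_lt_two (α := ℝ))
  obtain ⟨c, hc⟩ := h.bddAbove_range
  refine ⟨⌈2 * c⌉₊ + 1, by omega, fun a => ?_⟩
  have h1 : ((a + 1 : ℕ) : ℝ) ^ j / 2 ^ (a + 1) ≤ c := hc ⟨a + 1, rfl⟩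
  rw [div_le_iff₀ (by positivity), pow_succ] at h1
  have h2 := Nat.le_ceil (2 * c)
  have h3 : (((a + 1) ^ j : ℕ) : ℝ) ≤ ((⌈2 * c⌉₊ + 1 : ℕ) : ℝ) * 2 ^ a := by
    push_cast at h1 ⊢
    have : (0 : ℝ) < 2 ^ a := by positivity
    nlinarith
  exact_mod_cast h3

theorem card_divisors_pow_le (j : ℕ) : ∃ C : ℕ, 1 ≤ C ∧
    ∀ n : ℕ, n ≠ 0 → n.divisors.card ^ j ≤ C * n := by
  obtain ⟨c, hc1, hc⟩ := exists_succ_pow_le_two_pow j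
  have key : ∀ n : ℕ, n ≠ 0 →
      n.divisors.card ^ j ≤ c ^ (n.primeFactors ∩ Finset.range (2 ^ j)).card * n := by
    intro n
    induction n using Nat.recOnPosPrimePosCoprime with
    | prime_pow p a hp ha =>
      intro _
      rw [Nat.divisors_prime_pow hp, Finset.card_map, Finset.card_range,
        Nat.primeFactors_prime_pow ha.ne' hp]
      by_cases hpj : p < 2 ^ j
      · rw [Finset.inter_eq_left.mpr (by simpa using hpj), Finset.card_singleton, pow_one]
        exact (hc a).trans (by gcongr; exact hp.two_le)
      · push Not at hpj
        calc (a + 1) ^ j ≤ (2 ^ a) ^ j := by gcongr; exact Nat.lt_two_pow_self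
          _ = (2 ^ j) ^ a := by rw [← pow_mul, ← pow_mul, mul_comm]
          _ ≤ p ^ a := by gcongr
          _ ≤ _ := Nat.le_mul_of_pos_left _ (Nat.pow_pos hc1)
    | zero => intro h; exact absurd rfl h
    | one => intro _; simp
    | coprime a b ha hb hab iha ihb =>
      intro _
      rw [Nat.Coprime.card_divisors_mul hab, hab.primeFactors_mul, mul_pow,
        Finset.union_inter_distrib_right, Finset.card_union_of_disjoint, pow_add]
      · calc _ ≤ _ := Nat.mul_le_mul (iha (by omega)) (ihb (by omega))
          _ = _ := by ring
      · exact hab.disjoint_primeFactors.mono Finset.inter_subset_left Finset.inter_subset_left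
  refine ⟨c ^ (2 ^ j), Nat.one_le_pow _ _ hc1, fun n hn => (key n hn).trans ?_⟩
  gcongr
  exact (Finset.card_le_card Finset.inter_subset_right).trans (by simp)

end DivisorBound
section PellUnit

theorem exists_pell_of_congruent {D p q p' q' v b : ℤ} (hv : p ^ 2 - D * q ^ 2 = v)
    (hv' : p' ^ 2 - D * q' ^ 2 = v) (hv0 : v ≠ 0) (hb : v ∣ p - b * q) (hb' : v ∣ p' - b * q')
    (hbD : v ∣ b ^ 2 - D) :
    ∃ a e : ℤ, a ^ 2 - D * e ^ 2 = 1 ∧ v * a = p * p' - D * (q * q') ∧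
      v * e = p * q' - p' * q := by
  obtain ⟨x, hx⟩ := hb
  obtain ⟨y, hy⟩ := hb'
  obtain ⟨z, hz⟩ := hbD
  have ha : v * (v * x * y + x * b * q' + y * b * q + z * q * q') = p * p' - D * (q * q') := by
    linear_combination (-v * y - b * q') * hx - p * hy - q * q' * hz
  have he : v * (x * q' - y * q) = p * q' - p' * q := by
    linear_combination -q' * hx + q * hy
  refine ⟨_, _, ?_, ha, he⟩
  refine mul_left_cancel₀ (pow_ne_zero 2 hv0) ?_
  rw [mul_sub, ← mul_pow, mul_left_comm, ← mul_pow, ha, he]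
  linear_combination (p' ^ 2 - D * q' ^ 2) * hv + v * hv'

theorem exists_sqrt_mod {D p q v : ℤ} (hpq : IsCoprime p q) (hv : p ^ 2 - D * q ^ 2 = v)
    (hv0 : v ≠ 0) : ∃ b : ℕ, b < v.natAbs ∧ v ∣ p - b * q ∧ v ∣ (b : ℤ) ^ 2 - D := by
  have hqv : IsCoprime q v := by
    have h1 : IsCoprime q (p ^ 2) := hpq.symm.pow_right
    have h2 : v = p ^ 2 + q * (-(D * q)) := by rw [← hv]; ring
    rw [h2]
    exact h1.add_mul_left_right _
  obtain ⟨u, w, huw⟩ := hqv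
  have h0 : 0 ≤ (p * u) % v := Int.emod_nonneg _ hv0
  have hb : (((p * u) % v).toNat : ℤ) = (p * u) % v := Int.toNat_of_nonneg h0
  have hm : v ∣ p - (((p * u) % v).toNat : ℤ) * q := by
    rw [hb, Int.emod_def]
    exact ⟨p * w + p * u / v * q, by linear_combination -p * huw⟩
  refine ⟨((p * u) % v).toNat, ?_, hm, ?_⟩
  · have := Int.emod_lt_abs (p * u) hv0
    rw [Int.abs_eq_natAbs] at this
    omega
  · generalize (((p * u) % v).toNat : ℤ) = b at hm
    obtain ⟨x, hx⟩ := hm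
    have h3 : v ∣ q ^ 2 * (b ^ 2 - D) :=
      ⟨1 - x * (p + b * q), by linear_combination hv - (p + b * q) * hx⟩
    have h4 : IsCoprime v (q ^ 2) := by
      have : IsCoprime v q := ⟨w, u, by linear_combination huw⟩
      exact this.pow_right
    exact h4.dvd_of_dvd_mul_left h3

theorem exists_approx_sqrt (D : ℕ) {Q : ℕ} (hQ : 0 < Q) : ∃ p q : ℤ, IsCoprime p q ∧ 0 < q ∧
    q ≤ Q ∧ |q * √D - p| ≤ 1 / (Q + 1) := by
  obtain ⟨r, h1, h2⟩ := Real.exists_rat_abs_sub_le_and_den_le √D hQ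
  have hd : (0 : ℝ) < r.den := by exact_mod_cast r.pos
  refine ⟨r.num, r.den, ?_, by exact_mod_cast r.pos, by exact_mod_cast h2, ?_⟩
  · rw [Int.isCoprime_iff_gcd_eq_one]
    exact r.reduced
  · have h3 : ((r.den : ℤ) : ℝ) * √D - r.num = r.den * (√D - r) := by
      rw [mul_sub]
      congr 1
      have := Rat.den_mul_eq_num r
      exact_mod_cast this.symm
    rw [h3, abs_mul, abs_of_pos hd]
    calc (r.den : ℝ) * |√D - r| ≤ r.den * (1 / ((Q + 1) * r.den)) := by gcongr
      _ = 1 / (Q + 1) := by field_simp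

variable {D Q : ℕ} {p q : ℤ}

theorem norm_of_approx_sqrt (hD : ¬ IsSquare D) (hq : 0 < q) (hqQ : q ≤ Q)
    (h : |q * √D - p| ≤ 1 / (Q + 1)) : p ^ 2 - D * q ^ 2 ≠ 0 ∧
      ((p ^ 2 - D * q ^ 2).natAbs : ℝ) < 2 * √D + 1 ∧ |(p : ℝ)| ≤ 2 * D * Q ∧
      1 ≤ |q * √D - p| * (3 * D * Q) := by
  have hD1 : 2 ≤ D := by
    by_contra hlt
    interval_cases D <;> simp at hD
  have hD2 : (2 : ℝ) ≤ D := by exact_mod_cast hD1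
  have hs : √(D : ℝ) * √D = D := Real.mul_self_sqrt (by positivity)
  have hs0 : 0 ≤ √(D : ℝ) := Real.sqrt_nonneg _
  have hs1 : √(D : ℝ) ≤ 3 / 4 * D := by
    rw [Real.sqrt_le_left (by positivity)]
    nlinarith
  have hne : p ^ 2 - D * q ^ 2 ≠ 0 := by
    intro h0
    have h1 : ¬ IsSquare (D : ℤ) := by rwa [Int.isSquare_natCast_iff]
    exact hq.ne' (eq_zero_of_sq_eq_mul_sq (x := p) h1 (by linear_combination h0))
  have hq1 : (1 : ℝ) ≤ q := by exact_mod_cast hq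
  have hqQ' : (q : ℝ) ≤ Q := by exact_mod_cast hqQ
  have hQ1 : (1 : ℝ) ≤ Q := hq1.trans hqQ'
  have hδ : |q * √D - p| * (Q + 1) ≤ 1 := by
    rwa [le_div_iff₀ (by positivity)] at h
  have hnorm : |(q * √D - p)| * |q * √D + p| = ((p ^ 2 - D * q ^ 2).natAbs : ℝ) := by
    rw [← abs_mul, Nat.cast_natAbs, ← abs_neg]
    push_cast
    congr 1
    linear_combination -(q : ℝ) ^ 2 * hs
  set δ := |q * √D - p| with hδdef
  have hδ0 : 0 ≤ δ := abs_nonneg _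
  have hδ1 : δ ≤ 1 / 2 := by nlinarith
  obtain ⟨hp1, hp2⟩ := abs_le.mp (le_refl δ)
  have hsum : |q * √D + p| ≤ 2 * (q * √D) + δ := by
    rw [abs_le]
    constructor <;> nlinarith
  have hqs : q * √D ≤ Q * √D := by gcongr
  have hqs' : (Q : ℝ) * √D ≤ Q * (3 / 4 * D) := by gcongr
  have hQD : 2 ≤ Q * (D : ℝ) := by nlinarith
  have hn1 : (1 : ℝ) ≤ ((p ^ 2 - D * q ^ 2).natAbs : ℝ) := by
    have : 1 ≤ (p ^ 2 - D * q ^ 2).natAbs := Int.natAbs_pos.mpr hne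
    exact_mod_cast this
  refine ⟨hne, ?_, ?_, ?_⟩
  · rw [← hnorm]
    have h1 : δ * |q * √D + p| ≤ δ * (2 * (Q * √D) + δ) := by gcongr; linarith
    nlinarith
  · rw [abs_le]
    constructor <;> nlinarith
  · calc (1 : ℝ) ≤ _ := hn1
      _ = δ * |q * √D + p| := hnorm.symm
      _ ≤ δ * (3 * D * Q) := by
        gcongr
        nlinarith


/-- A set containing the invariants of all good rational approximations to `√D`. -/
def approxClasses (D R : ℕ) : Finset ((Σ _ : ℕ, ℕ) × ℤ) :=
  ((Finset.range R).sigma fun b => ((b : ℤ) ^ 2 - D).natAbs.divisors) ×ˢ {1, -1}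

theorem exists_pell_unit_le_pow {D : ℕ} (hD : ¬ IsSquare D) : ∃ a e : ℕ, 0 < e ∧
    a ^ 2 = D * e ^ 2 + 1 ∧ 2 * a ≤ (3 * D) ^ (2 * (approxClasses D (2 * D.sqrt + 3)).card + 3) := by
  set R := 2 * D.sqrt + 3 with hR
  set n := (approxClasses D R).card with hn
  have hD1 : 2 ≤ D := by
    by_contra hlt
    interval_cases D <;> simp at hD
  have hDZ : ¬ IsSquare (D : ℤ) := by rwa [Int.isSquare_natCast_iff]
  have happ : ∀ i : ℕ, ∃ p q : ℤ, IsCoprime p q ∧ 0 < q ∧ q ≤ ((3 * D) ^ i : ℕ) ∧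
      |q * √D - p| ≤ 1 / (((3 * D) ^ i : ℕ) + 1) := fun i =>
    exists_approx_sqrt D (by positivity)
  choose p q hpq hq0 hqQ hδ using happ
  have hnorm := fun i => norm_of_approx_sqrt hD (hq0 i) (hqQ i) (hδ i)
  set v : ℕ → ℤ := fun i => p i ^ 2 - D * q i ^ 2 with hv
  have hbex := fun i => exists_sqrt_mod (hpq i) (rfl : p i ^ 2 - D * q i ^ 2 = v i) (hnorm i).1
  choose b hb1 hb2 hb3 using hbex
  have hRR : ∀ i, (v i).natAbs < R := by
    intro i
    have h1 := (hnorm i).2.1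
    have h2 := Real.real_sqrt_le_nat_sqrt_succ (a := D)
    have h3 : ((v i).natAbs : ℝ) < (R : ℕ) := by
      rw [hR]; push_cast
      change ((p i ^ 2 - D * q i ^ 2).natAbs : ℝ) < _
      linarith
    exact_mod_cast h3
  have hmaps : Set.MapsTo (fun i => ((⟨b i, (v i).natAbs⟩, (v i).sign) : (Σ _ : ℕ, ℕ) × ℤ))
      (Finset.range (n + 1) : Set ℕ) (approxClasses D R : Set ((Σ _ : ℕ, ℕ) × ℤ)) := by
    intro i _
    simp only [approxClasses, Finset.coe_product, Set.mem_prod, Finset.mem_coe, Finset.mem_sigma,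
      Finset.mem_range, Nat.mem_divisors, Finset.mem_insert, Finset.mem_singleton]
    refine ⟨⟨(hb1 i).trans (hRR i), Int.natAbs_dvd_natAbs.mpr (hb3 i), ?_⟩, ?_⟩
    · rw [Int.natAbs_ne_zero]
      intro h0
      exact hDZ ⟨b i, by linear_combination -h0⟩
    · rcases lt_or_gt_of_ne (hnorm i).1 with h | h
      · exact Or.inr (Int.sign_eq_neg_one_of_neg h)
      · exact Or.inl (Int.sign_eq_one_of_pos h)
  obtain ⟨i, hi, j, hj, hne, hij⟩ := Finset.exists_ne_map_eq_of_card_lt_of_maps_to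
    (by rw [Finset.card_range]; omega) hmaps
  simp only [Prod.mk.injEq, Sigma.mk.injEq, heq_eq_eq] at hij
  wlog hlt : i < j generalizing i j
  · exact this j hj i hi hne.symm ⟨⟨hij.1.1.symm, hij.1.2.symm⟩, hij.2.symm⟩ (by omega)
  have hvv : v j = v i := by
    rw [← Int.sign_mul_natAbs (v i), ← Int.sign_mul_natAbs (v j), hij.1.2, hij.2]
  have hbj : v j ∣ p j - b j * q j := hb2 j
  rw [← hij.1.1, hvv] at hbj
  obtain ⟨a, e, h1, h2, h3⟩ := exists_pell_of_congruent (rfl : p i ^ 2 - D * q i ^ 2 = v i) hvv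
    (hnorm i).1 (hb2 i) hbj (hb3 i)
  have hQ0 : (0 : ℝ) < ((3 * D) ^ i : ℕ) := by positivity
  have hQij : 3 * (D : ℝ) * ((3 * D) ^ i : ℕ) ≤ ((3 * D) ^ j : ℕ) := by
    have : 3 * D * (3 * D) ^ i ≤ (3 * D) ^ j := by
      rw [← pow_succ']
      exact Nat.pow_le_pow_right (by omega) hlt
    exact_mod_cast this
  have he0 : e ≠ 0 := by
    rintro rfl
    rw [mul_zero] at h3
    have h4 : q i ∣ q j := (hpq i).symm.dvd_of_dvd_mul_left ⟨p j, by linear_combination -h3⟩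
    have h5 : q j ∣ q i := (hpq j).symm.dvd_of_dvd_mul_left ⟨p i, by linear_combination h3⟩
    have h6 : q i = q j := Int.dvd_antisymm (hq0 i).le (hq0 j).le h4 h5
    rw [← h6] at h3
    have h7 : p i = p j := mul_right_cancel₀ (hq0 i).ne' (by linear_combination -h3)
    have h8 := (hnorm i).2.2.2
    have h9 := hδ j
    rw [← h6, ← h7] at h9
    rw [le_div_iff₀ (by positivity)] at h9
    have h10 : 0 ≤ |(q i) * √D - (p i)| := abs_nonneg _
    have h11 : |(q i) * √D - (p i)| * (3 * D * ((3 * D) ^ i : ℕ)) ≤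
      |(q i) * √D - (p i)| * ((3 * D) ^ j : ℕ) := by gcongr
    nlinarith
  refine ⟨a.natAbs, e.natAbs, Int.natAbs_pos.mpr he0, ?_, ?_⟩
  · zify
    rw [sq_abs, sq_abs]
    linear_combination h1
  · have hle : ∀ k ∈ Finset.range (n + 1), ((3 * D) ^ k : ℕ) ≤ (3 * D) ^ n := fun k hk =>
      Nat.pow_le_pow_right (by omega) (by simpa [Nat.lt_succ_iff] using hk)
    have hP : ∀ k ∈ Finset.range (n + 1), |p k| ≤ 2 * D * ((3 * D) ^ n : ℕ) := by
      intro k hk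
      have h4 := (hnorm k).2.2.1
      have h5 : |p k| ≤ 2 * D * ((3 * D) ^ k : ℕ) := by exact_mod_cast h4
      refine h5.trans ?_
      have := hle k hk
      gcongr
    have hQ : ∀ k ∈ Finset.range (n + 1), |q k| ≤ ((3 * D) ^ n : ℕ) := by
      intro k hk
      rw [abs_of_pos (hq0 k)]
      refine (hqQ k).trans ?_
      exact_mod_cast hle k hk
    have h4 : |v i * a| ≤ 2 * D * ((3 * D) ^ n : ℕ) * (2 * D * ((3 * D) ^ n : ℕ)) +
        D * (((3 * D) ^ n : ℕ) * ((3 * D) ^ n : ℕ)) := by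
      rw [h2]
      refine (abs_sub _ _).trans ?_
      rw [abs_mul, abs_mul, abs_mul, Nat.abs_cast]
      have := hP i hi
      have := hP j hj
      have := hQ i hi
      have := hQ j hj
      gcongr
    have h5 : |a| ≤ |v i * a| := by
      rw [abs_mul]
      exact le_mul_of_one_le_left (abs_nonneg _) (Int.one_le_abs (hnorm i).1)
    have h6 : a.natAbs ≤ (4 * D ^ 2 + D) * (3 * D) ^ (2 * n) := by
      zify
      refine (h5.trans h4).trans (le_of_eq ?_)
      push_cast
      ring
    calc 2 * a.natAbs ≤ 2 * ((4 * D ^ 2 + D) * (3 * D) ^ (2 * n)) := by gcongr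
      _ = (2 * (4 * D ^ 2 + D)) * (3 * D) ^ (2 * n) := by ring
      _ ≤ (3 * D) ^ 3 * (3 * D) ^ (2 * n) := by
        gcongr
        nlinarith [pow_le_pow_left₀ (by norm_num) hD1 2]
      _ = _ := by rw [← pow_add, add_comm]

theorem exists_pell_unit_log_le : ∃ C : ℝ, 0 < C ∧ ∀ D : ℕ, ¬ IsSquare D → ∃ a e : ℕ, 0 < e ∧
    a ^ 2 = D * e ^ 2 + 1 ∧ log (2 * a) ≤ C * (D : ℝ) ^ ((13 : ℝ) / 25) := by
  obtain ⟨c, hc1, hc⟩ := card_divisors_pow_le 100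
  have hc1' : (1 : ℝ) ≤ c := by exact_mod_cast hc1
  refine ⟨23 * (25 * c) * 300, by positivity, fun D hD => ?_⟩
  obtain ⟨a, e, he, hae, ha⟩ := exists_pell_unit_le_pow hD
  refine ⟨a, e, he, hae, ?_⟩
  have hD1 : 2 ≤ D := by
    by_contra hlt
    interval_cases D <;> simp at hD
  have hDZ : ¬ IsSquare (D : ℤ) := by rwa [Int.isSquare_natCast_iff]
  have hDR : (1 : ℝ) ≤ D := by exact_mod_cast (by omega : 1 ≤ D)
  have hs1 : (1 : ℝ) ≤ √D := Real.one_le_sqrt.mpr hDR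
  set R := 2 * D.sqrt + 3 with hR
  have hRle : (R : ℝ) ≤ 5 * √D := by
    rw [hR]
    have := Real.nat_sqrt_le_real_sqrt (a := D)
    push_cast
    linarith
  have hRsq : R ^ 2 ≤ 25 * D := by
    have h1 : (R : ℝ) ^ 2 ≤ (5 * √D) ^ 2 := by gcongr
    rw [mul_pow, Real.sq_sqrt (by positivity)] at h1
    have h2 : (R : ℝ) ^ 2 ≤ ((25 * D : ℕ) : ℝ) := by push_cast; linarith
    exact_mod_cast h2
  set X : ℝ := (D : ℝ) ^ ((1 : ℝ) / 100) with hX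
  have hX1 : 1 ≤ X := Real.one_le_rpow hDR (by norm_num)
  have hX100 : X ^ 100 = D := by
    rw [hX, ← Real.rpow_natCast, ← Real.rpow_mul (by positivity)]
    norm_num
  have hdiv : ∀ b ∈ Finset.range R, ((((b : ℤ) ^ 2 - D).natAbs.divisors.card : ℕ) : ℝ) ≤
      25 * c * X := by
    intro b hb
    have hbR : b < R := by simpa using hb
    have h0 : ((b : ℤ) ^ 2 - D).natAbs ≠ 0 := by
      rw [Int.natAbs_ne_zero]
      intro h0
      exact hDZ ⟨b, by linear_combination -h0⟩
    have h1 : ((b : ℤ) ^ 2 - D).natAbs ≤ 25 * D := by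
      have : (b : ℤ) ^ 2 ≤ 25 * D := by
        have : b ^ 2 ≤ 25 * D := (Nat.pow_le_pow_left hbR.le 2).trans hRsq
        exact_mod_cast this
      have := sq_nonneg (b : ℤ)
      omega
    have h2 := (hc _ h0).trans (Nat.mul_le_mul_left c h1)
    refine le_of_pow_le_pow_left₀ (n := 100) (by norm_num) (by positivity) ?_
    calc ((((b : ℤ) ^ 2 - D).natAbs.divisors.card : ℕ) : ℝ) ^ 100 ≤ 25 * c * D := by
          have : ((((b : ℤ) ^ 2 - D).natAbs.divisors.card : ℕ) : ℝ) ^ 100 ≤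
            ((c * (25 * D) : ℕ) : ℝ) := by exact_mod_cast h2
          push_cast at this
          linarith
      _ ≤ (25 * c) ^ 100 * D := by
        gcongr
        exact le_self_pow₀ (by linarith) (by norm_num)
      _ = (25 * c * X) ^ 100 := by rw [mul_pow _ X, hX100]
  have hcard : ((approxClasses D R).card : ℝ) ≤ 2 * (5 * √D * (25 * c * X)) := by
    rw [approxClasses, Finset.card_product, Finset.card_sigma]
    have h1 : (({1, -1} : Finset ℤ)).card = 2 := rfl
    rw [h1]
    push_cast
    rw [mul_comm]
    gcongr
    refine (Finset.sum_le_sum hdiv).trans ?_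
    rw [Finset.sum_const, Finset.card_range, nsmul_eq_mul]
    gcongr
  have hloga : log (2 * a) ≤ (2 * (approxClasses D R).card + 3 : ℕ) * log (3 * D) := by
    rw [← Real.log_pow]
    apply Real.log_le_log
    · have : 0 < a := by
        rcases Nat.eq_zero_or_pos a with h | h
        · rw [h] at hae; simp at hae
        · exact h
      positivity
    · exact_mod_cast ha
  have hlog : log (3 * D) ≤ 300 * X := by
    have h1 : log (3 * D : ℝ) ≤ 2 + log D := by
      rw [Real.log_mul (by norm_num) (by positivity)]
      have : log (3 : ℝ) ≤ 2 := by
        have := Real.log_le_sub_one_of_pos (show (0 : ℝ) < 3 by norm_num)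
        linarith
      linarith
    have h2 := Real.log_le_rpow_div (x := (D : ℝ)) (ε := 1 / 100) (by positivity) (by norm_num)
    rw [← hX] at h2
    linarith
  calc log (2 * a) ≤ _ := hloga
    _ ≤ (23 * (25 * c) * (√D * X)) * (300 * X) := by
      gcongr
      · exact Real.log_nonneg (by linarith)
      · push_cast
        have : (1 : ℝ) ≤ 25 * c * (√D * X) := by
          have := mul_le_mul hs1 hX1 (by norm_num) (by positivity)
          nlinarith
        linarith
    _ = 23 * (25 * c) * 300 * (D : ℝ) ^ ((13 : ℝ) / 25) := by
      have : √(D : ℝ) * X * X = (D : ℝ) ^ ((13 : ℝ) / 25) := by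
        rw [Real.sqrt_eq_rpow, hX, ← Real.rpow_add (by positivity), ← Real.rpow_add (by positivity)]
        norm_num
      rw [← this]
      ring

end PellUnit
section HyperbolicElements

variable {ι : Type*}

/-- The element with `i`-th coordinate `exp (σ i * L)`. -/
noncomputable def hyperbolic (σ : ι → ℝ) (L : ℝ) : ι → ℝ := fun i => exp (σ i * L)

theorem hyperbolic_add (σ : ι → ℝ) (L L' : ℝ) :
    hyperbolic σ (L + L') = hyperbolic σ L * hyperbolic σ L' := by
  ext i
  simp [hyperbolic, mul_add, exp_add]

theorem hyperbolic_neg (σ : ι → ℝ) (L : ℝ) : hyperbolic σ (-L) = (hyperbolic σ L)⁻¹ := by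
  ext i
  simp [hyperbolic, exp_neg]

/-- The logarithms of the hyperbolic units of a subring. -/
def unitLogs (O : Subring (ι → ℝ)) (σ : ι → ℝ) : AddSubgroup ℝ where
  carrier := {L | hyperbolic σ L ∈ O ∧ hyperbolic σ (-L) ∈ O}
  add_mem' := by
    rintro a b ⟨ha, ha'⟩ ⟨hb, hb'⟩
    refine ⟨?_, ?_⟩
    · rw [hyperbolic_add]; exact O.mul_mem ha hb
    · rw [neg_add, hyperbolic_add]; exact O.mul_mem ha' hb'
  zero_mem' := by
    have : hyperbolic σ 0 = 1 := by ext; simp [hyperbolic]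
    simp [this, O.one_mem]
  neg_mem' := by
    rintro a ⟨ha, ha'⟩
    exact ⟨ha', by rwa [neg_neg]⟩

variable {O : Subring (ι → ℝ)} {σ : ι → ℝ}

theorem heightLE_hyperbolic (hσ : ∀ i, |σ i| ≤ 1) {q : ℕ} (hq : 1 ≤ q) {g L : ℝ}
    (hqg : (q : ℝ) ≤ exp g) (hL : |L| ≤ g) (hO : (q : ι → ℝ) * hyperbolic σ L ∈ O) :
    HeightLE O g (hyperbolic σ L) := by
  refine ⟨q, hq, hqg, hO, fun i => ?_⟩
  rw [hyperbolic, abs_of_pos (exp_pos _), exp_le_exp]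
  calc σ i * L ≤ |σ i * L| := le_abs_self _
    _ = |σ i| * |L| := abs_mul _ _
    _ ≤ 1 * g := mul_le_mul (hσ i) hL (abs_nonneg _) zero_le_one
    _ = g := one_mul g

theorem heightLE_div (O : Subring (ι → ℝ)) {a b : ℕ} (ha : 1 ≤ a) (hb : 1 ≤ b) {g : ℝ}
    (hag : (a : ℝ) ≤ exp g) (hbg : (b : ℝ) ≤ exp g) :
    HeightLE O g (fun _ => (a : ℝ) / b) := by
  have hb0 : (1 : ℝ) ≤ b := by exact_mod_cast hb
  have hb' : (b : ℝ) ≠ 0 := by positivity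
  refine ⟨b, hb, hbg, ?_, fun i => ?_⟩
  · have : (b : ι → ℝ) * (fun _ => (a : ℝ) / b) = (a : ι → ℝ) := by
      ext i
      simp only [Pi.mul_apply, Pi.natCast_apply]
      field_simp
    rw [this]
    exact natCast_mem O a
  · rw [abs_of_nonneg (by positivity)]
    exact (div_le_self (by positivity) hb0).trans hag

theorem exists_unit_reduction {L₀ h₀ T₀ : ℝ} (hL₀ : 0 < L₀) (hLh : L₀ ≤ h₀)
    (hmem : L₀ ∈ unitLogs O σ) (hT₀ : 0 ≤ T₀) {q : ℕ}
    (hq : (q : ι → ℝ) * hyperbolic σ T₀ ∈ O) (hq' : (q : ι → ℝ) * hyperbolic σ (-T₀) ∈ O) :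
    ∃ (L T : ℝ) (m : ℕ), h₀ ≤ L ∧ L ≤ 2 * h₀ ∧ 0 ≤ T ∧ T ≤ L ∧ T₀ = T + m * L ∧
      L ∈ unitLogs O σ ∧ (q : ι → ℝ) * hyperbolic σ T ∈ O ∧
      (q : ι → ℝ) * hyperbolic σ (-T) ∈ O := by
  have hh₀ : 0 < h₀ := hL₀.trans_le hLh
  set t := ⌈h₀ / L₀⌉₊
  have ht1 : h₀ ≤ t * L₀ := by
    rw [← div_le_iff₀ hL₀]
    exact Nat.le_ceil _
  have ht2 : t * L₀ ≤ 2 * h₀ := by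
    have h1 := Nat.ceil_lt_add_one (div_nonneg hh₀.le hL₀.le)
    have h2 : (t : ℝ) * L₀ ≤ (h₀ / L₀ + 1) * L₀ := by gcongr
    rw [add_mul, div_mul_cancel₀ _ hL₀.ne'] at h2
    linarith
  set L := t * L₀
  have hL : 0 < L := hh₀.trans_le ht1
  have hLmem : L ∈ unitLogs O σ := by
    have := (unitLogs O σ).nsmul_mem hmem t
    rwa [nsmul_eq_mul] at this
  set m := ⌊T₀ / L⌋₊
  have hm1 : m * L ≤ T₀ := by
    rw [← le_div_iff₀ hL]
    exact Nat.floor_le (by positivity)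
  have hm2 : T₀ ≤ (m + 1) * L := by
    rw [← div_le_iff₀ hL]
    exact (Nat.lt_floor_add_one _).le
  have hmmem : m * L ∈ unitLogs O σ := by
    have := (unitLogs O σ).nsmul_mem hLmem m
    rwa [nsmul_eq_mul] at this
  refine ⟨L, T₀ - m * L, m, ht1, ht2, by linarith, by linarith, by ring, hLmem, ?_, ?_⟩
  · rw [sub_eq_add_neg, hyperbolic_add, ← mul_assoc]
    exact O.mul_mem hq hmmem.2
  · rw [neg_sub, sub_eq_add_neg, add_comm, hyperbolic_add, ← mul_assoc]
    exact O.mul_mem hq' hmmem.1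

theorem mul_exp_boolSign {D q X Y : ℝ} {L : ℝ} (hD : 0 ≤ D) (hq : 0 < q)
    (h : X ^ 2 - D * Y ^ 2 = q ^ 2) (hL : q * exp L = X + Y * √D) (b : Bool) :
    q * exp (boolSign b * L) = X + Y * (boolSign b * √D) := by
  cases b
  · simp only [boolSign, Bool.false_eq_true, if_false, neg_one_mul, mul_neg, exp_neg]
    rw [← div_eq_mul_inv, div_eq_iff (exp_pos L).ne']
    refine mul_left_cancel₀ hq.ne' ?_
    rw [mul_left_comm, hL]
    linear_combination -h + Y ^ 2 * Real.sq_sqrt hD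
  · simpa [boolSign] using hL

variable {D₁ D₂ q : ℕ} {X Y : ℤ} {L : ℝ}

theorem mul_hyperbolic_fst_mem (hq : 1 ≤ q) (h : X ^ 2 - D₁ * Y ^ 2 = (q : ℤ) ^ 2)
    (hL : q * exp L = X + Y * √D₁) :
    (q : Bool × Bool → ℝ) * hyperbolic (fun i => boolSign i.1) L ∈ biquadraticOrder D₁ D₂ ∧
    (q : Bool × Bool → ℝ) * hyperbolic (fun i => boolSign i.1) (-L) ∈ biquadraticOrder D₁ D₂ := by
  have h' : (X : ℝ) ^ 2 - D₁ * Y ^ 2 = (q : ℝ) ^ 2 := by exact_mod_cast h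
  have key := mul_exp_boolSign (by positivity) (by positivity) h' hL
  refine ⟨⟨X, Y, 0, 0, ?_⟩, ⟨X, -Y, 0, 0, ?_⟩⟩
  · ext i
    simp only [Pi.mul_apply, Pi.natCast_apply, hyperbolic, key, biquadratic]
    simp
  · ext i
    have e : boolSign i.1 * -L = boolSign (!i.1) * L := by cases i.1 <;> simp [boolSign]
    have e' : boolSign (!i.1) = -boolSign i.1 := by cases i.1 <;> simp [boolSign]
    simp only [Pi.mul_apply, Pi.natCast_apply, hyperbolic, e, key]
    simp [biquadratic, e']

theorem mul_hyperbolic_snd_mem (hq : 1 ≤ q) (h : X ^ 2 - D₂ * Y ^ 2 = (q : ℤ) ^ 2)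
    (hL : q * exp L = X + Y * √D₂) :
    (q : Bool × Bool → ℝ) * hyperbolic (fun i => boolSign i.2) L ∈ biquadraticOrder D₁ D₂ ∧
    (q : Bool × Bool → ℝ) * hyperbolic (fun i => boolSign i.2) (-L) ∈ biquadraticOrder D₁ D₂ := by
  have h' : (X : ℝ) ^ 2 - D₂ * Y ^ 2 = (q : ℝ) ^ 2 := by exact_mod_cast h
  have key := mul_exp_boolSign (by positivity) (by positivity) h' hL
  refine ⟨⟨X, 0, Y, 0, ?_⟩, ⟨X, 0, -Y, 0, ?_⟩⟩
  · ext i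
    simp only [Pi.mul_apply, Pi.natCast_apply, hyperbolic, key, biquadratic]
    simp
  · ext i
    have e : boolSign i.2 * -L = boolSign (!i.2) * L := by cases i.2 <;> simp [boolSign]
    have e' : boolSign (!i.2) = -boolSign i.2 := by cases i.2 <;> simp [boolSign]
    simp only [Pi.mul_apply, Pi.natCast_apply, hyperbolic, e, key]
    simp [biquadratic, e']

theorem exists_pell_unit_log {D a e : ℕ} (hD : 0 < D) (he : 0 < e) (h : a ^ 2 = D * e ^ 2 + 1) :
    ∃ L : ℝ, 0 < L ∧ L ≤ log (2 * a) ∧ ((1 : ℕ) : ℝ) * exp L = (a : ℤ) + (e : ℤ) * √D ∧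
      (a : ℤ) ^ 2 - D * (e : ℤ) ^ 2 = ((1 : ℕ) : ℤ) ^ 2 := by
  have hD1 : (1 : ℝ) ≤ D := by exact_mod_cast hD
  have he1 : (1 : ℝ) ≤ e := by exact_mod_cast he
  have ha1 : (1 : ℝ) ≤ a := by
    have : a ≠ 0 := by rintro rfl; simp at h
    exact_mod_cast Nat.one_le_iff_ne_zero.mpr this
  have h' : (a : ℝ) ^ 2 = D * e ^ 2 + 1 := by exact_mod_cast h
  have hs : √(D : ℝ) ^ 2 = D := Real.sq_sqrt (by positivity)
  have hs1 : 1 ≤ √(D : ℝ) := Real.one_le_sqrt.mpr hD1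
  have hle : e * √(D : ℝ) ≤ a := by
    refine le_of_sq_le_sq ?_ (by positivity)
    rw [mul_pow, hs]
    linarith
  have hes : 1 ≤ e * √(D : ℝ) := one_le_mul_of_one_le_of_one_le he1 hs1
  refine ⟨log (a + e * √D), Real.log_pos (by linarith), ?_, ?_, ?_⟩
  · exact Real.log_le_log (by positivity) (by linarith)
  · rw [exp_log (by positivity)]
    push_cast
    ring
  · push_cast
    have : (a : ℤ) ^ 2 = D * e ^ 2 + 1 := by exact_mod_cast h
    linear_combination this

end HyperbolicElements
section Shifts

/-- The logarithm of `(√(x + l) + √(x + k)) / (√(x + l) - √(x + k))`. -/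
noncomputable def pairLog (x k l : ℕ) : ℝ :=
  2 * log (√((x : ℝ) + k) + √((x : ℝ) + l)) - log ((l : ℝ) - k)

variable {x k l s t : ℕ}

theorem exp_pairLog (hx : 0 < x) (hkl : k < l) :
    exp (pairLog x k l) = (√((x : ℝ) + k) + √((x : ℝ) + l)) ^ 2 / ((l : ℝ) - k) := by
  have h1 : (0 : ℝ) < (l : ℝ) - k := sub_pos.mpr (by exact_mod_cast hkl)
  rw [pairLog, exp_sub, exp_log h1, mul_comm, exp_mul, exp_log (by positivity)]
  norm_num

theorem exists_pairLog_eq (hx : 0 < x) (hk : 0 < k) (hkl : k < l) (hs : s ^ 2 = k * (x + k))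
    (ht : t ^ 2 = l * (x + l)) : ∃ (X Y : ℤ) (q : ℕ), 1 ≤ q ∧ q ≤ l ^ 3 ∧
      X ^ 2 - (k * l : ℕ) * Y ^ 2 = (q : ℤ) ^ 2 ∧
      q * exp (pairLog x k l) = X + Y * √((k * l : ℕ) : ℝ) := by
  obtain ⟨d, rfl⟩ := Nat.exists_eq_add_of_lt hkl
  set l := k + d + 1 with hl
  have hl0 : 0 < l := by omega
  refine ⟨k * l * (2 * x + k + l), 2 * s * t, k * l * (d + 1), Nat.succ_le_of_lt (by positivity), ?_, ?_, ?_⟩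
  · calc k * l * (d + 1) ≤ l * l * l := by gcongr; omega
      _ = l ^ 3 := by ring
  · have hs' : (s : ℤ) ^ 2 = k * (x + k) := by exact_mod_cast hs
    have ht' : (t : ℤ) ^ 2 = l * (x + l) := by exact_mod_cast ht
    have hl' : (l : ℤ) = k + d + 1 := by rw [hl]; push_cast; ring
    push_cast
    have hd : (d : ℤ) + 1 = l - k := by rw [hl']; ring
    rw [hd]
    linear_combination -4 * (k : ℤ) * l * t ^ 2 * hs' - 4 * (k : ℤ) * l * k * (x + k) * ht'
  · have hl' : (l : ℝ) = k + d + 1 := by rw [hl]; push_cast; ring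
    have hd : (l : ℝ) - k = d + 1 := by rw [hl']; ring
    have hs' : (s : ℝ) = √k * √((x : ℝ) + k) := by
      rw [← Real.sqrt_mul (by positivity)]
      symm
      rw [Real.sqrt_eq_iff_mul_self_eq (by positivity) (by positivity)]
      exact_mod_cast (by rw [← hs]; ring : k * (x + k) = s * s)
    have ht' : (t : ℝ) = √l * √((x : ℝ) + l) := by
      rw [← Real.sqrt_mul (by positivity)]
      symm
      rw [Real.sqrt_eq_iff_mul_self_eq (by positivity) (by positivity)]
      exact_mod_cast (by rw [← ht]; ring : l * (x + l) = t * t)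
    rw [exp_pairLog hx hkl, hd]
    push_cast
    rw [Real.sqrt_mul (by positivity), hs', ht']
    have h1 : √(k : ℝ) ^ 2 = k := Real.sq_sqrt (by positivity)
    have h2 : √(l : ℝ) ^ 2 = l := Real.sq_sqrt (by positivity)
    have h3 : √((x : ℝ) + k) ^ 2 = x + k := Real.sq_sqrt (by positivity)
    have h4 : √((x : ℝ) + l) ^ 2 = x + l := Real.sq_sqrt (by positivity)
    generalize √((x : ℝ) + k) = u at *
    generalize √((x : ℝ) + l) = v at *
    generalize √(k : ℝ) = a at *
    generalize √(l : ℝ) = b at *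
    field_simp
    linear_combination (k : ℝ) * l * h3 + (k : ℝ) * l * h4 - 2 * u * v * b ^ 2 * h1 -
      2 * u * v * k * h2

theorem pairLog_bounds (hx : 8 ≤ x) (hkl : k < l) (hlx : l ≤ x) :
    log x - log l ≤ pairLog x k l ∧ pairLog x k l ≤ 2 * log x := by
  have hx8 : (8 : ℝ) ≤ x := by exact_mod_cast hx
  have h1 : (1 : ℝ) ≤ (l : ℝ) - k := by
    have : ((k + 1 : ℕ) : ℝ) ≤ l := by exact_mod_cast hkl
    push_cast at this
    linarith
  have hlx' : (l : ℝ) ≤ x := by exact_mod_cast hlx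
  have hk0 : (0 : ℝ) ≤ k := by positivity
  have h2 : log ((l : ℝ) - k) ≤ log l := Real.log_le_log (by linarith) (by linarith)
  have h3 : 0 ≤ log ((l : ℝ) - k) := Real.log_nonneg h1
  have hs0 : 0 < √(x : ℝ) := Real.sqrt_pos.mpr (by linarith)
  have hs1 : √(x : ℝ) ≤ √((x : ℝ) + k) := Real.sqrt_le_sqrt (by linarith)
  have hs2 : 0 ≤ √((x : ℝ) + l) := Real.sqrt_nonneg _
  rw [pairLog]
  constructor
  · have h4 : log √(x : ℝ) ≤ log (√((x : ℝ) + k) + √((x : ℝ) + l)) :=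
      Real.log_le_log hs0 (by linarith)
    rw [Real.log_sqrt (by linarith)] at h4
    linarith
  · have hle : ∀ y : ℝ, y ≤ 2 * x → √y ≤ x / 2 := by
      intro y hy
      rw [Real.sqrt_le_left (by linarith)]
      nlinarith
    have h4 : log (√((x : ℝ) + k) + √((x : ℝ) + l)) ≤ log x := by
      apply Real.log_le_log (by linarith)
      have := hle (x + k) (by linarith)
      have := hle (x + l) (by linarith)
      linarith
    linarith

theorem log_sqrt_add_sqrt_bounds {x k₁ k₂ k₃ : ℝ} (hx : 0 < x) (hk₁ : 0 ≤ k₁) (hk₂ : 0 ≤ k₂)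
    (h : k₂ < k₃) :
    0 < 2 * log (√(x + k₁) + √(x + k₃)) - 2 * log (√(x + k₁) + √(x + k₂)) ∧
    2 * log (√(x + k₁) + √(x + k₃)) - 2 * log (√(x + k₁) + √(x + k₂)) ≤ k₃ / x := by
  have hs0 : 0 < √x := Real.sqrt_pos.mpr hx
  have hu1 : √x ≤ √(x + k₁) := Real.sqrt_le_sqrt (by linarith)
  have hu2 : √x ≤ √(x + k₂) := Real.sqrt_le_sqrt (by linarith)
  have hu23 : √(x + k₂) < √(x + k₃) := Real.sqrt_lt_sqrt (by linarith) (by linarith)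
  have e0 : √x ^ 2 = x := Real.sq_sqrt hx.le
  have e2 : √(x + k₂) ^ 2 = x + k₂ := Real.sq_sqrt (by linarith)
  have e3 : √(x + k₃) ^ 2 = x + k₃ := Real.sq_sqrt (by linarith)
  generalize √(x + k₁) = u₁ at *
  generalize √(x + k₂) = u₂ at *
  generalize √(x + k₃) = u₃ at *
  generalize √x = u at *
  constructor
  · have := Real.log_lt_log (show 0 < u₁ + u₂ by linarith) (show u₁ + u₂ < u₁ + u₃ by linarith)
    linarith
  · rw [← mul_sub, ← Real.log_div (by linarith) (by linarith)]
    have h1 := Real.log_le_sub_one_of_pos (x := (u₁ + u₃) / (u₁ + u₂))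
      (div_pos (by linarith) (by linarith))
    have h2 : (u₁ + u₃) / (u₁ + u₂) - 1 ≤ k₃ / (2 * x) := by
      rw [div_sub_one (by linarith), div_le_div_iff₀ (by linarith) (by linarith)]
      have h3 : (u₃ - u₂) * (2 * u) ≤ k₃ := by nlinarith
      have h4 : 0 < u₃ - u₂ := by linarith
      calc (u₁ + u₃ - (u₁ + u₂)) * (2 * x) = (u₃ - u₂) * (2 * u) * u := by rw [← e0]; ring
        _ ≤ k₃ * u := by gcongr
        _ ≤ k₃ * (u₁ + u₂) := by
          have : 0 ≤ k₃ := by linarith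
          gcongr
          linarith
    have h5 : k₃ / (2 * x) = k₃ / x / 2 := by field_simp
    linarith

theorem not_isSquare_mul (hk : 0 < k) (hkl : k < l) (hx : l ^ 2 ≤ x) (hs : s ^ 2 = k * (x + k))
    (ht : t ^ 2 = l * (x + l)) : ¬ IsSquare (k * l) := by
  rintro ⟨r, hr⟩
  have hr0 : r ≠ 0 := by
    rintro rfl
    have : 0 < k * l := Nat.mul_pos hk (hk.trans hkl)
    omega
  have h1 : (s * t) ^ 2 = r ^ 2 * ((x + k) * (x + l)) := by
    rw [mul_pow, hs, ht, sq r, ← hr]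
    ring
  obtain ⟨y, hy⟩ := (Nat.pow_dvd_pow_iff two_ne_zero).mp ⟨_, h1⟩
  have h2 : y ^ 2 = (x + k) * (x + l) := by
    rw [hy, mul_pow] at h1
    exact Nat.eq_of_mul_eq_mul_left (by positivity) h1
  obtain ⟨d, rfl⟩ := Nat.exists_eq_add_of_lt hkl
  have h3 : 2 * y < 2 * x + k + (k + d + 1) := by
    by_contra! h
    nlinarith
  have h4 : (2 * y + 1) ^ 2 ≤ (2 * x + k + (k + d + 1)) ^ 2 := Nat.pow_le_pow_left h3 2
  have h5 : x < y := by
    by_contra! h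
    nlinarith
  nlinarith

theorem not_isSquare_mul_mul {a b c : ℕ} (ha : 0 < a) (h : ¬ IsSquare (b * c)) :
    ¬ IsSquare (a * b * (a * c)) := by
  rintro ⟨r, hr⟩
  apply h
  have h1 : r ^ 2 = a ^ 2 * (b * c) := by rw [sq, ← hr]; ring
  obtain ⟨y, rfl⟩ := (Nat.pow_dvd_pow_iff two_ne_zero).mp ⟨_, h1⟩
  refine ⟨y, Nat.eq_of_mul_eq_mul_left (pow_pos ha 2) ?_⟩
  rw [← h1]
  ring

end Shifts
section ThreeShifts

theorem unit_reduction_of_pairLog {ι : Type*} {O : Subring (ι → ℝ)} {σ : ι → ℝ}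
    {D x k l s t : ℕ} {h₀ : ℝ} (hD : D = k * l)
    (hmem : ∀ (X Y : ℤ) (q : ℕ) (L : ℝ), 1 ≤ q → X ^ 2 - D * Y ^ 2 = (q : ℤ) ^ 2 →
      q * exp L = X + Y * √(D : ℝ) →
      (q : ι → ℝ) * hyperbolic σ L ∈ O ∧ (q : ι → ℝ) * hyperbolic σ (-L) ∈ O)
    (hx : 8 ≤ x) (hk : 0 < k) (hkl : k < l) (hlx : l ≤ x) (hs : s ^ 2 = k * (x + k))
    (ht : t ^ 2 = l * (x + l))
    (hunit : ∃ a e : ℕ, 0 < e ∧ a ^ 2 = D * e ^ 2 + 1 ∧ log (2 * a) ≤ h₀) :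
    ∃ (L T : ℝ) (m q : ℕ), h₀ ≤ L ∧ L ≤ 2 * h₀ ∧ 0 ≤ T ∧ T ≤ L ∧ pairLog x k l = T + m * L ∧
      1 ≤ q ∧ q ≤ l ^ 3 ∧ hyperbolic σ L ∈ O ∧ hyperbolic σ (-L) ∈ O ∧
      (q : ι → ℝ) * hyperbolic σ T ∈ O ∧ (q : ι → ℝ) * hyperbolic σ (-T) ∈ O := by
  obtain ⟨a, e, he, hae, ha⟩ := hunit
  obtain ⟨L₀, hL1, hL2, hL3, hL4⟩ := exists_pell_unit_log
    (by rw [hD]; exact Nat.mul_pos hk (hk.trans hkl)) he hae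
  have hunit := hmem _ _ _ _ le_rfl hL4 hL3
  rw [Nat.cast_one, one_mul, one_mul] at hunit
  obtain ⟨X, Y, q, hq1, hq2, hq3, hq4⟩ := exists_pairLog_eq (by omega) hk hkl hs ht
  rw [← hD] at hq3 hq4
  have hpair := hmem _ _ _ _ hq1 hq3 hq4
  have hT0 : 0 ≤ pairLog x k l := by
    refine le_trans ?_ (pairLog_bounds hx hkl hlx).1
    have hl0 : (0 : ℝ) < l := by exact_mod_cast hk.trans hkl
    exact sub_nonneg.mpr (Real.log_le_log hl0 (by exact_mod_cast hlx))
  obtain ⟨L, T, m, h1, h2, h3, h4, h5, h6, h7, h8⟩ :=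
    exists_unit_reduction hL1 (hL2.trans ha) hunit hT0 hpair.1 hpair.2
  exact ⟨L, T, m, q, h1, h2, h3, h4, h5, hq1, hq2, h6.1, h6.2, h7, h8⟩

theorem false_of_three_shifts {B x k₁ k₂ k₃ s₁ s₂ s₃ : ℕ} (hB : 10000 ≤ B)
    (hBexp : (B : ℝ) ^ 6000 ≤ exp (B / 100)) (hk₁ : 0 < k₁) (h12 : k₁ < k₂) (h23 : k₂ < k₃)
    (hk₃ : k₃ ≤ B ^ 287) (hs₁ : s₁ ^ 2 = k₁ * (x + k₁)) (hs₂ : s₂ ^ 2 = k₂ * (x + k₂))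
    (hs₃ : s₃ ^ 2 = k₃ * (x + k₃)) (hx1 : (B : ℝ) ^ 1000 ≤ log x) (hx2 : log x ≤ (B : ℝ) ^ 1002)
    (hunit : ∀ D : ℕ, ¬ IsSquare D → D ≤ B ^ 574 → ∃ a e : ℕ, 0 < e ∧ a ^ 2 = D * e ^ 2 + 1 ∧
      log (2 * a) ≤ (B : ℝ) ^ 300) : False := by
  have hB' : (10000 : ℝ) ≤ B := by exact_mod_cast hB
  have hB1 : (1 : ℝ) ≤ B := by linarith
  have hx0 : (0 : ℝ) < x := by
    rcases Nat.eq_zero_or_pos x with h | h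
    · exfalso
      rw [h, Nat.cast_zero, Real.log_zero] at hx1
      have : (0 : ℝ) < (B : ℝ) ^ 1000 := by positivity
      linarith
    · exact_mod_cast h
  have hBB : (B : ℝ) / 100 ≤ (B : ℝ) ^ 300 := by
    have := le_self_pow₀ hB1 (show 300 ≠ 0 by norm_num)
    linarith
  have hBB' : (B : ℝ) / 100 ≤ (B : ℝ) ^ 1000 := by
    have := le_self_pow₀ hB1 (show 1000 ≠ 0 by norm_num)
    linarith
  have hxB : (B : ℝ) ^ 6000 ≤ x := by
    rw [← Real.exp_log hx0]
    exact hBexp.trans (exp_le_exp.mpr (hBB'.trans hx1))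
  have hB0 : 0 < B := by omega
  have hxBN : B ^ 6000 ≤ x := by
    rw [← Nat.cast_le (α := ℝ), Nat.cast_pow]
    exact hxB
  have hle : ∀ {a : ℕ}, a ≤ 6000 → B ^ a ≤ x := fun ha =>
    le_trans (pow_le_pow_right₀ hB0 ha) hxBN
  have hk3sq : k₃ ^ 2 ≤ x := by
    calc k₃ ^ 2 ≤ (B ^ 287) ^ 2 := by gcongr
      _ = B ^ 574 := by rw [← pow_mul]
      _ ≤ x := hle (by norm_num)
  have hk3x : k₃ ≤ x := hk₃.trans (hle (by norm_num))
  have hx8 : 8 ≤ x := by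
    have h1 := hle (a := 1) (by norm_num)
    rw [pow_one] at h1
    omega
  have hk2sq : k₂ ^ 2 ≤ x := (Nat.pow_le_pow_left h23.le 2).trans hk3sq
  have hD1 := not_isSquare_mul hk₁ h12 hk2sq hs₁ hs₂
  have hD2 := not_isSquare_mul hk₁ (h12.trans h23) hk3sq hs₁ hs₃
  have hD12 := not_isSquare_mul_mul hk₁ (not_isSquare_mul (hk₁.trans h12) h23 hk3sq hs₂ hs₃)
  have hDle : ∀ {a b : ℕ}, a ≤ k₃ → b ≤ k₃ → a * b ≤ B ^ 574 := fun ha hb => by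
    calc _ ≤ B ^ 287 * B ^ 287 := Nat.mul_le_mul (ha.trans hk₃) (hb.trans hk₃)
      _ = B ^ 574 := by rw [← pow_add]
  obtain ⟨L₁, T₁, m, q₁, hL₁, hL₁', hT₁, hT₁', hm, hq₁, hq₁', hU₁, hU₁', hV₁, hV₁'⟩ :=
    unit_reduction_of_pairLog (D := k₁ * k₂) rfl
      (fun X Y q L => mul_hyperbolic_fst_mem (D₂ := k₁ * k₃)) hx8 hk₁ h12 (by omega) hs₁ hs₂
      (hunit _ hD1 (hDle (by omega) (by omega)))
  obtain ⟨L₂, T₂, n, q₂, hL₂, hL₂', hT₂, hT₂', hn, hq₂, hq₂', hU₂, hU₂', hV₂, hV₂'⟩ :=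
    unit_reduction_of_pairLog (D := k₁ * k₃) rfl
      (fun X Y q L => mul_hyperbolic_snd_mem (D₁ := k₁ * k₂)) hx8 hk₁ (h12.trans h23) hk3x hs₁ hs₃
      (hunit _ hD2 (hDle (by omega) (by omega)))
  set O := biquadraticOrder (k₁ * k₂) (k₁ * k₃)
  set σ₁ : Bool × Bool → ℝ := fun i => boolSign i.1 with hσ₁
  set σ₂ : Bool × Bool → ℝ := fun i => boolSign i.2 with hσ₂
  have hb : ∀ b, |boolSign b| ≤ 1 := by intro b; cases b <;> simp [boolSign]
  have hσ₁' : ∀ i, |σ₁ i| ≤ 1 := fun i => hb _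
  have hσ₂' : ∀ i, |σ₂ i| ≤ 1 := fun i => hb _
  set h₀ : ℝ := (B : ℝ) ^ 300 with hh₀
  have hh₀1 : 1 ≤ h₀ := one_le_pow₀ hB1
  have hqexp : ∀ {q : ℕ}, q ≤ B ^ 6000 → (q : ℝ) ≤ exp (2 * h₀) := by
    intro q hq
    have h1 : (q : ℝ) ≤ (B : ℝ) ^ 6000 := by exact_mod_cast hq
    refine h1.trans (hBexp.trans (exp_le_exp.mpr ?_))
    linarith
  have hcube : ∀ {q k : ℕ}, k ≤ k₃ → q ≤ k ^ 3 → (q : ℝ) ≤ exp (2 * h₀) := by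
    intro q k hk hq
    refine hqexp (hq.trans ?_)
    calc k ^ 3 ≤ (B ^ 287) ^ 3 := by gcongr; exact hk.trans hk₃
      _ = B ^ 861 := by rw [← pow_mul]
      _ ≤ B ^ 6000 := Nat.pow_le_pow_right hB0 (by norm_num)
  have hshift : ∀ {q : ℕ}, q ≤ k₃ → (q : ℝ) ≤ exp (2 * h₀) := fun hq =>
    hqexp ((hq.trans hk₃).trans (Nat.pow_le_pow_right hB0 (by norm_num)))
  have hq₁e := hcube h23.le hq₁'
  have hq₂e := hcube le_rfl hq₂'
  have abs_bd : ∀ {T L : ℝ}, 0 ≤ T → T ≤ L → L ≤ 2 * h₀ → |T| ≤ 2 * h₀ ∧ |-T| ≤ 2 * h₀ := by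
    intro T L h1 h2 h3
    rw [abs_neg, abs_of_nonneg h1]
    exact ⟨h2.trans h3, h2.trans h3⟩
  have hbT₁ := abs_bd hT₁ hT₁' hL₁'
  have hbT₂ := abs_bd hT₂ hT₂' hL₂'
  have hbL₁ := abs_bd (by linarith) le_rfl hL₁'
  have hbL₂ := abs_bd (by linarith) le_rfl hL₂'
  have hone : ((1 : ℕ) : ℝ) ≤ exp (2 * h₀) := by
    rw [Nat.cast_one]
    exact one_le_exp (by linarith)
  set γ : Bool × Bool → ℝ := (fun _ => ((k₂ - k₁ : ℕ) : ℝ) / (k₃ - k₁ : ℕ)) *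
    (hyperbolic σ₁ T₁ * hyperbolic σ₂ (-T₂)) with hγ
  have hγinv : γ⁻¹ = (fun _ => ((k₃ - k₁ : ℕ) : ℝ) / (k₂ - k₁ : ℕ)) *
      (hyperbolic σ₁ (-T₁) * hyperbolic σ₂ T₂) := by
    rw [hγ, hyperbolic_neg, hyperbolic_neg]
    ext i
    simp [mul_comm]
  have hγh : HeightLE O (6 * h₀) γ :=
    ((heightLE_div O (by omega) (by omega) (hshift (by omega)) (hshift (by omega))).mul
      ((heightLE_hyperbolic hσ₁' hq₁ hq₁e hbT₁.1 hV₁).mul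
        (heightLE_hyperbolic hσ₂' hq₂ hq₂e hbT₂.2 hV₂'))).mono (by linarith)
  have hγh' : HeightLE O (6 * h₀) γ⁻¹ := by
    rw [hγinv]
    exact ((heightLE_div O (by omega) (by omega) (hshift (by omega)) (hshift (by omega))).mul
      ((heightLE_hyperbolic hσ₁' hq₁ hq₁e hbT₁.2 hV₁').mul
        (heightLE_hyperbolic hσ₂' hq₂ hq₂e hbT₂.1 hV₂))).mono (by linarith)
  have hunitH : ∀ {σ : Bool × Bool → ℝ} {L : ℝ}, (∀ i, |σ i| ≤ 1) → |L| ≤ 2 * h₀ →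
      hyperbolic σ L ∈ O → HeightLE O (6 * h₀) (hyperbolic σ L) := by
    intro σ L hσ hL hO
    exact (heightLE_hyperbolic hσ le_rfl hone hL (by simpa using hO)).mono (by linarith)
  set α : Fin 3 → Bool × Bool → ℝ := ![γ, hyperbolic σ₁ L₁, hyperbolic σ₂ L₂] with hα
  set v : Fin 3 → ℤ := ![1, (m : ℤ), -(n : ℤ)] with hv
  set M := max m n with hM
  have hsum : ∑ j, (v j : ℝ) * log (α j (true, true)) =
      -(2 * log (√((x : ℝ) + k₁) + √((x : ℝ) + k₃)) -
        2 * log (√((x : ℝ) + k₁) + √((x : ℝ) + k₂))) := by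
    have e1 : ((k₂ - k₁ : ℕ) : ℝ) = (k₂ : ℝ) - k₁ := by push_cast [h12.le]; ring
    have e2 : ((k₃ - k₁ : ℕ) : ℝ) = (k₃ : ℝ) - k₁ := by push_cast [(h12.trans h23).le]; ring
    have p1 : 0 < (k₂ : ℝ) - k₁ := sub_pos.mpr (by exact_mod_cast h12)
    have p2 : 0 < (k₃ : ℝ) - k₁ := sub_pos.mpr (by exact_mod_cast h12.trans h23)
    have hlogγ : log (γ (true, true)) = log ((k₂ : ℝ) - k₁) - log ((k₃ : ℝ) - k₁) + (T₁ - T₂) := by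
      simp only [hγ, Pi.mul_apply, hyperbolic, e1, e2]
      rw [Real.log_mul (by positivity) (by positivity), Real.log_div p1.ne' p2.ne', ← exp_add,
        Real.log_exp]
      simp [hσ₁, hσ₂, boolSign, sub_eq_add_neg]
    rw [Fin.sum_univ_three]
    have a0 : α 0 = γ := rfl
    have a1 : α 1 = hyperbolic σ₁ L₁ := rfl
    have a2 : α 2 = hyperbolic σ₂ L₂ := rfl
    have v0 : v 0 = 1 := rfl
    have v1 : v 1 = m := rfl
    have v2 : v 2 = -n := rfl
    rw [a0, a1, a2, v0, v1, v2, hlogγ]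
    simp only [hyperbolic, Real.log_exp, hσ₁, hσ₂, boolSign, if_true, one_mul]
    rw [pairLog] at hm hn
    push_cast
    linear_combination hn - hm
  have hΛ := log_sqrt_add_sqrt_bounds (k₁ := k₁) (k₂ := k₂) (k₃ := k₃) hx0 (by positivity)
    (by positivity) (by exact_mod_cast h23)
  have hh6 : ((6 * B ^ 300 : ℕ) : ℝ) = 6 * h₀ := by push_cast; rfl
  obtain ⟨hp1, hp1'⟩ := pairLog_bounds hx8 h12 (by omega : k₂ ≤ x)
  obtain ⟨hp2, hp2'⟩ := pairLog_bounds hx8 (h12.trans h23) hk3x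
  have hk3pos : (0 : ℝ) < k₃ := by exact_mod_cast hk₁.trans (h12.trans h23)
  have hlogk : 20 * log k₃ ≤ log x := by
    have h1 : 20 * log (k₃ : ℝ) = log ((k₃ : ℝ) ^ 20) := by rw [Real.log_pow]; norm_num
    rw [h1]
    apply Real.log_le_log (by positivity)
    have h2 : k₃ ^ 20 ≤ x := by
      calc k₃ ^ 20 ≤ (B ^ 287) ^ 20 := by gcongr
        _ = B ^ 5740 := by rw [← pow_mul]
        _ ≤ x := hle (by norm_num)
    exact_mod_cast h2
  have hlogk2 : log (k₂ : ℝ) ≤ log k₃ := by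
    apply Real.log_le_log
    · exact_mod_cast hk₁.trans h12
    · exact_mod_cast h23.le
  have hMup : M * h₀ ≤ 2 * log x := by
    rcases max_choice m n with h | h <;> rw [hM, h]
    · have : m * h₀ ≤ m * L₁ := by gcongr
      linarith
    · have : n * h₀ ≤ n * L₂ := by gcongr
      linarith
  have hMlow : log x ≤ (4 * M + 4) * h₀ := by
    have h1 : (m : ℝ) ≤ M := by exact_mod_cast le_max_left m n
    have h2 : m * L₁ ≤ M * (2 * h₀) := by gcongr; linarith
    linarith
  have hbig : (6 * h₀) ^ 2 * (B : ℝ) ^ 20 ≤ M := by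
    have h1 : h₀ * (B : ℝ) ^ 700 ≤ (4 * M + 4) * h₀ := by
      rw [hh₀, ← pow_add]
      exact hx1.trans hMlow
    have h2 : (B : ℝ) ^ 700 ≤ 4 * M + 4 := by
      rw [mul_comm] at h1
      exact le_of_mul_le_mul_right h1 (by linarith)
    have h3 : (B : ℝ) ^ 700 = h₀ ^ 2 * (B : ℝ) ^ 20 * (B : ℝ) ^ 80 := by
      rw [hh₀, ← pow_mul, ← pow_add, ← pow_add]
    have h4 : (10000 : ℝ) ≤ (B : ℝ) ^ 80 := hB'.trans (le_self_pow₀ hB1 (by norm_num))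
    have h5 : 1 ≤ h₀ ^ 2 * (B : ℝ) ^ 20 :=
      one_le_mul_of_one_le_of_one_le (one_le_pow₀ hh₀1) (one_le_pow₀ hB1)
    have h6 : h₀ ^ 2 * (B : ℝ) ^ 20 * 10000 ≤ h₀ ^ 2 * (B : ℝ) ^ 20 * (B : ℝ) ^ 80 := by gcongr
    linarith
  have hMpos : (0 : ℝ) < M := lt_of_lt_of_le (by positivity) hbig
  have hMB : M ≤ B ^ 2000 := by
    have h1 : (M : ℝ) ≤ M * h₀ := le_mul_of_one_le_right hMpos.le hh₀1
    have h2 : 2 * (B : ℝ) ^ 1002 ≤ (B : ℝ) ^ 2000 := by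
      calc 2 * (B : ℝ) ^ 1002 ≤ B * (B : ℝ) ^ 1002 := by gcongr; linarith
        _ = (B : ℝ) ^ 1003 := by rw [← pow_succ']
        _ ≤ (B : ℝ) ^ 2000 := pow_le_pow_right₀ hB1 (by norm_num)
    have h3 : (M : ℝ) ≤ (B : ℝ) ^ 2000 := by linarith
    exact_mod_cast h3
  have hmain := linear_form_three_lower_bound (ι := Bool × Bool) (by simp)
    (i₀ := (true, true)) (O := O)
    (one_le_prod_abs_of_mem_biquadraticOrder (Nat.mul_pos hk₁ (hk₁.trans h12))
      (by rwa [Int.isSquare_natCast_iff]) (by rwa [Int.isSquare_natCast_iff])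
      (by rw [← Nat.cast_mul, Int.isSquare_natCast_iff]; exact hD12))
    hB hBexp (h := 6 * B ^ 300) (M := M)
    (by have : 0 < B ^ 300 := by positivity
        omega)
    (by have : (((6 * B ^ 300) ^ 2 * B ^ 20 : ℕ) : ℝ) ≤ (M : ℕ) := by
          rw [Nat.cast_mul, Nat.cast_pow, hh6, Nat.cast_pow]
          exact hbig
        exact_mod_cast this)
    hMB (α := α) (v := v)
    (by
      rw [hh6]
      intro j
      fin_cases j
      · exact hγh
      · exact hunitH hσ₁' hbL₁.1 hU₁
      · exact hunitH hσ₂' hbL₂.1 hU₂)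
    (by
      rw [hh6]
      intro j
      fin_cases j
      · exact hγh'
      · change HeightLE O _ (hyperbolic σ₁ L₁)⁻¹
        rw [← hyperbolic_neg]
        exact hunitH hσ₁' hbL₁.2 hU₁'
      · change HeightLE O _ (hyperbolic σ₂ L₂)⁻¹
        rw [← hyperbolic_neg]
        exact hunitH hσ₂' hbL₂.2 hU₂')
    (by
      intro j
      fin_cases j
      · change 0 < γ (true, true)
        have p1 : 0 < k₂ - k₁ := by omega
        have p2 : 0 < k₃ - k₁ := by omega
        simp only [hγ, Pi.mul_apply, hyperbolic]
        positivity
      · exact exp_pos _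
      · exact exp_pos _)
    rfl
    (by
      have hM1 : 0 < M := by exact_mod_cast hMpos
      intro j
      fin_cases j
      · change |(1 : ℤ)| ≤ M
        rw [abs_one]
        exact_mod_cast hM1
      · change |(m : ℤ)| ≤ M
        rw [Nat.abs_cast]
        exact_mod_cast le_max_left m n
      · change |(-n : ℤ)| ≤ M
        rw [abs_neg, Nat.abs_cast]
        exact_mod_cast le_max_right m n)
    (by
      rcases max_choice m n with h | h
      · refine ⟨1, ?_⟩
        change (M : ℤ) ≤ 10 * |(m : ℤ)|
        rw [Nat.abs_cast]
        omega
      · refine ⟨2, ?_⟩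
        change (M : ℤ) ≤ 10 * |(-n : ℤ)|
        rw [abs_neg, Nat.abs_cast]
        omega)
    (by rw [hsum]; exact neg_ne_zero.mpr hΛ.1.ne')
  rw [hsum, abs_neg, abs_of_pos hΛ.1, hh6] at hmain
  have hfin : exp (-(6 * h₀ * M / 100)) ≤ exp (log k₃ - log x) := by
    rw [exp_sub, exp_log hk3pos, exp_log hx0]
    exact hmain.trans hΛ.2
  rw [exp_le_exp] at hfin
  have hlx : 0 < log (x : ℝ) := lt_of_lt_of_le (by positivity) hx1
  linarith

end ThreeShifts
section Asymptotics

theorem exists_shift {N d : ℕ} (hN : 0 < N) (hd : d ∣ N ^ 2) (hdN : d ≠ N) :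
    ∃ k s : ℕ, d + N ^ 2 / d = 2 * N + k ∧ 0 < k ∧ s ^ 2 = k * (4 * N + k) ∧
      (k : ℝ) * d = ((d : ℝ) - N) ^ 2 := by
  obtain ⟨e, he⟩ := hd
  have hd0 : 0 < d := by
    rcases Nat.eq_zero_or_pos d with rfl | h
    · have : 0 < N ^ 2 := by positivity
      simp at he
      omega
    · exact h
  rw [he, Nat.mul_div_cancel_left _ hd0]
  have hle : 2 * N ≤ d + e := by
    rw [← Nat.pow_le_pow_iff_left two_ne_zero]
    zify at he ⊢
    nlinarith [sq_nonneg ((d : ℤ) - e)]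
  obtain ⟨k, hk⟩ := Nat.exists_eq_add_of_le hle
  have hez : (N : ℤ) ^ 2 = d * e := by exact_mod_cast he
  have hkz : (d : ℤ) + e = 2 * N + k := by exact_mod_cast hk
  have hs : ((d : ℤ) - e) ^ 2 = k * (4 * N + k) := by
    linear_combination (d + e + 2 * N + k : ℤ) * hkz + 4 * hez
  refine ⟨k, ((d : ℤ) - e).natAbs, hk, ?_, ?_, ?_⟩
  · rcases Nat.eq_zero_or_pos k with rfl | h
    · exfalso
      rw [Nat.cast_zero, zero_mul] at hs
      have := pow_eq_zero_iff two_ne_zero |>.mp hs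
      omega
    · exact h
  · zify
    rw [sq_abs]
    exact hs
  · have her : (N : ℝ) ^ 2 = d * e := by exact_mod_cast he
    have hkr : (d : ℝ) + e = 2 * N + k := by exact_mod_cast hk
    linear_combination (-d : ℝ) * hkr - her

theorem shift_pow_le {N d k : ℕ} {r w l : ℝ} (hN : 0 < N) (hr : r ^ 2 = N) (hr0 : 0 ≤ r)
    (hwr : w ≤ r / 2) (hwl : w ^ 7 = l) (hk : (k : ℝ) * d = ((d : ℝ) - N) ^ 2)
    (h1 : N - r * w ≤ d) (h2 : d ≤ N + r * w) : (k : ℝ) ^ 7 ≤ 128 * l ^ 2 := by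
  have hN' : (0 : ℝ) < N := by exact_mod_cast hN
  have hd : (N : ℝ) / 2 ≤ d := by nlinarith
  have h3 : ((d : ℝ) - N) ^ 2 ≤ (r * w) ^ 2 := sq_le_sq' (by linarith) (by linarith)
  rw [mul_pow, hr, ← hk] at h3
  have h4 : (k : ℝ) * (N / 2) ≤ k * d := by gcongr
  have h5 : (k : ℝ) ≤ 2 * w ^ 2 := by
    have h6 : (k : ℝ) * N ≤ 2 * w ^ 2 * N := by linarith
    exact le_of_mul_le_mul_right h6 hN'
  calc (k : ℝ) ^ 7 ≤ (2 * w ^ 2) ^ 7 := by gcongr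
    _ = 128 * l ^ 2 := by rw [← hwl]; ring

theorem card_fiber_le_two {n : ℕ} {S : Finset ℕ} (hS : S ⊆ n.divisors) (a : ℕ) :
    (S.filter fun d => d + n / d = a).card ≤ 2 := by
  rcases (S.filter fun d => d + n / d = a).eq_empty_or_nonempty with h | ⟨d, hd⟩
  · simp [h]
  refine (Finset.card_le_card (t := {d, n / d}) fun d' hd' => ?_).trans Finset.card_le_two
  rw [Finset.mem_filter] at hd hd'
  have h1 := Nat.mul_div_cancel' (Nat.dvd_of_mem_divisors (hS hd.1))
  have h2 := Nat.mul_div_cancel' (Nat.dvd_of_mem_divisors (hS hd'.1))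
  have h3 := hd.2.trans hd'.2.symm
  rw [Finset.mem_insert, Finset.mem_singleton]
  generalize n / d = e at *
  generalize n / d' = e' at *
  zify at h1 h2 h3 ⊢
  have : ((d' : ℤ) - d) * (d' - e) = 0 := by linear_combination h1 - h2 - d' * h3
  rcases mul_eq_zero.mp this with h | h
  · left; linarith
  · right; linarith

theorem exists_scale {C : ℝ} (B₀ : ℕ) : ∃ c : ℝ, ∀ l : ℝ, c ≤ l → ∃ B : ℕ, B₀ ≤ B ∧ C ≤ B ∧
    (B : ℝ) ^ 1000 ≤ l ∧ l ≤ (B : ℝ) ^ 1001 := by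
  refine ⟨((max (max B₀ ⌈C⌉₊) (2 ^ 1000) : ℕ) : ℝ) ^ 1000, fun l hl => ?_⟩
  have hl0 : 0 ≤ l := le_trans (by positivity) hl
  set y := l ^ ((1 : ℝ) / 1000) with hy
  have hy0 : 0 ≤ y := by positivity
  have hyl : y ^ 1000 = l := by
    rw [hy, ← Real.rpow_natCast, ← Real.rpow_mul hl0]
    norm_num
  rw [← hyl] at hl
  have hle := Nat.le_floor (le_of_pow_le_pow_left₀ (by norm_num) hy0 hl)
  rw [max_le_iff, max_le_iff] at hle
  obtain ⟨⟨h1, h2⟩, h3⟩ := hle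
  have h3' : (2 : ℝ) ^ 1000 ≤ ⌊y⌋₊ := by exact_mod_cast h3
  have h4 : (1 : ℝ) ≤ ⌊y⌋₊ := (one_le_pow₀ one_le_two).trans h3'
  refine ⟨⌊y⌋₊, h1, (Nat.le_ceil C).trans (by exact_mod_cast h2), ?_, ?_⟩
  · rw [← hyl]
    exact pow_le_pow_left₀ (by positivity) (Nat.floor_le hy0) _
  · rw [← hyl]
    calc y ^ 1000 ≤ (2 * ⌊y⌋₊) ^ 1000 := by
          have := (Nat.lt_floor_add_one y).le
          gcongr
          linarith only [this, h4]
      _ = 2 ^ 1000 * (⌊y⌋₊ : ℝ) ^ 1000 := mul_pow _ _ _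
      _ ≤ ⌊y⌋₊ * (⌊y⌋₊ : ℝ) ^ 1000 := by gcongr
      _ = (⌊y⌋₊ : ℝ) ^ 1001 := by rw [← pow_succ']

/-- For large `N`, at most two positive `k` with `k ^ 7 ≤ 512 (log N) ^ 2` make `k (4 N + k)` a
square. -/
theorem card_shifts_le_two : ∃ c : ℝ, ∀ N : ℕ, c ≤ log N → ∀ T : Finset ℕ,
    (∀ k ∈ T, 0 < k ∧ (k : ℝ) ^ 7 ≤ 512 * log N ^ 2 ∧ ∃ s : ℕ, s ^ 2 = k * (4 * N + k)) →
    T.card ≤ 2 := by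
  obtain ⟨C, hC, hpell⟩ := exists_pell_unit_log_le
  obtain ⟨B₀, hB₀⟩ := exists_pow_le_exp
  obtain ⟨c, hc⟩ := exists_scale (C := C) (max B₀ 10000)
  refine ⟨max c 1, fun N hN T hT => ?_⟩
  obtain ⟨B, hBB, hCB, hl1, hl2⟩ := hc _ ((le_max_left c 1).trans hN)
  rw [max_le_iff] at hBB
  have hB' : (10000 : ℝ) ≤ B := by exact_mod_cast hBB.2
  have hB1 : (1 : ℝ) ≤ B := by linarith
  have hN1 : 1 ≤ log (N : ℝ) := (le_max_right c 1).trans hN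
  have hN0 : (0 : ℝ) < N := by
    rcases Nat.eq_zero_or_pos N with h | h
    · rw [h, Nat.cast_zero, Real.log_zero] at hN1
      linarith
    · exact_mod_cast h
  by_contra! hcard
  have hκ := fun i => Finset.orderEmbOfCardLe_mem T hcard i
  have hmono := (T.orderEmbOfCardLe hcard).strictMono
  generalize T.orderEmbOfCardLe hcard = κ at hκ hmono
  have hprop := fun i => hT _ (hκ i)
  choose hpos hpow s hs using hprop
  have hκle : ∀ i, κ i ≤ B ^ 287 := by
    intro i
    have h1 : (κ i : ℝ) ^ 7 ≤ ((B : ℝ) ^ 287) ^ 7 := by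
      calc (κ i : ℝ) ^ 7 ≤ 512 * log N ^ 2 := hpow i
        _ ≤ B * ((B : ℝ) ^ 1001) ^ 2 := by gcongr; linarith
        _ = (B : ℝ) ^ 2003 := by rw [← pow_mul, ← pow_succ']
        _ ≤ (B : ℝ) ^ 2009 := pow_le_pow_right₀ hB1 (by norm_num)
        _ = ((B : ℝ) ^ 287) ^ 7 := by rw [← pow_mul]
    have h2 := le_of_pow_le_pow_left₀ (by norm_num) (by positivity) h1
    exact_mod_cast h2
  have hlog4 : log ((4 * N : ℕ) : ℝ) = log 4 + log N := by
    rw [Nat.cast_mul, Real.log_mul (by norm_num) hN0.ne']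
    norm_num
  have h40 : 0 ≤ log (4 : ℝ) := Real.log_nonneg (by norm_num)
  have h43 : log (4 : ℝ) ≤ 3 := by
    have := Real.log_le_sub_one_of_pos (show (0 : ℝ) < 4 by norm_num)
    linarith
  refine false_of_three_shifts hBB.2 (hB₀ B hBB.1) (hpos 0) (hmono (by decide : (0 : Fin 3) < 1))
    (hmono (by decide : (1 : Fin 3) < 2)) (hκle 2) (hs 0) (hs 1) (hs 2) ?_ ?_ ?_
  · rw [hlog4]
    linarith
  · rw [hlog4]
    have h1 : (B : ℝ) ^ 1002 = B * (B : ℝ) ^ 1001 := pow_succ' _ _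
    have h2 : 10000 * (B : ℝ) ^ 1001 ≤ B * (B : ℝ) ^ 1001 := by gcongr
    linarith
  · intro D hD hDB
    obtain ⟨a, e, he, hae, ha⟩ := hpell D hD
    refine ⟨a, e, he, hae, ha.trans ?_⟩
    have h1 : (D : ℝ) ^ ((13 : ℝ) / 25) ≤ (B : ℝ) ^ 299 := by
      have h2 : (D : ℝ) ≤ (B : ℝ) ^ 574 := by exact_mod_cast hDB
      calc (D : ℝ) ^ ((13 : ℝ) / 25) ≤ ((B : ℝ) ^ 574) ^ ((13 : ℝ) / 25) := by gcongr
        _ = (B : ℝ) ^ ((574 : ℝ) * (13 / 25)) := by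
          rw [← Real.rpow_natCast, ← Real.rpow_mul (by positivity)]
          norm_num
        _ ≤ (B : ℝ) ^ (299 : ℝ) := Real.rpow_le_rpow_of_exponent_le hB1 (by norm_num)
        _ = (B : ℝ) ^ 299 := by exact_mod_cast Real.rpow_natCast (B : ℝ) 299
    calc C * (D : ℝ) ^ ((13 : ℝ) / 25) ≤ B * (B : ℝ) ^ 299 := by gcongr
      _ = (B : ℝ) ^ 300 := (pow_succ' _ _).symm

theorem eventually_log_bounds (c : ℝ) : ∃ n₀ : ℕ, ∀ n : ℕ, n₀ ≤ n →
    c ≤ log n ∧ 1 ≤ log n ∧ log n ≤ (n : ℝ) ^ ((1 : ℝ) / 4) / 2 := by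
  have h1 := Real.tendsto_log_atTop.eventually_ge_atTop c
  have h2 := Real.tendsto_log_atTop.eventually_ge_atTop 1
  have h3 := (isLittleO_log_rpow_atTop (show (0 : ℝ) < 1 / 4 by norm_num)).def
    (show (0 : ℝ) < 1 / 2 by norm_num)
  obtain ⟨n₀, hn₀⟩ := Filter.eventually_atTop.mp
    (tendsto_natCast_atTop_atTop.eventually (h1.and (h2.and h3)))
  refine ⟨n₀, fun n hn => ?_⟩
  obtain ⟨ha, hb, hc⟩ := hn₀ n hn
  refine ⟨ha, hb, (le_abs_self _).trans ?_⟩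
  rw [Real.norm_eq_abs, Real.norm_eq_abs, abs_of_nonneg (by positivity :
    (0 : ℝ) ≤ (n : ℝ) ^ ((1 : ℝ) / 4))] at hc
  linarith

end Asymptotics
end MiddleDivisors

/-- Any sufficiently large perfect square `n = N ^ 2` has at most five divisors between
`√n - n^(1/4) (log n)^(1/7)` and `√n + n^(1/4) (log n)^(1/7)`. -/
theorem perfect_square_few_middle_divisors :
    ∃ n₀ : ℕ, ∀ n N : ℕ, n = N ^ 2 → n₀ ≤ n →
      ((n.divisors.filter (fun (d : ℕ) =>
          Real.sqrt n - (n : ℝ) ^ ((1 : ℝ) / 4) * (Real.log n) ^ ((1 : ℝ) / 7) ≤ (d : ℝ) ∧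
          (d : ℝ) ≤ Real.sqrt n + (n : ℝ) ^ ((1 : ℝ) / 4) * (Real.log n) ^ ((1 : ℝ) / 7))).card
        ≤ 5) := by
  obtain ⟨c, hc⟩ := MiddleDivisors.card_shifts_le_two
  obtain ⟨n₀, hn₀⟩ := MiddleDivisors.eventually_log_bounds (2 * c)
  refine ⟨n₀, fun n N hn hle => ?_⟩
  obtain ⟨h1, h2, h3⟩ := hn₀ n hle
  set r : ℝ := (n : ℝ) ^ ((1 : ℝ) / 4) with hr
  set w : ℝ := log n ^ ((1 : ℝ) / 7) with hw
  set S := n.divisors.filter fun d : ℕ => √(n : ℝ) - r * w ≤ d ∧ (d : ℝ) ≤ √(n : ℝ) + r * w with hS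
  have hlogn : log (n : ℝ) = 2 * log N := by
    rw [hn, Nat.cast_pow, Real.log_pow, Nat.cast_ofNat]
  have hN : 0 < N := by
    rcases Nat.eq_zero_or_pos N with h | h
    · rw [hlogn, h, Nat.cast_zero, Real.log_zero] at h2
      linarith
    · exact h
  have hsqrt : √(n : ℝ) = N := by
    rw [hn, Nat.cast_pow, Real.sqrt_sq (by positivity)]
  have hr2 : r ^ 2 = N := by
    rw [← hsqrt, Real.sqrt_eq_rpow, hr, ← Real.rpow_natCast, ← Real.rpow_mul (by positivity)]
    norm_num
  have hw7 : w ^ 7 = log n := by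
    rw [hw, ← Real.rpow_natCast, ← Real.rpow_mul (by linarith)]
    norm_num
  have hwr : w ≤ r / 2 := by
    refine le_trans ?_ h3
    calc w ≤ log n ^ (1 : ℝ) := Real.rpow_le_rpow_of_exponent_le h2 (by norm_num)
      _ = log n := Real.rpow_one _
  set T := (S.erase N).image fun d => d + n / d with hT
  have hT2 : (T.image fun t => t - 2 * N).card ≤ 2 := by
    refine hc N (by linarith) _ fun k hk => ?_
    simp only [hT, Finset.mem_image, Finset.mem_erase, hS, Finset.mem_filter,
      Nat.mem_divisors] at hk
    obtain ⟨_, ⟨d, ⟨hdN, ⟨hdn, _⟩, hd1, hd2⟩, rfl⟩, rfl⟩ := hk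
    rw [hsqrt] at hd1 hd2
    obtain ⟨k, s, hk1, hk2, hk3, hk4⟩ := MiddleDivisors.exists_shift hN (hn ▸ hdn) hdN
    rw [hn, hk1, Nat.add_sub_cancel_left]
    refine ⟨hk2, ?_, s, hk3⟩
    have h5 := MiddleDivisors.shift_pow_le hN hr2 (by positivity) hwr hw7 hk4
      hd1 hd2
    rw [hlogn] at h5
    linarith
  have hTinj : (T.image fun t => t - 2 * N).card = T.card := by
    refine Finset.card_image_of_injOn fun t ht t' ht' h => ?_
    have hge : ∀ t ∈ T, 2 * N ≤ t := by
      intro t ht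
      simp only [hT, Finset.mem_image, Finset.mem_erase, hS, Finset.mem_filter,
        Nat.mem_divisors] at ht
      obtain ⟨d, ⟨hdN, ⟨hdn, _⟩, _⟩, rfl⟩ := ht
      obtain ⟨k, s, hk1, _⟩ := MiddleDivisors.exists_shift hN (hn ▸ hdn) hdN
      rw [hn, hk1]
      omega
    have := hge t ht
    have := hge t' ht'
    omega
  have hcard := Finset.card_le_mul_card_image (f := fun d => d + n / d) (S.erase N) 2
    fun a _ => MiddleDivisors.card_fiber_le_two
      ((Finset.erase_subset _ _).trans (Finset.filter_subset _ _)) a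
  have := Finset.pred_card_le_card_erase (s := S) (a := N)
  rw [← hT] at hcard
  omega
end
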